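/- arXiv:1402.0080 — 3 statements merged into one kernel-verified Lean document; each statement's English description precedes it below -/
import Mathlib

section
/- Let A ⊂ ℝ^d be a homogeneous set. For every ε > 0 there exists a Moran set F ⊂ A (with inf of the ratio sequence positive) such that d_H(F, A) < ε, 0 ≤ dim_P A − dim_P F < ε and 0 ≤ dim_H A − dim_H F < ε, where d_H is the Hausdorff distance and dim_H, dim_P are the Hausdorff and packing dimensions. -/
open scoped ENNReal

noncomputable section

open Filter MeasureTheory

/-- A compact set `A` is *homogeneous* with respect to the Borel probability measure `μ`
supported on `A` and constants `lam ≥ 1`, `kappa ∈ (0,1)`, `1 < del ≤ Del`. -/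
structure IsHomog {X : Type*} [MetricSpace X] [MeasurableSpace X]
    (A : Set X) (μ : Measure X) (lam kappa del Del : ℝ) : Prop where
  compact : IsCompact A
  diam_pos : 0 < Metric.diam A
  prob : IsProbabilityMeasure μ
  supp_null : μ Aᶜ = 0
  supp_pos : ∀ x ∈ A, ∀ r : ℝ, 0 < r → 0 < μ (Metric.closedBall x r)
  one_le_lam : 1 ≤ lam
  ratio_le : ∀ x₁ ∈ A, ∀ x₂ ∈ A, ∀ r : ℝ, 0 < r → r ≤ Metric.diam A →
    (μ (Metric.closedBall x₁ r)).toReal ≤ lam * (μ (Metric.closedBall x₂ r)).toReal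
  kappa_pos : 0 < kappa
  kappa_lt_one : kappa < 1
  one_lt_del : 1 < del
  del_le_Del : del ≤ Del
  scale_lower : ∀ x ∈ A, ∀ r : ℝ, 0 < r → r ≤ Metric.diam A →
    del * (μ (Metric.closedBall x (kappa * r))).toReal ≤ (μ (Metric.closedBall x r)).toReal
  scale_upper : ∀ x ∈ A, ∀ r : ℝ, 0 < r → r ≤ Metric.diam A →
    (μ (Metric.closedBall x r)).toReal ≤ Del * (μ (Metric.closedBall x (kappa * r))).toReal

/-- `alphaPt μ x r = log μ(B(x,r)) / log r`. -/
def alphaPt {X : Type*} [MetricSpace X] [MeasurableSpace X]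
    (μ : Measure X) (x : X) (r : ℝ) : ℝ :=
  Real.log (μ (Metric.closedBall x r)).toReal / Real.log r

/-- `g ∼ h` : `|h r - g r| = O(1/|log r|)` as `r → 0⁺`. -/
def EquivNearZero (g h : ℝ → ℝ) : Prop :=
  ∃ C : ℝ, 0 < C ∧ ∃ δ : ℝ, 0 < δ ∧ ∀ r : ℝ, 0 < r → r < δ → |h r - g r| ≤ C / |Real.log r|

/-- `g` is a representative of the equivalence class `[α_A(x,·)]` of the homogeneous set `A`. -/
def IsAlphaRep {X : Type*} [MetricSpace X] [MeasurableSpace X]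
    (A : Set X) (μ : Measure X) (g : ℝ → ℝ) : Prop :=
  ∃ x ∈ A, EquivNearZero g (fun r => alphaPt μ x r)

/-- `χ(A,B)` computed from representatives `g` of `[α_A]` and `h` of `[α_B]`. -/
def chiFun (g h : ℝ → ℝ) : ℝ :=
  Filter.limsup (fun r => |Real.log (g r / h r)|) (nhdsWithin (0 : ℝ) (Set.Ioi 0))

/-- `N(A,r)`: the smallest number of closed balls of radius `r` needed to cover `A`. -/
def coverNum {X : Type*} [MetricSpace X] (A : Set X) (r : ℝ) : ℕ :=
  sInf {m : ℕ | ∃ s : Finset X, s.card = m ∧ A ⊆ ⋃ x ∈ s, Metric.closedBall x r}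

/-- Lower box-counting dimension. -/
def lowerBoxDim {X : Type*} [MetricSpace X] (A : Set X) : ℝ :=
  Filter.liminf (fun r : ℝ => Real.log (coverNum A r : ℝ) / (-Real.log r))
    (nhdsWithin (0 : ℝ) (Set.Ioi 0))

/-- Upper box-counting dimension. -/
def upperBoxDim {X : Type*} [MetricSpace X] (A : Set X) : ℝ :=
  Filter.limsup (fun r : ℝ => Real.log (coverNum A r : ℝ) / (-Real.log r))
    (nhdsWithin (0 : ℝ) (Set.Ioi 0))

/-- Radius-based packing premeasure. -/
def packPre {X : Type*} [MetricSpace X] (A : Set X) (s : ℝ) : ℝ≥0∞ :=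
  ⨅ (δ : ℝ) (_ : 0 < δ),
    ⨆ (m : ℕ) (x : Fin m → X) (ρ : Fin m → ℝ) (_ : ∀ i, x i ∈ A)
      (_ : ∀ i, 0 < ρ i ∧ ρ i ≤ δ)
      (_ : ∀ i j, i ≠ j →
        Disjoint (Metric.closedBall (x i) (ρ i)) (Metric.closedBall (x j) (ρ j))),
      ∑ i, ENNReal.ofReal (ρ i ^ s)

/-- Radius-based packing measure. -/
def packMeasure {X : Type*} [MetricSpace X] (A : Set X) (s : ℝ) : ℝ≥0∞ :=
  ⨅ (F : ℕ → Set X) (_ : A ⊆ ⋃ m, F m), ∑' m, packPre (F m) s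

/-- Radius-based packing dimension. -/
def packDim {X : Type*} [MetricSpace X] (A : Set X) : ℝ :=
  sInf {s : ℝ | 0 ≤ s ∧ packMeasure A s = 0}

/-- Distance between two sets, valued in `ℝ≥0∞`. -/
def setDistE {X : Type*} [MetricSpace X] (E F : Set X) : ℝ≥0∞ :=
  ⨅ (a : X) (_ : a ∈ E) (b : X) (_ : b ∈ F), edist a b

/-- Uniformly disconnected set. -/
def UnifDisconn {X : Type*} [MetricSpace X] (A : Set X) : Prop :=
  ∃ C : ℝ, 1 < C ∧ ∃ rstar : ℝ, 0 < rstar ∧ ∀ x ∈ A, ∀ r : ℝ, 0 < r → r < rstar →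
    ∃ E : Set X, E ⊆ A ∧ A ∩ Metric.closedBall x r ⊆ E ∧
      E ⊆ Metric.closedBall x (C * r) ∧ ENNReal.ofReal r < setDistE E (A \ E)

/-- `A` can be bilipschitz embedded into `B`. -/
def BilipEmbed {X Y : Type*} [MetricSpace X] [MetricSpace Y] (A : Set X) (B : Set Y) : Prop :=
  ∃ (f : X → Y) (L : ℝ), 1 ≤ L ∧ Set.MapsTo f A B ∧ Set.InjOn f A ∧
    ∀ x₁ ∈ A, ∀ x₂ ∈ A,
      dist x₁ x₂ / L ≤ dist (f x₁) (f x₂) ∧ dist (f x₁) (f x₂) ≤ L * dist x₁ x₂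

/-- `A` and `B` are bilipschitz equivalent. -/
def BilipEquivSets {X Y : Type*} [MetricSpace X] [MetricSpace Y] (A : Set X) (B : Set Y) :
    Prop :=
  ∃ (f : X → Y) (L : ℝ), 1 ≤ L ∧ Set.BijOn f A B ∧
    ∀ x₁ ∈ A, ∀ x₂ ∈ A,
      dist x₁ x₂ / L ≤ dist (f x₁) (f x₂) ∧ dist (f x₁) (f x₂) ≤ L * dist x₁ x₂

/-- `A` and `B` are quasi-Lipschitz equivalent. -/
def QuasiLipEquiv {X Y : Type*} [MetricSpace X] [MetricSpace Y] (A : Set X) (B : Set Y) : Prop :=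
  ∃ f : X → Y, Set.BijOn f A B ∧
    ∀ ε : ℝ, 0 < ε → ∃ δ : ℝ, 0 < δ ∧ ∀ x₁ ∈ A, ∀ x₂ ∈ A,
      0 < dist x₁ x₂ → dist x₁ x₂ < δ →
      |Real.log (dist (f x₁) (f x₂)) / Real.log (dist x₁ x₂) - 1| < ε

/-- Ahlfors–David `s`-regular set. -/
def IsADRegular {X : Type*} [MetricSpace X] [MeasurableSpace X] (A : Set X) (s : ℝ) : Prop :=
  IsCompact A ∧ 0 < Metric.diam A ∧
    ∃ (μ : Measure X) (c : ℝ), 1 ≤ c ∧ μ Aᶜ = 0 ∧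
      ∀ x ∈ A, ∀ r : ℝ, 0 < r → r ≤ Metric.diam A →
        ENNReal.ofReal (c⁻¹ * r ^ s) ≤ μ (Metric.closedBall x r) ∧
          μ (Metric.closedBall x r) ≤ ENNReal.ofReal (c * r ^ s)

/-- `n₁ ⋯ n_k` (with `0`-based indexing of the sequence `n`). -/
def prodN (n : ℕ → ℕ) (k : ℕ) : ℕ := ∏ i ∈ Finset.range k, n i

/-- `c₁ ⋯ c_k` (with `0`-based indexing of the sequence `c`). -/
def prodC (c : ℕ → ℝ) (k : ℕ) : ℝ := ∏ i ∈ Finset.range k, c i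

/-- Admissible word for the branching sequence `n`. -/
def AdmWord (n : ℕ → ℕ) (w : List ℕ) : Prop := ∀ i : Fin w.length, w.get i < n i.val

/-- A Moran structure on `J ⊆ ℝ^d` with branching numbers `n` and ratios `c`:
`Jw w` is the basic set indexed by the word `w`. -/
structure IsMoranSystem {d : ℕ} (J : Set (EuclideanSpace ℝ (Fin d))) (n : ℕ → ℕ)
    (c : ℕ → ℝ) (Jw : List ℕ → Set (EuclideanSpace ℝ (Fin d))) : Prop where
  compact : IsCompact J
  int_nonempty : (interior J).Nonempty
  two_le_n : ∀ k, 2 ≤ n k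
  c_pos : ∀ k, 0 < c k
  c_lt_one : ∀ k, c k < 1
  c_inf_pos : ∃ c₀ : ℝ, 0 < c₀ ∧ ∀ k, c₀ ≤ c k
  root : Jw [] = J
  subset : ∀ w : List ℕ, AdmWord n w → ∀ i : ℕ, i < n w.length → Jw (w ++ [i]) ⊆ Jw w
  similar : ∀ w : List ℕ, AdmWord n w → ∀ i : ℕ, i < n w.length →
    ∃ S : EuclideanSpace ℝ (Fin d) → EuclideanSpace ℝ (Fin d),
      (∀ x y, dist (S x) (S y) = c w.length * dist x y) ∧ Jw (w ++ [i]) = S '' Jw w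
  disj_int : ∀ w : List ℕ, AdmWord n w → ∀ i : ℕ, i < n w.length → ∀ j : ℕ, j < n w.length →
    i ≠ j → Disjoint (interior (Jw (w ++ [i]))) (interior (Jw (w ++ [j])))

/-- The Moran set determined by the family `Jw`. -/
def moranSet {d : ℕ} (n : ℕ → ℕ) (Jw : List ℕ → Set (EuclideanSpace ℝ (Fin d))) :
    Set (EuclideanSpace ℝ (Fin d)) :=
  ⋂ k : ℕ, ⋃ (w : List ℕ) (_ : w.length = k ∧ AdmWord n w), Jw w

/-- The index `k` such that `(c₁⋯c_k)·D < r ≤ (c₁⋯c_{k-1})·D`. -/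
def levelOf (c : ℕ → ℝ) (D r : ℝ) : ℕ := sInf {k : ℕ | prodC c k * D < r}

/-- `Φ(r) = n₁⋯n_k` whenever `(c₁⋯c_k)·D < r ≤ (c₁⋯c_{k-1})·D`, where `D = |J|`. -/
def Phi (n : ℕ → ℕ) (c : ℕ → ℝ) (D r : ℝ) : ℕ := prodN n (levelOf c D r)

section Homogeneous

variable {X : Type*} [MetricSpace X] [MeasurableSpace X] {A : Set X} {μ : Measure X}
  {lam kappa del Del : ℝ}

theorem IsHomog.lam_pos (hA : IsHomog A μ lam kappa del Del) : 0 < lam :=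
  zero_lt_one.trans_le hA.one_le_lam

theorem IsHomog.real_pos (hA : IsHomog A μ lam kappa del Del) {x : X} (hx : x ∈ A) {r : ℝ}
    (hr : 0 < r) : 0 < μ.real (Metric.closedBall x r) := by
  have := hA.prob
  exact ENNReal.toReal_pos (hA.supp_pos x hx r hr).ne' (measure_ne_top _ _)

theorem IsHomog.real_le_pow_mul (hA : IsHomog A μ lam kappa del Del) {x : X} (hx : x ∈ A) {r : ℝ}
    (hr : 0 < r) (hr' : r ≤ Metric.diam A) (p : ℕ) :
    μ.real (Metric.closedBall x r) ≤ Del ^ p * μ.real (Metric.closedBall x (kappa ^ p * r)) := by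
  have hk := hA.kappa_pos
  have hD : 0 < Del := by linarith [hA.one_lt_del, hA.del_le_Del]
  induction p with
  | zero => simp
  | succ p ih =>
    refine ih.trans ?_
    have h1 : kappa ^ p * r ≤ Metric.diam A :=
      (mul_le_of_le_one_left hr.le (pow_le_one₀ hk.le hA.kappa_lt_one.le)).trans hr'
    have h2 := hA.scale_upper x hx (kappa ^ p * r) (by positivity) h1
    rw [pow_succ, pow_succ, mul_assoc, mul_comm (kappa ^ p) kappa, mul_assoc kappa]
    exact mul_le_mul_of_nonneg_left h2 (by positivity)

theorem IsHomog.pow_mul_real_le (hA : IsHomog A μ lam kappa del Del) {x : X} (hx : x ∈ A) {r : ℝ}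
    (hr : 0 < r) (hr' : r ≤ Metric.diam A) (p : ℕ) :
    del ^ p * μ.real (Metric.closedBall x (kappa ^ p * r)) ≤ μ.real (Metric.closedBall x r) := by
  have hk := hA.kappa_pos
  have hD : 0 < del := by linarith [hA.one_lt_del]
  induction p with
  | zero => simp
  | succ p ih =>
    refine le_trans ?_ ih
    have h1 : kappa ^ p * r ≤ Metric.diam A :=
      (mul_le_of_le_one_left hr.le (pow_le_one₀ hk.le hA.kappa_lt_one.le)).trans hr'
    have h2 := hA.scale_lower x hx (kappa ^ p * r) (by positivity) h1
    rw [pow_succ, pow_succ, mul_assoc, mul_comm (kappa ^ p) kappa, mul_assoc kappa]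
    exact mul_le_mul_of_nonneg_left h2 (by positivity)

theorem IsHomog.exists_contraction (hA : IsHomog A μ lam kappa del Del) {τ : ℝ} (hτ : 0 < τ) :
    ∃ D : ℝ, 1 ≤ D ∧ ∀ x ∈ A, ∀ r : ℝ, 0 < r → r ≤ Metric.diam A →
      μ.real (Metric.closedBall x r) ≤ D * μ.real (Metric.closedBall x (τ * r)) := by
  have := hA.prob
  obtain ⟨p, hp⟩ := exists_pow_lt_of_lt_one hτ hA.kappa_lt_one
  have hD : 1 ≤ Del := by linarith [hA.one_lt_del, hA.del_le_Del]
  refine ⟨Del ^ p, one_le_pow₀ hD, fun x hx r hr hr' ↦ (hA.real_le_pow_mul hx hr hr' p).trans ?_⟩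
  gcongr
  exact measure_ne_top _ _

theorem IsHomog.exists_expansion (hA : IsHomog A μ lam kappa del Del) (M : ℝ) :
    ∃ τ : ℝ, 0 < τ ∧ ∀ ρ : ℝ, ρ ≤ τ → ∀ x ∈ A, ∀ r : ℝ, 0 < r → r ≤ Metric.diam A →
      M * μ.real (Metric.closedBall x (ρ * r)) ≤ μ.real (Metric.closedBall x r) := by
  have := hA.prob
  obtain ⟨p, hp⟩ := pow_unbounded_of_one_lt M hA.one_lt_del
  refine ⟨kappa ^ p, pow_pos hA.kappa_pos p, fun ρ hρ x hx r hr hr' ↦ ?_⟩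
  refine le_trans ?_ (hA.pow_mul_real_le hx hr hr' p)
  have hd : 0 < del := by linarith [hA.one_lt_del]
  gcongr
  exact measure_ne_top _ _

theorem IsHomog.card_mul_le [OpensMeasurableSpace X] (hA : IsHomog A μ lam kappa del Del)
    {x₀ : X} (hx₀ : x₀ ∈ A) {r : ℝ} (hr : 0 < r) (hr' : r ≤ Metric.diam A) {T : Finset X}
    (hTA : ∀ x ∈ T, x ∈ A) (hT : ∀ x ∈ T, ∀ y ∈ T, x ≠ y → 2 * r < dist x y) {V : Set X}
    (hV : ∀ x ∈ T, Metric.closedBall x r ⊆ V) :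
    T.card * μ.real (Metric.closedBall x₀ r) ≤ lam * μ.real V := by
  have := hA.prob
  have hlam := hA.lam_pos
  calc T.card * μ.real (Metric.closedBall x₀ r)
      = ∑ x ∈ T, μ.real (Metric.closedBall x₀ r) := by simp
    _ ≤ ∑ x ∈ T, lam * μ.real (Metric.closedBall x r) :=
        Finset.sum_le_sum fun x hx ↦ hA.ratio_le x₀ hx₀ x (hTA x hx) r hr hr'
    _ = lam * μ.real (⋃ x ∈ T, Metric.closedBall x r) := by
        rw [← Finset.mul_sum, measureReal_biUnion_finset]
        · intro x hx y hy hxy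
          exact Metric.closedBall_disjoint_closedBall (by linarith [hT x hx y hy hxy])
        · exact fun x _ ↦ Metric.isClosed_closedBall.measurableSet
    _ ≤ lam * μ.real V :=
        mul_le_mul_of_nonneg_left (measureReal_mono (Set.iUnion₂_subset hV)) hlam.le

theorem IsHomog.exists_separated_cover [OpensMeasurableSpace X]
    (hA : IsHomog A μ lam kappa del Del) {S : Set X} (hS : S ⊆ A) {r : ℝ} (hr : 0 < r)
    (hr' : r ≤ Metric.diam A) :
    ∃ T : Finset X, (∀ x ∈ T, x ∈ S) ∧ (∀ x ∈ T, ∀ y ∈ T, x ≠ y → 2 * r < dist x y) ∧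
      ∀ y ∈ S, ∃ x ∈ T, dist y x ≤ 2 * r := by
  classical
  have := hA.prob
  rcases S.eq_empty_or_nonempty with rfl | ⟨x₀, hx₀⟩
  · exact ⟨∅, by simp⟩
  have hpos := hA.real_pos (hS hx₀) hr
  let P : Set ℕ := {m | ∃ T : Finset X, T.card = m ∧ (∀ x ∈ T, x ∈ S) ∧
    ∀ x ∈ T, ∀ y ∈ T, x ≠ y → 2 * r < dist x y}
  have hP : P.Nonempty := ⟨0, ∅, by simp⟩
  have hPb : BddAbove P := by
    refine ⟨⌊lam * μ.real Set.univ / μ.real (Metric.closedBall x₀ r)⌋₊, ?_⟩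
    rintro m ⟨T, rfl, hTS, hT⟩
    refine Nat.le_floor ((le_div_iff₀ hpos).2 ?_)
    exact hA.card_mul_le (hS hx₀) hr hr' (fun x hx ↦ hS (hTS x hx)) hT fun _ _ ↦ Set.subset_univ _
  obtain ⟨T, hTc, hTS, hT⟩ := Nat.sSup_mem hP hPb
  refine ⟨T, hTS, hT, fun y hy ↦ ?_⟩
  by_contra! hcon
  have hyT : y ∉ T := fun h ↦ by
    have := hcon y h
    rw [dist_self] at this
    linarith
  have hmem : (insert y T).card ∈ P := by
    refine ⟨insert y T, rfl, ?_, ?_⟩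
    · simpa using ⟨hy, hTS⟩
    · intro a ha b hb hab
      rcases Finset.mem_insert.1 ha with h | ha' <;> rcases Finset.mem_insert.1 hb with h' | hb'
      · exact absurd (h.trans h'.symm) hab
      · exact h ▸ hcon b hb'
      · rw [dist_comm]; exact h' ▸ hcon a ha'
      · exact hT a ha' b hb' hab
  have := le_csSup hPb hmem
  rw [Finset.card_insert_of_notMem hyT, hTc] at this
  omega

theorem IsHomog.real_le_card_mul (hA : IsHomog A μ lam kappa del Del) {x₀ : X} (hx₀ : x₀ ∈ A)
    {r : ℝ} (hr : 0 < r) (hr' : r ≤ Metric.diam A) {T : Finset X} (hTA : ∀ x ∈ T, x ∈ A)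
    {V : Set X} (hV : ∀ y ∈ A ∩ V, ∃ x ∈ T, dist y x ≤ r) :
    μ.real V ≤ T.card * (lam * μ.real (Metric.closedBall x₀ r)) := by
  have := hA.prob
  have hlam := hA.lam_pos
  have h1 : μ.real V ≤ μ.real (⋃ x ∈ T, Metric.closedBall x r) := by
    have h2 : V ⊆ (⋃ x ∈ T, Metric.closedBall x r) ∪ Aᶜ := by
      intro y hy
      by_cases hyA : y ∈ A
      · obtain ⟨x, hx, hxy⟩ := hV y ⟨hyA, hy⟩
        exact Or.inl (Set.mem_biUnion hx hxy)
      · exact Or.inr hyA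
    refine ENNReal.toReal_mono (measure_ne_top _ _) ?_
    calc μ V ≤ _ := measure_mono h2
      _ ≤ _ := measure_union_le _ _
      _ = _ := by rw [hA.supp_null, add_zero]
  calc μ.real V ≤ _ := h1
    _ ≤ ∑ x ∈ T, μ.real (Metric.closedBall x r) := measureReal_biUnion_finset_le _ _
    _ ≤ ∑ x ∈ T, lam * μ.real (Metric.closedBall x₀ r) :=
        Finset.sum_le_sum fun x hx ↦ hA.ratio_le x (hTA x hx) x₀ hx₀ r hr hr'
    _ = _ := by simp

/-- Inside a ball of radius `r` centred on a homogeneous set one finds many disjoint balls of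
radius `ρ * r` centred on the set. -/
theorem IsHomog.exists_separated_card [OpensMeasurableSpace X]
    (hA : IsHomog A μ lam kappa del Del) {D : ℝ}
    (hD : ∀ x ∈ A, ∀ r : ℝ, 0 < r → r ≤ Metric.diam A →
      μ.real (Metric.closedBall x r) ≤ D * μ.real (Metric.closedBall x (2⁻¹ * r)))
    (hD1 : 1 ≤ D) {x₀ : X} (hx₀ : x₀ ∈ A) {x : X} (hx : x ∈ A) {r ρ : ℝ} (hr : 0 < r)
    (hr' : r ≤ Metric.diam A) (hρ : 0 < ρ) (hρ' : ρ ≤ 2⁻¹) :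
    ∃ T : Finset X, (∀ y ∈ T, y ∈ A) ∧ (∀ y ∈ T, dist y x ≤ 2⁻¹ * r) ∧
      (∀ y ∈ T, ∀ z ∈ T, y ≠ z → 2 * (ρ * r) < dist y z) ∧
      μ.real (Metric.closedBall x₀ r) ≤
        (lam ^ 2 * D ^ 2) * (T.card * μ.real (Metric.closedBall x₀ (ρ * r))) := by
  have := hA.prob
  have hlam := hA.lam_pos
  have h2 : 2 * (ρ * r) ≤ Metric.diam A := by nlinarith
  have h1 : ρ * r ≤ Metric.diam A := by nlinarith
  obtain ⟨T, hTS, hT, hcov⟩ := hA.exists_separated_cover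
    (S := A ∩ Metric.closedBall x (2⁻¹ * r)) Set.inter_subset_left (r := ρ * r) (by positivity) h1
  refine ⟨T, fun y hy ↦ (hTS y hy).1, fun y hy ↦ (hTS y hy).2, hT, ?_⟩
  have h3 := hA.real_le_card_mul hx₀ (r := 2 * (ρ * r)) (by positivity) h2
    (fun y hy ↦ (hTS y hy).1) hcov
  have h4 := hD x₀ hx₀ (2 * (ρ * r)) (by positivity) h2
  rw [show 2⁻¹ * (2 * (ρ * r)) = ρ * r by ring] at h4
  calc μ.real (Metric.closedBall x₀ r) ≤ lam * μ.real (Metric.closedBall x r) :=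
        hA.ratio_le x₀ hx₀ x hx r hr hr'
    _ ≤ lam * (D * μ.real (Metric.closedBall x (2⁻¹ * r))) := by gcongr; exact hD x hx r hr hr'
    _ ≤ lam * (D * (T.card * (lam * (D * μ.real (Metric.closedBall x₀ (ρ * r)))))) := by
        gcongr
        exact h3.trans (by gcongr)
    _ = _ := by ring

end Homogeneous

section Tree

theorem admWord_append {n : ℕ → ℕ} {w : List ℕ} {i : ℕ} :
    AdmWord n (w ++ [i]) ↔ AdmWord n w ∧ i < n w.length := by
  simp only [AdmWord, Fin.forall_iff, List.get_eq_getElem, List.length_append,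
    List.length_singleton]
  constructor
  · intro h
    refine ⟨fun j hj ↦ ?_, ?_⟩
    · simpa [List.getElem_append_left hj] using h j (by omega)
    · simpa using h w.length (by omega)
  · rintro ⟨h, hi⟩ j hj
    rcases Nat.lt_or_ge j w.length with hj' | hj'
    · simpa [List.getElem_append_left hj'] using h j hj'
    · obtain rfl : j = w.length := by omega
      simpa using hi

/-- `x` assigns to each admissible word a point of `A`, in such a way that the closed balls of
radius `R * ρ ^ k` around the points of words of length `k` form a nested, disjoint system. -/
structure IsBallTree {X : Type*} [MetricSpace X] (A : Set X) (n : ℕ → ℕ) (R ρ : ℝ)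
    (x : List ℕ → X) : Prop where
  mem : ∀ w, AdmWord n w → x w ∈ A
  nested : ∀ w, AdmWord n w → ∀ i < n w.length,
    dist (x (w ++ [i])) (x w) + R * ρ ^ (w.length + 1) ≤ R * ρ ^ w.length
  separated : ∀ w, AdmWord n w → ∀ i < n w.length, ∀ j < n w.length, i ≠ j →
    2 * (R * ρ ^ (w.length + 1)) < dist (x (w ++ [i])) (x (w ++ [j]))

/-- The word formed by the first `k` letters of `ω`. -/
def prefixWord {n : ℕ → ℕ} (ω : ∀ i, Fin (n i)) (k : ℕ) : List ℕ :=
  (List.range k).map fun i ↦ (ω i : ℕ)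

section

variable {n : ℕ → ℕ} (ω : ∀ i, Fin (n i))

@[simp] theorem length_prefixWord (k : ℕ) : (prefixWord ω k).length = k := by simp [prefixWord]

theorem prefixWord_succ (k : ℕ) : prefixWord ω (k + 1) = prefixWord ω k ++ [(ω k : ℕ)] := by
  simp [prefixWord, List.range_succ]

theorem admWord_prefixWord (k : ℕ) : AdmWord n (prefixWord ω k) := by
  rintro ⟨i, hi⟩
  simp only [prefixWord, List.get_eq_getElem, List.getElem_map]
  exact (ω _).isLt.trans_eq (congrArg n (by simp))

theorem eq_of_prefixWord_eq {ω ω' : ∀ i, Fin (n i)} {k : ℕ}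
    (h : prefixWord ω k = prefixWord ω' k) {i : ℕ} (hi : i < k) : ω i = ω' i := by
  have := List.map_inj_left.1 h i (List.mem_range.2 hi)
  exact Fin.ext this

theorem measurableSet_prefixWord_eq (k : ℕ) (w : List ℕ) :
    MeasurableSet {ω : ∀ i, Fin (n i) | prefixWord ω k = w} := by
  induction k generalizing w with
  | zero => simp [prefixWord]
  | succ k ih =>
    have : {ω : ∀ i, Fin (n i) | prefixWord ω (k + 1) = w} =
        ⋃ (u : List ℕ) (i : ℕ) (_ : u ++ [i] = w),
          {ω : ∀ i, Fin (n i) | prefixWord ω k = u} ∩ {ω | (ω k : ℕ) = i} := by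
      ext ω
      simp [prefixWord_succ]
    rw [this]
    refine .iUnion fun u ↦ .iUnion fun i ↦ .iUnion fun _ ↦ (ih u).inter ?_
    have hs : MeasurableSet {j : Fin (n k) | (j : ℕ) = i} := .of_discrete
    exact hs.preimage (measurable_pi_apply k)

end

theorem exists_measure_prefixWord (n : ℕ → ℕ) (hn : ∀ k, n k ≠ 0) :
    ∃ P : Measure (∀ i, Fin (n i)), IsProbabilityMeasure P ∧
      ∀ k w, P {ω | prefixWord ω k = w} ≤ (prodN n k : ℝ≥0∞)⁻¹ := by
  have (i : ℕ) : NeZero (n i) := ⟨hn i⟩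
  let Q : ∀ i, Measure (Fin (n i)) := fun i ↦ (PMF.uniformOfFintype (Fin (n i))).toMeasure
  have hQ (i : ℕ) (a : Fin (n i)) : Q i {a} = (n i : ℝ≥0∞)⁻¹ := by
    simp [Q]
  refine ⟨Measure.infinitePi Q, inferInstance, fun k w ↦ ?_⟩
  rcases Set.eq_empty_or_nonempty {ω : ∀ i, Fin (n i) | prefixWord ω k = w} with h | ⟨ω₀, hω₀⟩
  · simp [h]
  calc Measure.infinitePi Q {ω | prefixWord ω k = w}
      ≤ Measure.infinitePi Q (Set.pi (Finset.range k) fun i ↦ {ω₀ i}) := by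
        refine measure_mono fun ω hω i hi ↦ ?_
        exact eq_of_prefixWord_eq (hω.trans hω₀.symm) (Finset.mem_range.1 hi)
    _ = ∏ i ∈ Finset.range k, (n i : ℝ≥0∞)⁻¹ := by
        rw [Measure.infinitePi_pi _ fun i _ ↦ measurableSet_singleton _]
        exact Finset.prod_congr rfl fun i _ ↦ hQ i _
    _ = _ := by
        rw [prodN, Nat.cast_prod, ENNReal.prod_inv_distrib]
        intro i _ j _ _
        simp [hn]

namespace IsBallTree

variable {X : Type*} [MetricSpace X] {A : Set X} {n : ℕ → ℕ} {R ρ : ℝ} {x : List ℕ → X}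

theorem separated_of_length_eq (hx : IsBallTree A n R ρ x) :
    ∀ (k : ℕ) (w w' : List ℕ), AdmWord n w → AdmWord n w' → w.length = k → w'.length = k → w ≠ w' →
      2 * (R * ρ ^ k) < dist (x w) (x w') := by
  intro k
  induction k with
  | zero =>
    intro w w' _ _ h h' hne
    rw [List.length_eq_zero_iff] at h h'
    exact absurd (h.trans h'.symm) hne
  | succ k ih =>
    intro w w' hw hw' h h' hne
    obtain ⟨u, i, rfl⟩ := List.eq_nil_or_concat' w |>.resolve_left (by rintro rfl; simp at h)
    obtain ⟨v, j, rfl⟩ := List.eq_nil_or_concat' w' |>.resolve_left (by rintro rfl; simp at h')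
    rw [admWord_append] at hw hw'
    have hu : u.length = k := by simpa using h
    have hv : v.length = k := by simpa using h'
    by_cases huv : u = v
    · subst huv
      have := hx.separated u hw.1 i hw.2 j hw'.2 (by rintro rfl; exact hne rfl)
      rwa [hu] at this
    · have h1 := ih u v hw.1 hw'.1 hu hv huv
      have h2 := hx.nested u hw.1 i hw.2
      have h3 := hx.nested v hw'.1 j hw'.2
      rw [hu] at h2
      rw [hv] at h3
      have h4 := dist_triangle4 (x u) (x (u ++ [i])) (x (v ++ [j])) (x v)
      rw [dist_comm (x u) (x (u ++ [i]))] at h4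
      linarith

theorem exists_coding [CompleteSpace X] (hx : IsBallTree A n R ρ x) (hR : 0 < R) (hρ : 0 < ρ)
    (hρ1 : ρ < 1) (ω : ∀ i, Fin (n i)) :
    ∃ p : X, ∀ k, dist p (x (prefixWord ω k)) ≤ R * ρ ^ k := by
  have hstep (k : ℕ) : dist (x (prefixWord ω (k + 1))) (x (prefixWord ω k)) + R * ρ ^ (k + 1) ≤
      R * ρ ^ k := by
    have := hx.nested _ (admWord_prefixWord ω k) (ω k) (by simp)
    rwa [length_prefixWord, ← prefixWord_succ] at this
  have hc : CauchySeq fun k ↦ x (prefixWord ω k) := by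
    refine cauchySeq_of_le_geometric ρ R hρ1 fun k ↦ ?_
    rw [dist_comm]
    have : 0 ≤ R * ρ ^ (k + 1) := by positivity
    linarith [hstep k]
  obtain ⟨p, hp⟩ := cauchySeq_tendsto_of_complete hc
  refine ⟨p, fun k ↦ ?_⟩
  refine le_of_tendsto (hp.dist tendsto_const_nhds) ?_
  filter_upwards [eventually_ge_atTop k] with j hj
  suffices h : dist (x (prefixWord ω j)) (x (prefixWord ω k)) + R * ρ ^ j ≤ R * ρ ^ k by
    have : 0 ≤ R * ρ ^ j := by positivity
    linarith
  induction j, hj using Nat.le_induction with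
  | base => simp
  | succ j hj ih =>
    have := dist_triangle (x (prefixWord ω (j + 1))) (x (prefixWord ω j)) (x (prefixWord ω k))
    linarith [hstep j]

/-- The uniform measure on the limit set of a ball tree. -/
theorem exists_measure [CompleteSpace X] [MeasurableSpace X] [BorelSpace X]
    (hx : IsBallTree A n R ρ x) (hR : 0 < R) (hρ : 0 < ρ) (hρ1 : ρ < 1) (hn : ∀ k, n k ≠ 0) :
    ∃ ν : Measure X,
      1 ≤ ν (⋂ k : ℕ, ⋃ (w : List ℕ) (_ : w.length = k ∧ AdmWord n w),
        Metric.closedBall (x w) (R * ρ ^ w.length)) ∧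
      ∀ (k : ℕ) (B : Set X), MeasurableSet B → ∀ K : ℝ≥0∞,
        (∀ W : Finset (List ℕ), (∀ w ∈ W, w.length = k ∧ AdmWord n w ∧
          ∃ p ∈ B, dist p (x w) ≤ R * ρ ^ k) → (W.card : ℝ≥0∞) ≤ K) →
        ν B ≤ K * (prodN n k : ℝ≥0∞)⁻¹ := by
  obtain ⟨P, hP, hcyl⟩ := exists_measure_prefixWord n hn
  choose π hπ using fun ω ↦ hx.exists_coding hR hρ hρ1 ω
  have hlim : Tendsto (fun k ↦ R * ρ ^ k) atTop (nhds 0) := by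
    simpa using (tendsto_pow_atTop_nhds_zero_of_lt_one hρ.le hρ1).const_mul R
  have hmeas : Measurable π := by
    refine measurable_of_tendsto_metrizable (f := fun k ω ↦ x (prefixWord ω k)) (fun k ↦ ?_) ?_
    · intro s _
      have : (fun ω : ∀ i, Fin (n i) ↦ x (prefixWord ω k)) ⁻¹' s =
          ⋃ (w : List ℕ) (_ : x w ∈ s), {ω | prefixWord ω k = w} := by
        ext ω
        simp
      rw [this]
      exact .iUnion fun w ↦ .iUnion fun _ ↦ measurableSet_prefixWord_eq k w
    · rw [tendsto_pi_nhds]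
      intro ω
      rw [tendsto_iff_dist_tendsto_zero]
      refine squeeze_zero (fun _ ↦ dist_nonneg) (fun k ↦ ?_) hlim
      rw [dist_comm]
      exact hπ ω k
  refine ⟨P.map π, ?_, fun k B hB K hK ↦ ?_⟩
  · refine le_trans ?_ (Measure.le_map_apply hmeas.aemeasurable _)
    rw [← measure_univ (μ := P)]
    refine measure_mono fun ω _ ↦ Set.mem_iInter.2 fun k ↦ ?_
    refine Set.mem_iUnion₂.2 ⟨prefixWord ω k, ⟨by simp, admWord_prefixWord ω k⟩, ?_⟩
    simpa using hπ ω k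
  · rw [Measure.map_apply hmeas hB]
    let S : Set (List ℕ) := {w | w.length = k ∧ AdmWord n w ∧ ∃ p ∈ B, dist p (x w) ≤ R * ρ ^ k}
    calc P (π ⁻¹' B) ≤ P (⋃ w : S, {ω | prefixWord ω k = w}) := by
          refine measure_mono fun ω hω ↦ Set.mem_iUnion.2 ⟨⟨prefixWord ω k, ?_⟩, rfl⟩
          exact ⟨by simp, admWord_prefixWord ω k, π ω, hω, hπ ω k⟩
      _ ≤ ∑' w : S, P {ω | prefixWord ω k = w} := measure_iUnion_le _
      _ ≤ ∑' w : S, (prodN n k : ℝ≥0∞)⁻¹ := ENNReal.tsum_le_tsum fun w ↦ hcyl k w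
      _ ≤ K * (prodN n k : ℝ≥0∞)⁻¹ := by
          rw [ENNReal.tsum_eq_iSup_sum]
          refine iSup_le fun W ↦ ?_
          rw [Finset.sum_const, nsmul_eq_mul]
          gcongr
          have := hK (W.map (Function.Embedding.subtype _)) (by
            intro w hw
            obtain ⟨v, -, rfl⟩ := Finset.mem_map.1 hw
            exact v.2)
          simpa using this

end IsBallTree

end Tree

section Moran

variable {d : ℕ} {A : Set (EuclideanSpace ℝ (Fin d))} {n : ℕ → ℕ} {R ρ : ℝ}
  {x : List ℕ → EuclideanSpace ℝ (Fin d)}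

theorem IsBallTree.isMoranSystem (hx : IsBallTree A n R ρ x) (hn : ∀ k, 2 ≤ n k) (hR : 0 < R)
    (hρ : 0 < ρ) (hρ1 : ρ < 1) :
    IsMoranSystem (Metric.closedBall (x []) R) n (fun _ ↦ ρ)
      (fun w ↦ Metric.closedBall (x w) (R * ρ ^ w.length)) where
  compact := isCompact_closedBall _ _
  int_nonempty := ⟨x [], Metric.ball_subset_interior_closedBall (Metric.mem_ball_self hR)⟩
  two_le_n := hn
  c_pos _ := hρ
  c_lt_one _ := hρ1
  c_inf_pos := ⟨ρ, hρ, fun _ ↦ le_rfl⟩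
  root := by simp
  subset w hw i hi := by
    refine Metric.closedBall_subset_closedBall' ?_
    have := hx.nested w hw i hi
    simp only [List.length_append, List.length_singleton]
    linarith
  similar w hw i hi := by
    refine ⟨fun y ↦ x (w ++ [i]) + ρ • (y - x w), fun y z ↦ ?_, ?_⟩
    · rw [dist_add_left, dist_smul₀, dist_sub_right, Real.norm_of_nonneg hρ.le]
    · ext y
      simp only [List.length_append, List.length_singleton, Set.mem_image]
      constructor
      · intro hy
        refine ⟨x w + ρ⁻¹ • (y - x (w ++ [i])), ?_, ?_⟩
        · rw [mem_closedBall_iff_norm, add_sub_cancel_left, norm_smul, norm_inv,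
            Real.norm_of_nonneg hρ.le, inv_mul_le_iff₀ hρ]
          rw [mem_closedBall_iff_norm] at hy
          exact hy.trans_eq (by ring)
        · rw [add_sub_cancel_left, smul_inv_smul₀ hρ.ne', add_sub_cancel]
      · rintro ⟨z, hz, rfl⟩
        rw [mem_closedBall_iff_norm] at hz ⊢
        rw [add_sub_cancel_left, norm_smul, Real.norm_of_nonneg hρ.le, pow_succ, ← mul_assoc,
          mul_comm]
        gcongr
  disj_int w hw i hi j hj hij := by
    refine Disjoint.mono interior_subset interior_subset ?_
    refine Metric.closedBall_disjoint_closedBall ?_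
    have := hx.separated w hw i hi j hj hij
    simp only [List.length_append, List.length_singleton]
    linarith

theorem IsBallTree.moranSet_subset (hx : IsBallTree A n R ρ x) (hA : IsClosed A)
    (hρ : 0 < ρ) (hρ1 : ρ < 1) :
    moranSet n (fun w ↦ Metric.closedBall (x w) (R * ρ ^ w.length)) ⊆ A := by
  have hlim : Tendsto (fun k ↦ R * ρ ^ k) atTop (nhds 0) := by
    simpa using (tendsto_pow_atTop_nhds_zero_of_lt_one hρ.le hρ1).const_mul R
  intro p hp
  rw [← hA.closure_eq, Metric.mem_closure_iff]
  intro ε hε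
  obtain ⟨k, hk⟩ := (hlim.eventually_lt_const hε).exists
  obtain ⟨w, ⟨rfl, hw⟩, hpw⟩ := Set.mem_iUnion₂.1 (Set.mem_iInter.1 hp k)
  exact ⟨x w, hx.mem w hw, (Metric.mem_closedBall.1 hpw).trans_lt hk⟩

theorem IsBallTree.exists_mem_moranSet (hx : IsBallTree A n R ρ x) (hn : ∀ k, n k ≠ 0)
    (hR : 0 < R) (hρ : 0 < ρ) (hρ1 : ρ < 1) {i : ℕ} (hi : i < n 0) :
    ∃ p ∈ moranSet n (fun w ↦ Metric.closedBall (x w) (R * ρ ^ w.length)),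
      dist p (x [i]) ≤ R * ρ := by
  have (j : ℕ) : NeZero (n j) := ⟨hn j⟩
  let ω : ∀ j, Fin (n j) := fun j ↦ if h : j = 0 then ⟨i, h ▸ hi⟩ else 0
  obtain ⟨p, hp⟩ := hx.exists_coding hR hρ hρ1 ω
  refine ⟨p, Set.mem_iInter.2 fun k ↦ ?_, ?_⟩
  · refine Set.mem_iUnion₂.2 ⟨prefixWord ω k, ⟨by simp, admWord_prefixWord ω k⟩, ?_⟩
    simpa using hp k
  · simpa [prefixWord, ω] using hp 1

theorem IsBallTree.hausdorffDist_moranSet_le (hx : IsBallTree A n R ρ x) (hA : IsClosed A)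
    (hn : ∀ k, n k ≠ 0) (hR : 0 < R) (hρ : 0 < ρ) (hρ1 : ρ < 1)
    (hcov : ∀ y ∈ A, ∃ i < n 0, dist y (x [i]) ≤ 2 * (R * ρ)) :
    Metric.hausdorffDist (moranSet n (fun w ↦ Metric.closedBall (x w) (R * ρ ^ w.length))) A ≤
      3 * (R * ρ) := by
  refine Metric.hausdorffDist_le_of_mem_dist (by positivity) (fun p hp ↦ ?_) fun y hy ↦ ?_
  · exact ⟨p, hx.moranSet_subset hA hρ hρ1 hp, by rw [dist_self]; positivity⟩
  · obtain ⟨i, hi, hyi⟩ := hcov y hy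
    obtain ⟨p, hp, hpi⟩ := hx.exists_mem_moranSet hn hR hρ hρ1 hi
    refine ⟨p, hp, ?_⟩
    linarith [dist_triangle_right y p (x [i])]

end Moran

section Dimension

variable {X : Type*} [MetricSpace X] [MeasurableSpace X] [BorelSpace X]

theorem ofReal_le_dimH_of_closedBall_le {F : Set X} {ν : Measure X} (hν : 1 ≤ ν F)
    {R ρ t c : ℝ} (hR : 0 < R) (hρ : 0 < ρ) (hρ1 : ρ < 1) (ht : 0 < t) (hc : 0 < c) {k₀ : ℕ}
    (h : ∀ k ≥ k₀, ∀ p, ν (Metric.closedBall p (2 * (R * ρ ^ k))) ≤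
      ENNReal.ofReal (c * (R * ρ ^ k) ^ t)) :
    ENNReal.ofReal t ≤ dimH F := by
  set C : ℝ≥0∞ := ENNReal.ofReal (c * (ρ ^ t)⁻¹) with hC
  have hρt : 0 < ρ ^ t := Real.rpow_pos_of_pos hρ t
  have hC0 : C ≠ 0 := by rw [hC, Ne, ENNReal.ofReal_eq_zero, not_le]; positivity
  have hCt : C ≠ ⊤ := ENNReal.ofReal_ne_top
  have hlim : Tendsto (fun k ↦ R * ρ ^ k) atTop (nhds 0) := by
    simpa using (tendsto_pow_atTop_nhds_zero_of_lt_one hρ.le hρ1).const_mul R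
  have key : C⁻¹ • ν ≤ μH[t] := by
    refine Measure.le_hausdorffMeasure t _ (ENNReal.ofReal (R * ρ ^ k₀))
      (by rw [ENNReal.ofReal_pos]; positivity) fun s hs ↦ ?_
    rw [Measure.smul_apply, smul_eq_mul, mul_comm, ← div_eq_mul_inv]
    refine ENNReal.div_le_of_le_mul ?_
    rcases s.eq_empty_or_nonempty with rfl | ⟨p, hp⟩
    · simp
    have hsub {k : ℕ} (hk : Metric.ediam s ≤ ENNReal.ofReal (R * ρ ^ k)) :
        s ⊆ Metric.closedBall p (2 * (R * ρ ^ k)) := by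
      intro q hq
      have h1 := (Metric.edist_le_ediam_of_mem hq hp).trans hk
      rw [edist_dist, ENNReal.ofReal_le_ofReal_iff (by positivity)] at h1
      have : 0 < R * ρ ^ k := by positivity
      rw [Metric.mem_closedBall]
      linarith
    by_cases hs0 : Metric.ediam s = 0
    · suffices hz : ν s ≤ 0 by rw [le_zero_iff.1 hz]; exact zero_le
      have h2 : Tendsto (fun k ↦ ENNReal.ofReal (c * (R * ρ ^ k) ^ t)) atTop (nhds 0) := by
        have := ((hlim.rpow_const (Or.inr ht.le)).const_mul c)
        rw [Real.zero_rpow ht.ne', mul_zero] at this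
        simpa using ENNReal.tendsto_ofReal this
      refine ge_of_tendsto h2 ?_
      filter_upwards [eventually_ge_atTop k₀] with k hk
      exact (measure_mono (hsub (by simp [hs0]))).trans (h k hk p)
    · have hst : Metric.ediam s ≠ ⊤ := ne_top_of_le_ne_top ENNReal.ofReal_ne_top hs
      obtain ⟨D, hD, hDs⟩ : ∃ D : ℝ, 0 < D ∧ Metric.ediam s = ENNReal.ofReal D :=
        ⟨(Metric.ediam s).toReal, ENNReal.toReal_pos hs0 hst, (ENNReal.ofReal_toReal hst).symm⟩
      rw [hDs, ENNReal.ofReal_le_ofReal_iff (by positivity)] at hs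
      have hRk : 0 < R * ρ ^ k₀ := by positivity
      obtain ⟨j, hj1, hj2⟩ := exists_nat_pow_near_of_lt_one (x := D / (R * ρ ^ k₀)) (by positivity)
        ((div_le_one hRk).2 hs) hρ hρ1
      rw [lt_div_iff₀ hRk] at hj1
      rw [div_le_iff₀ hRk] at hj2
      have e1 : R * ρ ^ (k₀ + j) = ρ ^ j * (R * ρ ^ k₀) := by ring
      have e2 : ρ ^ (j + 1) * (R * ρ ^ k₀) = ρ * (R * ρ ^ (k₀ + j)) := by ring
      rw [← e1] at hj2
      rw [e2] at hj1
      refine (measure_mono (hsub (k := k₀ + j) ?_)).trans ((h _ (by omega) p).trans ?_)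
      · rw [hDs]; exact ENNReal.ofReal_le_ofReal hj2
      · rw [hDs, ENNReal.ofReal_rpow_of_pos hD, hC, ← ENNReal.ofReal_mul (by positivity)]
        refine ENNReal.ofReal_le_ofReal ?_
        rw [mul_comm (D ^ t), mul_assoc]
        refine mul_le_mul_of_nonneg_left ?_ hc.le
        rw [inv_mul_eq_div, le_div_iff₀ hρt, mul_comm, ← Real.mul_rpow hρ.le (by positivity)]
        exact Real.rpow_le_rpow (by positivity) hj1.le ht.le
  have hne : μH[((⟨t, ht.le⟩ : NNReal) : ℝ)] F ≠ 0 := by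
    have h1 := key F
    rw [Measure.smul_apply, smul_eq_mul] at h1
    intro h0
    have h2 : C⁻¹ * ν F ≤ 0 := h1.trans h0.le
    rw [nonpos_iff_eq_zero, mul_eq_zero, ENNReal.inv_eq_zero] at h2
    rcases h2 with h2 | h2
    · exact hCt h2
    · simp [h2] at hν
  have := le_dimH_of_hausdorffMeasure_ne_zero hne
  rwa [ENNReal.ofReal, Real.toNNReal_of_nonneg ht.le]

theorem IsHomog.eventually_real_le_rpow {A : Set X} {μ : Measure X} {lam kappa del Del : ℝ}
    (hA : IsHomog A μ lam kappa del Del) {x₀ : X} (hx₀ : x₀ ∈ A) {r : ℕ → ℝ} (hr : ∀ k, 0 < r k)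
    (hlim : Tendsto r atTop (nhds 0)) {s : ℝ} (hs : 0 ≤ s) (hsA : ENNReal.ofReal s < dimH A) :
    ∀ᶠ k in atTop, μ.real (Metric.closedBall x₀ (r k)) ≤ r k ^ s := by
  have hlam := hA.lam_pos
  by_contra hcon
  rw [not_eventually] at hcon
  have hT (k : ℕ) : ∃ T : Finset X, r k ≤ Metric.diam A → (∀ x ∈ T, x ∈ A) ∧
      (∀ x ∈ T, ∀ y ∈ T, x ≠ y → 2 * r k < dist x y) ∧ ∀ y ∈ A, ∃ x ∈ T, dist y x ≤ 2 * r k := by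
    by_cases hk : r k ≤ Metric.diam A
    · obtain ⟨T, h⟩ := hA.exists_separated_cover subset_rfl (hr k) hk
      exact ⟨T, fun _ ↦ h⟩
    · exact ⟨∅, fun h ↦ absurd h hk⟩
  choose T hT using hT
  have hsmall : ∀ᶠ k in atTop, r k ≤ Metric.diam A :=
    (hlim.eventually_lt_const hA.diam_pos).mono fun _ h ↦ h.le
  have hdiam (k : ℕ) (x : X) : Metric.ediam (Metric.closedBall x (2 * r k)) ≤
      ENNReal.ofReal (4 * r k) := by
    refine Metric.ediam_le_of_forall_dist_le fun y hy z hz ↦ ?_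
    linarith [dist_triangle_right y z x, Metric.mem_closedBall.1 hy, Metric.mem_closedBall.1 hz]
  have hmain : μH[s] A ≤ ENNReal.ofReal (lam * 4 ^ s) := by
    have hlim' : Tendsto (fun k ↦ ENNReal.ofReal (4 * r k)) atTop (nhds 0) := by
      simpa using ENNReal.tendsto_ofReal (hlim.const_mul 4)
    refine (Measure.hausdorffMeasure_le_liminf_sum (ι := fun k ↦ T k) s A _ hlim'
      (fun k x ↦ Metric.closedBall (x : X) (2 * r k)) (.of_forall fun k x ↦ hdiam k x) ?_).trans ?_
    · filter_upwards [hsmall] with k hk y hy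
      obtain ⟨x, hx, hxy⟩ := (hT k hk).2.2 y hy
      exact Set.mem_iUnion.2 ⟨⟨x, hx⟩, hxy⟩
    · refine liminf_le_of_frequently_le' ((hcon.and_eventually hsmall).mono ?_)
      rintro k ⟨hk, hk'⟩
      have hprob := hA.prob
      have h1 := hA.card_mul_le hx₀ (hr k) hk' (hT k hk').1 (hT k hk').2.1
        (V := Set.univ) fun _ _ ↦ Set.subset_univ _
      rw [probReal_univ, mul_one] at h1
      calc ∑ x : T k, Metric.ediam (Metric.closedBall (x : X) (2 * r k)) ^ s
          ≤ ∑ x : T k, ENNReal.ofReal (4 * r k) ^ s := by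
            gcongr
            exact hdiam k _
        _ = ENNReal.ofReal ((T k).card * (4 * r k) ^ s) := by
            rw [ENNReal.ofReal_mul (Nat.cast_nonneg _), ENNReal.ofReal_natCast,
              ENNReal.ofReal_rpow_of_pos (by linarith [hr k])]
            simp
        _ ≤ _ := by
            refine ENNReal.ofReal_le_ofReal ?_
            rw [Real.mul_rpow (by norm_num) (hr k).le, mul_left_comm, mul_comm]
            gcongr
            refine le_trans ?_ h1
            gcongr
            exact (not_le.1 hk).le
  have htop : μH[((⟨s, hs⟩ : NNReal) : ℝ)] A = ⊤ := by
    refine hausdorffMeasure_of_lt_dimH ?_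
    rwa [ENNReal.ofReal, Real.toNNReal_of_nonneg hs] at hsA
  have htop' : μH[s] A = ⊤ := htop
  rw [htop'] at hmain
  exact ENNReal.ofReal_ne_top (top_le_iff.1 hmain)

end Dimension

section Packing

variable {X : Type*} [MetricSpace X]

theorem packPre_mono {S T : Set X} (h : S ⊆ T) (s : ℝ) : packPre S s ≤ packPre T s := by
  refine iInf₂_mono fun δ _ ↦ ?_
  refine iSup_mono fun m ↦ iSup_mono fun x ↦ iSup_mono fun ρ ↦ ?_
  exact iSup_le fun hx ↦ le_iSup_of_le (fun i ↦ h (hx i)) le_rfl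

theorem packMeasure_mono {S T : Set X} (h : S ⊆ T) (s : ℝ) : packMeasure S s ≤ packMeasure T s :=
  le_iInf₂ fun F hF ↦ iInf₂_le F (h.trans hF)

theorem packPre_empty (s : ℝ) : packPre (∅ : Set X) s = 0 := by
  refine le_antisymm ?_ zero_le
  refine iInf₂_le_of_le 1 one_pos ?_
  refine iSup_le fun m ↦ iSup_le fun x ↦ iSup_le fun ρ ↦ iSup_le fun hx ↦ iSup₂_le fun _ _ ↦ ?_
  have : IsEmpty (Fin m) := ⟨fun i ↦ hx i⟩
  simp

theorem packMeasure_le_packPre (S : Set X) (s : ℝ) : packMeasure S s ≤ packPre S s := by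
  refine iInf₂_le_of_le (fun m ↦ if m = 0 then S else ∅) ?_ ?_
  · exact Set.subset_iUnion_of_subset 0 (by simp)
  · rw [tsum_eq_single 0]
    · simp
    · intro m hm
      simp [hm, packPre_empty]

theorem packDim_nonneg (S : Set X) : 0 ≤ packDim S := Real.sInf_nonneg fun _ h ↦ h.1

theorem packMeasure_ne_zero_of_lt_packDim {S : Set X} {s : ℝ} (hs : 0 ≤ s) (h : s < packDim S) :
    packMeasure S s ≠ 0 := fun h0 ↦
  notMem_of_lt_csInf h ⟨0, fun _ h ↦ h.1⟩ ⟨hs, h0⟩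

variable [MeasurableSpace X]

theorem IsHomog.packMeasure_eq_zero [OpensMeasurableSpace X] {A : Set X} {μ : Measure X}
    {lam kappa del Del : ℝ}
    (hA : IsHomog A μ lam kappa del Del) {x₀ : X} (hx₀ : x₀ ∈ A) {R ρ : ℝ} (hR : 0 < R)
    (hρ : 0 < ρ) (hρ1 : ρ < 1) {c t s : ℝ} (hc : 0 < c) (ht : 0 ≤ t) (hts : t < s) {k₀ : ℕ}
    (hk₀ : R * ρ ^ k₀ ≤ Metric.diam A)
    (h : ∀ k ≥ k₀, c * (R * ρ ^ k) ^ t ≤ μ.real (Metric.closedBall x₀ (R * ρ ^ k))) :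
    packMeasure A s = 0 := by
  have hprob := hA.prob
  have hlam := hA.lam_pos
  have hρt : 0 < ρ ^ t := Real.rpow_pos_of_pos hρ t
  set C := lam / (c * ρ ^ t) with hC
  have hC0 : 0 < C := by positivity
  have hRk : 0 < R * ρ ^ k₀ := by positivity
  have hball : ∀ x ∈ A, ∀ a : ℝ, 0 < a → a ≤ R * ρ ^ k₀ →
      a ^ t ≤ C * μ.real (Metric.closedBall x a) := by
    intro x hx a ha ha'
    obtain ⟨j, hj1, hj2⟩ := exists_nat_pow_near_of_lt_one (x := a / (R * ρ ^ k₀)) (by positivity)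
      ((div_le_one hRk).2 ha') hρ hρ1
    rw [lt_div_iff₀ hRk] at hj1
    rw [div_le_iff₀ hRk] at hj2
    have e1 : ρ ^ (j + 1) * (R * ρ ^ k₀) = R * ρ ^ (k₀ + j + 1) := by ring
    have e2 : ρ * (ρ ^ j * (R * ρ ^ k₀)) = R * ρ ^ (k₀ + j + 1) := by ring
    rw [e1] at hj1
    have h1 := h (k₀ + j + 1) (by omega)
    have h2 := hA.ratio_le x₀ hx₀ x hx _ (by positivity : 0 < R * ρ ^ (k₀ + j + 1))
      (hj1.le.trans (ha'.trans hk₀))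
    have h3 : μ.real (Metric.closedBall x (R * ρ ^ (k₀ + j + 1))) ≤
        μ.real (Metric.closedBall x a) :=
      measureReal_mono (Metric.closedBall_subset_closedBall hj1.le)
    have h4 : ρ ^ t * a ^ t ≤ (R * ρ ^ (k₀ + j + 1)) ^ t := by
      rw [← Real.mul_rpow hρ.le ha.le, ← e2]
      gcongr
    rw [hC, div_mul_eq_mul_div, le_div_iff₀ (by positivity)]
    calc a ^ t * (c * ρ ^ t) = c * (ρ ^ t * a ^ t) := by ring
      _ ≤ c * (R * ρ ^ (k₀ + j + 1)) ^ t := by gcongr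
      _ ≤ _ := h1
      _ ≤ _ := h2
      _ ≤ _ := mul_le_mul_of_nonneg_left h3 hlam.le
  have hpre : ∀ δ : ℝ, 0 < δ → δ ≤ R * ρ ^ k₀ →
      packPre A s ≤ ENNReal.ofReal (δ ^ (s - t) * C) := by
    intro δ hδ hδ'
    refine iInf₂_le_of_le δ hδ ?_
    refine iSup_le fun m ↦ iSup_le fun x ↦ iSup_le fun a ↦ iSup_le fun hx ↦ iSup₂_le fun ha hd ↦ ?_
    rw [← ENNReal.ofReal_sum_of_nonneg fun i _ ↦ Real.rpow_nonneg (ha i).1.le _]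
    refine ENNReal.ofReal_le_ofReal ?_
    calc ∑ i, a i ^ s
        ≤ ∑ i, δ ^ (s - t) * (C * μ.real (Metric.closedBall (x i) (a i))) := by
          refine Finset.sum_le_sum fun i _ ↦ ?_
          rw [show s = (s - t) + t by ring, Real.rpow_add (ha i).1, show s - t + t - t = s - t by ring]
          refine mul_le_mul ?_ (hball _ (hx i) _ (ha i).1 ((ha i).2.trans hδ'))
            (Real.rpow_nonneg (ha i).1.le _) (by positivity)
          exact Real.rpow_le_rpow (ha i).1.le (ha i).2 (by linarith)
      _ = δ ^ (s - t) * (C * μ.real (⋃ i ∈ Finset.univ, Metric.closedBall (x i) (a i))) := by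
          rw [measureReal_biUnion_finset (fun i _ j _ hij ↦ hd i j hij)
            fun i _ ↦ Metric.isClosed_closedBall.measurableSet, Finset.mul_sum, Finset.mul_sum]
      _ ≤ δ ^ (s - t) * (C * 1) := by
          gcongr
          exact measureReal_le_one
      _ = _ := by rw [mul_one]
  refine le_antisymm ((packMeasure_le_packPre A s).trans ?_) zero_le
  have hlim : Tendsto (fun δ : ℝ ↦ ENNReal.ofReal (δ ^ (s - t) * C)) (nhdsWithin 0 (Set.Ioi 0))
      (nhds 0) := by
    have h1 : Tendsto (fun δ : ℝ ↦ δ ^ (s - t) * C) (nhdsWithin 0 (Set.Ioi 0)) (nhds 0) := by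
      have h2 : ContinuousAt (fun δ : ℝ ↦ δ ^ (s - t) * C) 0 :=
        (Real.continuousAt_rpow_const 0 (s - t) (Or.inr (by linarith))).mul_const C
      have h3 := h2.tendsto
      rw [Real.zero_rpow (by linarith), zero_mul] at h3
      exact h3.mono_left nhdsWithin_le_nhds
    simpa using ENNReal.tendsto_ofReal h1
  refine ge_of_tendsto hlim ?_
  filter_upwards [Ioc_mem_nhdsGT hRk] with δ hδ
  exact hpre δ hδ.1 hδ.2

theorem packMeasure_ne_zero_of_frequently {F : Set X} {ν : Measure X}
    (hν : 1 ≤ ν F) {r : ℕ → ℝ} (hr : ∀ k, 0 < r k) (hlim : Tendsto r atTop (nhds 0))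
    {c t : ℝ} (hc : 0 ≤ c)
    (hsep : ∀ᶠ k in atTop, ∀ S ⊆ F, ∃ T : Finset X, (∀ x ∈ T, x ∈ S) ∧
      (∀ x ∈ T, ∀ y ∈ T, x ≠ y → 2 * r k < dist x y) ∧ ∀ y ∈ S, ∃ x ∈ T, dist y x ≤ 2 * r k)
    (h : ∃ᶠ k in atTop, ∀ p, ν (Metric.closedBall p (2 * r k)) ≤
      ENNReal.ofReal (c * r k ^ t)) :
    packMeasure F t ≠ 0 := by
  have hpre : ∀ S ⊆ F, ν S / ENNReal.ofReal c ≤ packPre S t := by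
    intro S hS
    refine le_iInf₂ fun δ hδ ↦ ENNReal.div_le_of_le_mul' ?_
    obtain ⟨k, ⟨hk1, hk2⟩, hk3⟩ :=
      ((h.and_eventually hsep).and_eventually (hlim.eventually_lt_const hδ)).exists
    obtain ⟨T, hTS, hT, hcov⟩ := hk2 S hS
    have hdisj : ∀ i j : Fin T.card, i ≠ j →
        Disjoint (Metric.closedBall (T.equivFin.symm i : X) (r k))
          (Metric.closedBall (T.equivFin.symm j : X) (r k)) := by
      intro i j hij
      refine Metric.closedBall_disjoint_closedBall ?_
      have := hT _ (T.equivFin.symm i).2 _ (T.equivFin.symm j).2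
        (fun he ↦ hij (T.equivFin.symm.injective (Subtype.ext he)))
      linarith
    calc ν S ≤ ν (⋃ x ∈ T, Metric.closedBall x (2 * r k)) := by
          refine measure_mono fun y hy ↦ ?_
          obtain ⟨x, hx, hxy⟩ := hcov y hy
          exact Set.mem_biUnion hx hxy
      _ ≤ ∑ x ∈ T, ν (Metric.closedBall x (2 * r k)) := measure_biUnion_finset_le _ _
      _ ≤ ∑ x ∈ T, ENNReal.ofReal (c * r k ^ t) := Finset.sum_le_sum fun x _ ↦ hk1 x
      _ = ENNReal.ofReal c * ∑ _i : Fin T.card, ENNReal.ofReal (r k ^ t) := by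
          rw [ENNReal.ofReal_mul hc]
          simp only [Finset.sum_const, Finset.card_univ, Fintype.card_fin, nsmul_eq_mul]
          ring
      _ ≤ _ := by
          gcongr
          refine le_iSup_of_le T.card (le_iSup_of_le (fun i ↦ (T.equivFin.symm i : X))
            (le_iSup_of_le (fun _ ↦ r k) (le_iSup_of_le (fun i ↦ hTS _ (T.equivFin.symm i).2)
            (le_iSup₂_of_le (fun _ ↦ ⟨hr k, hk3.le⟩) hdisj le_rfl))))
  have hmain : ν F / ENNReal.ofReal c ≤ packMeasure F t := by
    refine le_iInf₂ fun E hE ↦ ?_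
    calc ν F / ENNReal.ofReal c ≤ (∑' m, ν (E m ∩ F)) / ENNReal.ofReal c := by
          gcongr
          refine (measure_mono ?_).trans (measure_iUnion_le _)
          rw [← Set.iUnion_inter]
          exact Set.subset_inter hE subset_rfl
      _ = ∑' m, ν (E m ∩ F) / ENNReal.ofReal c := by
          simp only [div_eq_mul_inv, ENNReal.tsum_mul_right]
      _ ≤ ∑' m, packPre (E m) t := ENNReal.tsum_le_tsum fun m ↦
          (hpre _ Set.inter_subset_right).trans (packPre_mono Set.inter_subset_left t)
  intro h0
  rw [h0, nonpos_iff_eq_zero, ENNReal.div_eq_zero_iff] at hmain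
  rcases hmain with h1 | h1
  · simp [h1] at hν
  · exact ENNReal.ofReal_ne_top h1

end Packing

section Construction

theorem Finset.exists_enumeration {X : Type*} [Nonempty X] (T : Finset X) {N : ℕ}
    (hN : N ≤ T.card) :
    ∃ f : ℕ → X, (∀ i < N, f i ∈ T) ∧ (∀ i < N, ∀ j < N, i ≠ j → f i ≠ f j) ∧
      (N = T.card → ∀ z ∈ T, ∃ i < N, f i = z) := by
  classical
  let f : ℕ → X := fun i ↦ if h : i < T.card then T.equivFin.symm ⟨i, h⟩ else Classical.arbitrary X
  have hf (i : ℕ) (h : i < T.card) : f i = T.equivFin.symm ⟨i, h⟩ := dif_pos h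
  refine ⟨f, fun i hi ↦ ?_, fun i hi j hj hij h ↦ hij ?_, fun h z hz ↦ ?_⟩
  · rw [hf i (by omega)]
    exact Subtype.property _
  · rw [hf i (by omega), hf j (by omega)] at h
    simpa using T.equivFin.symm.injective (Subtype.ext h)
  · have hlt := (T.equivFin ⟨z, hz⟩).isLt
    refine ⟨T.equivFin ⟨z, hz⟩, by omega, ?_⟩
    rw [hf _ hlt]
    simp

/-- The point reached from `x₀` by following the word `w`, where `f k y i` is the `i`-th child of
the point `y` of level `k`. -/
def treePoint {X : Type*} (f : ℕ → X → ℕ → X) (x₀ : X) (w : List ℕ) : X :=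
  (w.foldl (fun s i ↦ (s.1 + 1, f s.1 s.2 i)) ((0 : ℕ), x₀)).2

theorem treePoint_append {X : Type*} (f : ℕ → X → ℕ → X) (x₀ : X) (w : List ℕ) (i : ℕ) :
    treePoint f x₀ (w ++ [i]) = f w.length (treePoint f x₀ w) i := by
  have h (w : List ℕ) :
      (w.foldl (fun s i ↦ (s.1 + 1, f s.1 s.2 i)) ((0 : ℕ), x₀)).1 = w.length := by
    induction w using List.reverseRecOn with
    | nil => rfl
    | append_singleton w i ih => simp [List.foldl_append, ih]
  simp [treePoint, List.foldl_append, h]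

variable {X : Type*} [MetricSpace X] [MeasurableSpace X] [OpensMeasurableSpace X] {A : Set X}
  {μ : Measure X} {lam kappa del Del : ℝ}

theorem IsHomog.exists_children (hA : IsHomog A μ lam kappa del Del) {D ρ : ℝ}
    (hD : ∀ x ∈ A, ∀ r : ℝ, 0 < r → r ≤ Metric.diam A →
      μ.real (Metric.closedBall x r) ≤ D * μ.real (Metric.closedBall x (2⁻¹ * r)))
    (hD1 : 1 ≤ D) (hρ : 0 < ρ) (hρ' : ρ ≤ 16⁻¹)
    (hexp : ∀ x ∈ A, ∀ r : ℝ, 0 < r → r ≤ Metric.diam A →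
      (lam ^ 2 * D ^ 2 + 1) * μ.real (Metric.closedBall x (ρ * r)) ≤
        μ.real (Metric.closedBall x r))
    {x₀ : X} (hx₀ : x₀ ∈ A) {R : ℝ} (hR : R = 2 * Metric.diam A) (k : ℕ) :
    ∃ N : ℕ, 2 ≤ N ∧
      (k ≠ 0 → μ.real (Metric.closedBall x₀ (R * ρ ^ k)) ≤
        lam ^ 2 * D ^ 2 * (N * μ.real (Metric.closedBall x₀ (R * ρ ^ (k + 1))))) ∧
      ∀ y, ∃ f : ℕ → X, y ∈ A →
        (∀ i < N, f i ∈ A ∧ dist (f i) y + R * ρ ^ (k + 1) ≤ R * ρ ^ k ∧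
          ∀ j < N, i ≠ j → 2 * (R * ρ ^ (k + 1)) < dist (f i) (f j)) ∧
        (k = 0 → ∀ z ∈ A, ∃ i < N, dist z (f i) ≤ 2 * (R * ρ)) := by
  have hne : Nonempty X := ⟨x₀⟩
  have hdiam := hA.diam_pos
  have hlam := hA.lam_pos
  have hR0 : 0 < R := by linarith
  have hRρ : 8 * (R * ρ) ≤ Metric.diam A := by rw [hR]; nlinarith
  have hstep : 2⁻¹ * (R * ρ ^ k) + R * ρ ^ (k + 1) ≤ R * ρ ^ k := by
    have : 0 < R * ρ ^ k := by positivity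
    rw [pow_succ]
    nlinarith
  rcases eq_or_ne k 0 with rfl | hk
  · have hRρ0 : 0 < R * ρ := by positivity
    obtain ⟨T, hTA, hT, hcov⟩ := hA.exists_separated_cover subset_rfl (r := R * ρ) hRρ0
      (by linarith)
    refine ⟨T.card, ?_, by simp, fun y ↦ ?_⟩
    · by_contra! hcard
      have hle : Metric.diam A ≤ 4 * (R * ρ) := by
        refine Metric.diam_le_of_forall_dist_le (by positivity) fun a ha b hb ↦ ?_
        obtain ⟨z, hz, haz⟩ := hcov a ha
        obtain ⟨z', hz', hbz⟩ := hcov b hb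
        obtain rfl : z = z' := Finset.card_le_one.1 (by omega) z hz z' hz'
        linarith [dist_triangle_right a b z]
      linarith
    · obtain ⟨f, hfT, hfinj, hfsurj⟩ := T.exists_enumeration le_rfl
      refine ⟨f, fun hy ↦ ⟨fun i hi ↦ ⟨hTA _ (hfT i hi), ?_, fun j hj hij ↦ ?_⟩, fun _ z hz ↦ ?_⟩⟩
      · have := Metric.dist_le_diam_of_mem hA.compact.isBounded (hTA _ (hfT i hi)) hy
        refine le_trans ?_ hstep
        gcongr
        rw [pow_zero, mul_one]
        linarith
      · rw [zero_add, pow_one]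
        exact hT _ (hfT i hi) _ (hfT j hj) (hfinj i hi j hj hij)
      · obtain ⟨a, ha, hza⟩ := hcov z hz
        obtain ⟨i, hi, rfl⟩ := hfsurj rfl a ha
        exact ⟨i, hi, hza⟩
  · have hρ1 : ρ ≤ 1 := hρ'.trans (by norm_num)
    have hr : 0 < R * ρ ^ k := by positivity
    have hr' : R * ρ ^ k ≤ Metric.diam A := by
      have : ρ ^ k ≤ ρ := pow_le_of_le_one hρ.le hρ1 hk
      nlinarith
    have e1 : R * ρ ^ (k + 1) = ρ * (R * ρ ^ k) := by ring
    have hm1 := hA.real_pos hx₀ (by positivity : 0 < R * ρ ^ (k + 1))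
    set m := μ.real (Metric.closedBall x₀ (R * ρ ^ k))
    set m' := μ.real (Metric.closedBall x₀ (R * ρ ^ (k + 1))) with hm'
    have hC : 0 < lam ^ 2 * D ^ 2 := by positivity
    refine ⟨⌈m / (lam ^ 2 * D ^ 2 * m')⌉₊, ?_, fun _ ↦ ?_, fun y ↦ ?_⟩
    · rw [Nat.succ_le_iff, Nat.lt_ceil, Nat.cast_one, one_lt_div (by positivity)]
      refine lt_of_lt_of_le ?_ (hexp x₀ hx₀ _ hr hr')
      rw [← e1, ← hm']
      nlinarith
    · have := Nat.le_ceil (m / (lam ^ 2 * D ^ 2 * m'))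
      rw [div_le_iff₀ (by positivity)] at this
      linarith
    · by_cases hy : y ∈ A
      · obtain ⟨T, hTA, hTy, hT, hcard⟩ :=
          hA.exists_separated_card hD hD1 hx₀ hy hr hr' hρ (hρ'.trans (by norm_num))
        rw [← e1] at hT hcard
        obtain ⟨f, hfT, hfinj, -⟩ := T.exists_enumeration (N := ⌈m / (lam ^ 2 * D ^ 2 * m')⌉₊) (by
          rw [Nat.ceil_le, div_le_iff₀ (by positivity)]
          linarith)
        refine ⟨f, fun _ ↦ ⟨fun i hi ↦ ⟨hTA _ (hfT i hi), ?_, fun j hj hij ↦ ?_⟩,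
          fun h ↦ absurd h hk⟩⟩
        · linarith [hTy _ (hfT i hi)]
        · exact hT _ (hfT i hi) _ (hfT j hj) (hfinj i hi j hj hij)
      · exact ⟨fun _ ↦ y, fun h ↦ absurd h hy⟩

theorem IsHomog.exists_ballTree (hA : IsHomog A μ lam kappa del Del) {D ρ : ℝ}
    (hD : ∀ x ∈ A, ∀ r : ℝ, 0 < r → r ≤ Metric.diam A →
      μ.real (Metric.closedBall x r) ≤ D * μ.real (Metric.closedBall x (2⁻¹ * r)))
    (hD1 : 1 ≤ D) (hρ : 0 < ρ) (hρ' : ρ ≤ 16⁻¹)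
    (hexp : ∀ x ∈ A, ∀ r : ℝ, 0 < r → r ≤ Metric.diam A →
      (lam ^ 2 * D ^ 2 + 1) * μ.real (Metric.closedBall x (ρ * r)) ≤
        μ.real (Metric.closedBall x r))
    {x₀ : X} (hx₀ : x₀ ∈ A) {R : ℝ} (hR : R = 2 * Metric.diam A) :
    ∃ (n : ℕ → ℕ) (x : List ℕ → X), (∀ k, 2 ≤ n k) ∧ IsBallTree A n R ρ x ∧
      (∀ y ∈ A, ∃ i < n 0, dist y (x [i]) ≤ 2 * (R * ρ)) ∧
      ∀ k, μ.real (Metric.closedBall x₀ (R * ρ)) ≤ (lam ^ 2 * D ^ 2) ^ k *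
        (prodN n (k + 1) * μ.real (Metric.closedBall x₀ (R * ρ ^ (k + 1)))) := by
  choose n hn hcard f hf using hA.exists_children hD hD1 hρ hρ' hexp hx₀ hR
  have hlam := hA.lam_pos
  have hmem : ∀ w, AdmWord n w → treePoint f x₀ w ∈ A := by
    intro w
    induction w using List.reverseRecOn with
    | nil => exact fun _ ↦ hx₀
    | append_singleton w i ih =>
      intro hw
      rw [admWord_append] at hw
      rw [treePoint_append]
      exact ((hf _ _ (ih hw.1)).1 i hw.2).1
  refine ⟨n, treePoint f x₀, hn, ⟨hmem, fun w hw i hi ↦ ?_, fun w hw i hi j hj hij ↦ ?_⟩,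
    fun y hy ↦ ?_, fun k ↦ ?_⟩
  · rw [treePoint_append]
    exact ((hf _ _ (hmem w hw)).1 i hi).2.1
  · rw [treePoint_append, treePoint_append]
    exact ((hf _ _ (hmem w hw)).1 i hi).2.2 j hj hij
  · exact (hf 0 x₀ hx₀).2 rfl y hy
  · induction k with
    | zero =>
      have h1 : (1 : ℝ) ≤ prodN n 1 := by
        have := hn 0
        simp only [prodN, Finset.prod_range_one]
        exact_mod_cast (by omega : 1 ≤ n 0)
      simp only [pow_zero, one_mul, zero_add, pow_one]
      exact le_mul_of_one_le_left measureReal_nonneg h1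
    | succ k ih =>
      refine ih.trans ?_
      have h1 := hcard (k + 1) (by omega)
      have h2 : (prodN n (k + 1 + 1) : ℝ) = prodN n (k + 1) * n (k + 1) := by
        simp [prodN, Finset.prod_range_succ _ (k + 1)]
      calc _ ≤ (lam ^ 2 * D ^ 2) ^ k * (prodN n (k + 1) * (lam ^ 2 * D ^ 2 * (n (k + 1) *
            μ.real (Metric.closedBall x₀ (R * ρ ^ (k + 1 + 1)))))) := by gcongr
        _ = _ := by rw [h2]; ring

/-- Only boundedly many balls of a fixed level of a ball tree meet a ball of comparable size. -/
theorem IsHomog.card_words_le (hA : IsHomog A μ lam kappa del Del) {D ρ : ℝ}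
    (hD : ∀ x ∈ A, ∀ r : ℝ, 0 < r → r ≤ Metric.diam A →
      μ.real (Metric.closedBall x r) ≤ D * μ.real (Metric.closedBall x (2⁻¹ * r)))
    (hD1 : 1 ≤ D) {n : ℕ → ℕ} {R : ℝ} {x : List ℕ → X} (hx : IsBallTree A n R ρ x)
    {k : ℕ} (hr : 0 < R * ρ ^ k) (hr' : 8 * (R * ρ ^ k) ≤ Metric.diam A) {p : X}
    {W : Finset (List ℕ)} (hW : ∀ w ∈ W, w.length = k ∧ AdmWord n w ∧
      ∃ q ∈ Metric.closedBall p (2 * (R * ρ ^ k)), dist q (x w) ≤ R * ρ ^ k) :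
    (W.card : ℝ) ≤ lam * D ^ 3 := by
  classical
  have hlam := hA.lam_pos
  rcases W.eq_empty_or_nonempty with rfl | ⟨w₀, hw₀⟩
  · simp only [Finset.card_empty, Nat.cast_zero]
    positivity
  have hsep : ∀ w ∈ W, ∀ v ∈ W, w ≠ v → 2 * (R * ρ ^ k) < dist (x w) (x v) :=
    fun w hw v hv hwv ↦ hx.separated_of_length_eq k w v (hW w hw).2.1 (hW v hv).2.1
      (hW w hw).1 (hW v hv).1 hwv
  have hinj : Set.InjOn x W := by
    intro w hw v hv hwv
    by_contra hne
    have := hsep w hw v hv hne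
    rw [hwv, dist_self] at this
    linarith
  have hdist : ∀ w ∈ W, dist (x w) p ≤ 3 * (R * ρ ^ k) := by
    intro w hw
    obtain ⟨-, -, q, hq, hqw⟩ := hW w hw
    have := Metric.mem_closedBall.1 hq
    linarith [dist_triangle_left (x w) p q]
  have h0 : x w₀ ∈ A := hx.mem _ (hW w₀ hw₀).2.1
  have hpos := hA.real_pos h0 hr
  have h1 := hA.card_mul_le h0 hr (by linarith) (T := W.image x)
    (V := Metric.closedBall (x w₀) (8 * (R * ρ ^ k))) ?_ ?_ ?_
  · rw [Finset.card_image_of_injOn hinj] at h1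
    have h2 := hD _ h0 _ (by positivity) hr'
    rw [show 2⁻¹ * (8 * (R * ρ ^ k)) = 4 * (R * ρ ^ k) by ring] at h2
    have h3 := hD _ h0 (4 * (R * ρ ^ k)) (by positivity) (by linarith)
    rw [show 2⁻¹ * (4 * (R * ρ ^ k)) = 2 * (R * ρ ^ k) by ring] at h3
    have h4 := hD _ h0 (2 * (R * ρ ^ k)) (by positivity) (by linarith)
    rw [show 2⁻¹ * (2 * (R * ρ ^ k)) = R * ρ ^ k by ring] at h4
    refine le_of_mul_le_mul_right (h1.trans ?_) hpos
    calc _ ≤ lam * (D * (D * (D * μ.real (Metric.closedBall (x w₀) (R * ρ ^ k))))) := by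
          gcongr
          exact h2.trans (by gcongr; exact h3.trans (by gcongr))
      _ = _ := by ring
  · intro y hy
    obtain ⟨w, hw, rfl⟩ := Finset.mem_image.1 hy
    exact hx.mem _ (hW w hw).2.1
  · intro y hy z hz hyz
    obtain ⟨w, hw, rfl⟩ := Finset.mem_image.1 hy
    obtain ⟨v, hv, rfl⟩ := Finset.mem_image.1 hz
    exact hsep w hw v hv (fun h ↦ hyz (h ▸ rfl))
  · intro y hy
    obtain ⟨w, hw, rfl⟩ := Finset.mem_image.1 hy
    refine Metric.closedBall_subset_closedBall' ?_
    linarith [hdist w hw, hdist w₀ hw₀, dist_triangle_right (x w) (x w₀) p]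

theorem IsHomog.exists_packMeasure_eq_zero (hA : IsHomog A μ lam kappa del Del) :
    ∃ s : ℝ, 0 ≤ s ∧ packMeasure A s = 0 := by
  have hdiam := hA.diam_pos
  obtain ⟨x₀, hx₀⟩ : A.Nonempty := by
    rw [Set.nonempty_iff_ne_empty]
    rintro rfl
    simp at hdiam
  obtain ⟨D, hD1, hD⟩ := hA.exists_contraction (τ := 2⁻¹) (by norm_num)
  have hD0 : 0 < D := by linarith
  obtain ⟨q, hq⟩ := pow_unbounded_of_one_lt D (one_lt_two (α := ℝ))
  set a := Metric.diam A
  have hm0 := hA.real_pos hx₀ hdiam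
  have hm (k : ℕ) : μ.real (Metric.closedBall x₀ a) ≤
      D ^ k * μ.real (Metric.closedBall x₀ (a * 2⁻¹ ^ k)) := by
    induction k with
    | zero => simp
    | succ k ih =>
      refine ih.trans ?_
      have h1 : a * 2⁻¹ ^ k ≤ a :=
        mul_le_of_le_one_right hdiam.le (pow_le_one₀ (by norm_num) (by norm_num))
      have h2 := hD x₀ hx₀ (a * 2⁻¹ ^ k) (by positivity) h1
      rw [show 2⁻¹ * (a * 2⁻¹ ^ k) = a * 2⁻¹ ^ (k + 1) by ring] at h2
      rw [pow_succ, mul_assoc]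
      gcongr
  refine ⟨q + 1, by positivity, ?_⟩
  refine hA.packMeasure_eq_zero hx₀ (R := a) (ρ := 2⁻¹) hdiam (by norm_num) (by norm_num)
    (c := μ.real (Metric.closedBall x₀ a) / a ^ q) (t := q) (by positivity) (by positivity)
    (by linarith) (k₀ := 0) (by simp [a]) fun k _ ↦ ?_
  rw [Real.rpow_natCast, mul_pow, div_mul_eq_mul_div, div_le_iff₀ (by positivity)]
  have h1 : (2⁻¹ ^ k) ^ q * D ^ k ≤ (1 : ℝ) := by
    rw [← pow_mul, mul_comm k, pow_mul, ← mul_pow]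
    refine pow_le_one₀ (by positivity) ?_
    rw [inv_pow, inv_mul_le_iff₀ (by positivity), mul_one]
    exact hq.le
  calc μ.real (Metric.closedBall x₀ a) * (a ^ q * (2⁻¹ ^ k) ^ q)
      ≤ D ^ k * μ.real (Metric.closedBall x₀ (a * 2⁻¹ ^ k)) * (a ^ q * (2⁻¹ ^ k) ^ q) := by
        gcongr
        exact hm k
    _ = ((2⁻¹ ^ k) ^ q * D ^ k) * (μ.real (Metric.closedBall x₀ (a * 2⁻¹ ^ k)) * a ^ q) := by ring
    _ ≤ 1 * (μ.real (Metric.closedBall x₀ (a * 2⁻¹ ^ k)) * a ^ q) := by gcongr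
    _ = _ := one_mul _

end Construction

section Approximation

theorem inv_prodN_le {n : ℕ → ℕ} {m : ℕ → ℝ} {C R ρ e : ℝ} (hR : 0 < R) (hρ : 0 < ρ)
    (hC : 1 ≤ C) (hCρ : C * ρ ^ e ≤ 1) (hn : ∀ k, n k ≠ 0) (hm : ∀ k, 0 < m k)
    (h : ∀ k, m 1 ≤ C ^ k * (prodN n (k + 1) * m (k + 1))) {k : ℕ} (hk : 1 ≤ k) :
    (prodN n k : ℝ)⁻¹ ≤ R ^ e / m 1 * (m k * (R * ρ ^ k) ^ (-e)) := by
  obtain ⟨j, rfl⟩ := Nat.exists_eq_add_of_le' hk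
  have hN : (0 : ℝ) < prodN n (j + 1) :=
    Nat.cast_pos.2 (Finset.prod_pos fun i _ ↦ Nat.pos_of_ne_zero (hn i))
  have hρe : 0 < ρ ^ e := Real.rpow_pos_of_pos hρ e
  have hRe : 0 < R ^ e := Real.rpow_pos_of_pos hR e
  have hpow : (R * ρ ^ (j + 1)) ^ (-e) = (R ^ e)⁻¹ * ((ρ ^ e) ^ (j + 1))⁻¹ := by
    rw [Real.rpow_neg (by positivity), Real.mul_rpow hR.le (by positivity), mul_inv,
      Real.rpow_pow_comm hρ.le]
  have hCj : C ^ j ≤ ((ρ ^ e) ^ (j + 1))⁻¹ := by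
    rw [le_inv_comm₀ (by positivity) (by positivity), ← one_div, le_div_iff₀ (by positivity)]
    calc (ρ ^ e) ^ (j + 1) * C ^ j ≤ (ρ ^ e) ^ (j + 1) * C ^ (j + 1) := by
          gcongr
          exact j.le_succ
      _ = (C * ρ ^ e) ^ (j + 1) := by rw [mul_pow, mul_comm]
      _ ≤ 1 := pow_le_one₀ (by positivity) hCρ
  rw [hpow, show R ^ e / m 1 * (m (j + 1) * ((R ^ e)⁻¹ * ((ρ ^ e) ^ (j + 1))⁻¹)) =
    ((ρ ^ e) ^ (j + 1))⁻¹ * m (j + 1) / m 1 by field_simp, le_div_iff₀ (hm 1),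
    inv_mul_le_iff₀ hN]
  calc m 1 ≤ C ^ j * (prodN n (j + 1) * m (j + 1)) := h j
    _ ≤ ((ρ ^ e) ^ (j + 1))⁻¹ * (prodN n (j + 1) * m (j + 1)) := by
        have := hm (j + 1)
        gcongr
    _ = _ := by ring

/-- A homogeneous set contains a Moran set which is Hausdorff close to it and carries a measure
whose values on balls of radius `r` exceed those of `μ` by at most a factor `c * r ^ (-e)`. -/
theorem IsHomog.exists_moranSystem {d : ℕ} {A : Set (EuclideanSpace ℝ (Fin d))}
    {μ : Measure (EuclideanSpace ℝ (Fin d))} {lam kappa del Del : ℝ}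
    (hA : IsHomog A μ lam kappa del Del) {x₀ : EuclideanSpace ℝ (Fin d)} (hx₀ : x₀ ∈ A)
    {ε e : ℝ} (hε : 0 < ε) (he : 0 < e) :
    ∃ (J : Set (EuclideanSpace ℝ (Fin d))) (n : ℕ → ℕ) (c : ℕ → ℝ)
      (Jw : List ℕ → Set (EuclideanSpace ℝ (Fin d))),
      IsMoranSystem J n c Jw ∧ moranSet n Jw ⊆ A ∧
      Metric.hausdorffDist (moranSet n Jw) A < ε ∧
      ∃ (R ρ K : ℝ) (ν : Measure (EuclideanSpace ℝ (Fin d))), 0 < R ∧ 0 < ρ ∧ ρ < 1 ∧ 0 < K ∧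
        R * ρ ≤ Metric.diam A ∧ 1 ≤ ν (moranSet n Jw) ∧
        ∀ k ≥ 1, ∀ p, ν (Metric.closedBall p (2 * (R * ρ ^ k))) ≤ ENNReal.ofReal
          (K * (μ.real (Metric.closedBall x₀ (R * ρ ^ k)) * (R * ρ ^ k) ^ (-e))) := by
  have hdiam := hA.diam_pos
  have hlam := hA.one_le_lam
  obtain ⟨D, hD1, hD⟩ := hA.exists_contraction (τ := 2⁻¹) (by norm_num)
  obtain ⟨τ, hτ, hexp⟩ := hA.exists_expansion (lam ^ 2 * D ^ 2 + 1)
  obtain ⟨R, hR⟩ : ∃ R, R = 2 * Metric.diam A := ⟨_, rfl⟩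
  have hR0 : 0 < R := by
    rw [hR]
    positivity
  have hC : 1 ≤ lam ^ 2 * D ^ 2 :=
    one_le_mul_of_one_le_of_one_le (one_le_pow₀ hlam) (one_le_pow₀ hD1)
  obtain ⟨ρ, hρ, hρ', hρτ, hρR, hρC⟩ : ∃ ρ : ℝ, 0 < ρ ∧ ρ ≤ 16⁻¹ ∧ ρ ≤ τ ∧ 3 * (R * ρ) < ε ∧
      lam ^ 2 * D ^ 2 * ρ ^ e ≤ 1 := by
    have h1 : Tendsto (fun ρ : ℝ ↦ 3 * (R * ρ)) (nhds 0) (nhds 0) :=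
      Continuous.tendsto' (by fun_prop) _ _ (by simp)
    have h2 : Tendsto (fun ρ : ℝ ↦ lam ^ 2 * D ^ 2 * ρ ^ e) (nhds 0) (nhds 0) := by
      simpa [Real.zero_rpow he.ne'] using
        ((Real.continuousAt_rpow_const 0 e (Or.inr he.le)).tendsto).const_mul (lam ^ 2 * D ^ 2)
    have h := ((ge_mem_nhds (show (0 : ℝ) < 16⁻¹ by norm_num)).and ((ge_mem_nhds hτ).and
      ((h1.eventually_lt_const hε).and (h2.eventually_le_const one_pos))))
    obtain ⟨ρ, hρ, h⟩ := ((eventually_mem_nhdsWithin (a := (0 : ℝ)) (s := Set.Ioi 0)).and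
      (nhdsWithin_le_nhds h)).exists
    exact ⟨ρ, hρ, h⟩
  have hρ1 : ρ < 1 := by linarith [show (16 : ℝ)⁻¹ < 1 by norm_num]
  obtain ⟨n, x, hn, hx, hcov, hgrow⟩ := hA.exists_ballTree hD hD1 hρ hρ' (hexp ρ hρτ) hx₀ hR
  have hn0 (k : ℕ) : n k ≠ 0 := by linarith [hn k]
  obtain ⟨ν, hν, hνB⟩ := hx.exists_measure hR0 hρ hρ1 hn0
  have hcl := hA.compact.isClosed
  have hm (k : ℕ) : 0 < μ.real (Metric.closedBall x₀ (R * ρ ^ k)) :=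
    hA.real_pos hx₀ (by positivity)
  refine ⟨_, n, _, _, hx.isMoranSystem hn hR0 hρ hρ1, hx.moranSet_subset hcl hρ hρ1,
    (hx.hausdorffDist_moranSet_le hcl hn0 hR0 hρ hρ1 hcov).trans_lt hρR, R, ρ,
    lam * D ^ 3 * (R ^ e / μ.real (Metric.closedBall x₀ (R * ρ ^ 1))), ν, hR0, hρ, hρ1, ?_, ?_, hν,
    fun k hk p ↦ ?_⟩
  · have := hm 1
    positivity
  · rw [hR]
    nlinarith
  have hkey := inv_prodN_le (e := e) hR0 hρ hC hρC hn0 hm (by simpa using hgrow) hk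
  have hN : (0 : ℝ) < prodN n k :=
    Nat.cast_pos.2 (Finset.prod_pos fun i _ ↦ Nat.pos_of_ne_zero (hn0 i))
  have hr : R * ρ ^ k ≤ R * ρ := by
    gcongr
    exact pow_le_of_le_one hρ.le hρ1.le (by omega)
  have hr' : 8 * (R * ρ ^ k) ≤ Metric.diam A := by
    have : 8 * (R * ρ) ≤ Metric.diam A := by
      rw [hR]
      nlinarith
    linarith
  refine (hνB k _ Metric.isClosed_closedBall.measurableSet (ENNReal.ofReal (lam * D ^ 3))
    fun W hW ↦ ?_).trans ?_
  · rw [← ENNReal.ofReal_natCast]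
    exact ENNReal.ofReal_le_ofReal (hA.card_words_le hD hD1 hx (by positivity) hr' hW)
  · rw [← ENNReal.ofReal_natCast, ← ENNReal.ofReal_inv_of_pos hN,
      ← ENNReal.ofReal_mul (by positivity)]
    refine ENNReal.ofReal_le_ofReal ?_
    rw [mul_assoc (lam * D ^ 3)]
    gcongr

variable {X : Type*} [MetricSpace X] [MeasurableSpace X] [BorelSpace X] {A F : Set X}
  {μ ν : Measure X} {lam kappa del Del : ℝ}

theorem IsHomog.toReal_dimH_le (hA : IsHomog A μ lam kappa del Del) {x₀ : X} (hx₀ : x₀ ∈ A)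
    (hAtop : dimH A ≠ ⊤) (hFtop : dimH F ≠ ⊤)
    {R ρ K e : ℝ} (hR : 0 < R) (hρ : 0 < ρ) (hρ1 : ρ < 1) (hK : 0 < K) (he : 0 < e)
    (hν : 1 ≤ ν F) (h : ∀ k ≥ 1, ∀ p, ν (Metric.closedBall p (2 * (R * ρ ^ k))) ≤ ENNReal.ofReal
      (K * (μ.real (Metric.closedBall x₀ (R * ρ ^ k)) * (R * ρ ^ k) ^ (-e)))) :
    (dimH A).toReal - 2 * e ≤ (dimH F).toReal := by
  rcases le_or_gt (dimH A).toReal (2 * e) with ha | ha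
  · linarith [ENNReal.toReal_nonneg (a := dimH F)]
  have hlim : Tendsto (fun k ↦ R * ρ ^ k) atTop (nhds 0) := by
    simpa using (tendsto_pow_atTop_nhds_zero_of_lt_one hρ.le hρ1).const_mul R
  have hr (k : ℕ) : 0 < R * ρ ^ k := by positivity
  have hs : ENNReal.ofReal ((dimH A).toReal - e) < dimH A := by
    rw [ENNReal.ofReal_lt_iff_lt_toReal (by linarith) hAtop]
    linarith
  obtain ⟨k₀, hk₀⟩ := eventually_atTop.1
    (hA.eventually_real_le_rpow hx₀ hr hlim (by linarith) hs)
  rw [← ENNReal.ofReal_le_iff_le_toReal hFtop]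
  refine ofReal_le_dimH_of_closedBall_le hν hR hρ hρ1 (by linarith) hK (k₀ := max k₀ 1)
    fun k hk p ↦ (h k (le_of_max_le_right hk) p).trans (ENNReal.ofReal_le_ofReal ?_)
  rw [show (dimH A).toReal - 2 * e = ((dimH A).toReal - e) + -e by ring, Real.rpow_add (hr k)]
  have := hk₀ k (le_of_max_le_left hk)
  gcongr

theorem IsHomog.packDim_mono (hA : IsHomog A μ lam kappa del Del) (hF : F ⊆ A) :
    packDim F ≤ packDim A :=
  csInf_le_csInf ⟨0, fun _ h ↦ h.1⟩ hA.exists_packMeasure_eq_zero fun s h ↦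
    ⟨h.1, le_antisymm ((packMeasure_mono hF s).trans h.2.le) zero_le⟩

theorem IsHomog.packDim_le (hA : IsHomog A μ lam kappa del Del) {x₀ : X} (hx₀ : x₀ ∈ A)
    (hF : F ⊆ A) {R ρ K e : ℝ} (hR : 0 < R) (hρ : 0 < ρ) (hρ1 : ρ < 1) (hK : 0 < K) (he : 0 < e)
    (hν : 1 ≤ ν F) (h : ∀ k ≥ 1, ∀ p, ν (Metric.closedBall p (2 * (R * ρ ^ k))) ≤ ENNReal.ofReal
      (K * (μ.real (Metric.closedBall x₀ (R * ρ ^ k)) * (R * ρ ^ k) ^ (-e)))) :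
    packDim A - 3 * e ≤ packDim F := by
  rcases le_or_gt (packDim A) (3 * e) with ha | ha
  · linarith [packDim_nonneg F]
  have hlim : Tendsto (fun k ↦ R * ρ ^ k) atTop (nhds 0) := by
    simpa using (tendsto_pow_atTop_nhds_zero_of_lt_one hρ.le hρ1).const_mul R
  have hr (k : ℕ) : 0 < R * ρ ^ k := by positivity
  have hdiam := hlim.eventually_le_const hA.diam_pos
  have hfreq : ∃ᶠ k in atTop, μ.real (Metric.closedBall x₀ (R * ρ ^ k)) ≤
      (R * ρ ^ k) ^ (packDim A - 2 * e) := by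
    intro hcon
    obtain ⟨k₀, hk₀⟩ := eventually_atTop.1 (hcon.and hdiam)
    refine packMeasure_ne_zero_of_lt_packDim (S := A) (s := packDim A - e) (by linarith)
      (by linarith) (hA.packMeasure_eq_zero hx₀ hR hρ hρ1 one_pos
      (show 0 ≤ packDim A - 2 * e by linarith) (by linarith) (hk₀ k₀ le_rfl).2 fun k hk ↦ ?_)
    rw [one_mul]
    exact (not_le.1 (hk₀ k hk).1).le
  obtain ⟨s, hs⟩ := hA.exists_packMeasure_eq_zero
  refine le_csInf ⟨s, hs.1, le_antisymm ((packMeasure_mono hF s).trans hs.2.le) zero_le⟩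
    fun u hu ↦ ?_
  by_contra! hlt
  refine packMeasure_ne_zero_of_frequently (t := u) hν hr hlim hK.le ?_ ?_ hu.2
  · filter_upwards [hdiam] with k hk S hS
    exact hA.exists_separated_cover (hS.trans hF) (hr k) hk
  · refine (hfreq.and_eventually ((hlim.eventually_le_const one_pos).and
      (eventually_ge_atTop 1))).mono fun k hk p ↦ (h k hk.2.2 p).trans
      (ENNReal.ofReal_le_ofReal ?_)
    gcongr
    calc _ ≤ (R * ρ ^ k) ^ (packDim A - 2 * e) * (R * ρ ^ k) ^ (-e) := by
          gcongr
          exact hk.1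
      _ = (R * ρ ^ k) ^ (packDim A - 2 * e + -e) := (Real.rpow_add (hr k) _ _).symm
      _ ≤ (R * ρ ^ k) ^ u :=
        Real.rpow_le_rpow_of_exponent_ge (hr k) hk.2.1 (by linarith)

end Approximation

/-- For a homogeneous set `A ⊆ ℝ^d` and any `ε > 0` there is a Moran set `F ⊆ A` with
`d_H(F,A) < ε`, `0 ≤ dim_P A − dim_P F < ε` and `0 ≤ dim_H A − dim_H F < ε`. -/
theorem statement11 {d : ℕ} (A : Set (EuclideanSpace ℝ (Fin d)))
    (μ : Measure (EuclideanSpace ℝ (Fin d))) (lam kappa del Del : ℝ)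
    (hA : IsHomog A μ lam kappa del Del) (ε : ℝ) (hε : 0 < ε) :
    ∃ (J : Set (EuclideanSpace ℝ (Fin d))) (n : ℕ → ℕ) (c : ℕ → ℝ)
      (Jw : List ℕ → Set (EuclideanSpace ℝ (Fin d))),
      IsMoranSystem J n c Jw ∧ moranSet n Jw ⊆ A ∧
      Metric.hausdorffDist (moranSet n Jw) A < ε ∧
      0 ≤ packDim A - packDim (moranSet n Jw) ∧
      packDim A - packDim (moranSet n Jw) < ε ∧
      0 ≤ (dimH A).toReal - (dimH (moranSet n Jw)).toReal ∧
      (dimH A).toReal - (dimH (moranSet n Jw)).toReal < ε := by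
  obtain ⟨x₀, hx₀⟩ : A.Nonempty := by
    rw [Set.nonempty_iff_ne_empty]
    rintro rfl
    simpa using hA.diam_pos
  have he : 0 < ε / 4 := by positivity
  obtain ⟨J, n, c, Jw, hJ, hF, hdist, R, ρ, K, ν, hR, hρ, hρ1, hK, -, hν, hνB⟩ :=
    hA.exists_moranSystem hx₀ hε he
  have hP := hA.packDim_le hx₀ hF hR hρ hρ1 hK he hν hνB
  have hH := hA.toReal_dimH_le hx₀ (Real.dimH_ne_top _) (Real.dimH_ne_top _) hR hρ hρ1 hK he hν hνB
  refine ⟨J, n, c, Jw, hJ, hF, hdist, sub_nonneg.2 (hA.packDim_mono hF), by linarith,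
    sub_nonneg.2 (ENNReal.toReal_mono (Real.dimH_ne_top _) (dimH_mono hF)), by linarith⟩

end
end

section
/- Let A and B be homogeneous sets with measures μ and ν respectively, such that α_A(r) ∼ α_A(x*,r) and α_B(r) ∼ α_B(y*,r) for some x* ∈ A and y* ∈ B, and suppose A can be bilipschitz embedded into B. Then: (i) there is a constant C such that μ(B(x,r))/μ(B(x,r')) ≤ C · ν(B(y,r))/ν(B(y,r')) for all x ∈ A, y ∈ B and 0 < r' < r ≤ min(|A|,|B|); (ii) there exist δ ∈ (0,1) and a non-decreasing function ε : (0,δ) → (0,∞) with ε(r₀) ↓ 0 as r₀ ↓ 0 such that for every r₀ < δ, sup over all r, r' with r' < r₀·r < r < r₀ of |(α_A(r) log r − α_A(r') log r')/(α_B(r) log r − α_B(r') log r')| is at most 1 + ε(r₀). -/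
open scoped ENNReal

noncomputable section

open Filter MeasureTheory

/-- A totally bounded set has a finite `r`-separated subset whose closed `r`-balls cover it. -/
lemma TotallyBounded.exists_finset_separated_cover {X : Type*} [PseudoMetricSpace X] {s : Set X}
    (hs : TotallyBounded s) {r : ℝ} (hr : 0 < r) :
    ∃ t : Finset X, (t : Set X) ⊆ s ∧ (∀ x ∈ t, ∀ y ∈ t, x ≠ y → r < dist x y) ∧
      s ⊆ ⋃ x ∈ t, Metric.closedBall x r := by
  lift r to NNReal using hr.le
  have hr' : r / 2 ≠ 0 := by
    have : r ≠ 0 := by rintro rfl; simp at hr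
    positivity
  obtain ⟨N, -, hNfin, hN⟩ := Metric.exists_finite_isCover_of_totallyBounded hr' hs
  have hpack : Metric.packingNumber r s ≠ ⊤ := by
    have h₁ := Metric.packingNumber_two_mul_le_externalCoveringNumber (r / 2) s
    rw [mul_div_cancel₀ r two_ne_zero] at h₁
    have h₂ := h₁.trans hN.externalCoveringNumber_le_encard
    exact ne_top_of_le_ne_top hNfin.encard_lt_top.ne h₂
  have hfin : (Metric.maximalSeparatedSet r s).Finite := by
    rw [← Set.encard_ne_top_iff, Metric.encard_maximalSeparatedSet hpack]
    exact hpack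
  refine ⟨hfin.toFinset, ?_, ?_, ?_⟩
  · simpa using Metric.maximalSeparatedSet_subset
  · intro x hx y hy hxy
    have h : (r : ℝ≥0∞) < edist x y := Metric.isSeparated_maximalSeparatedSet
      (hfin.mem_toFinset.1 hx) (hfin.mem_toFinset.1 hy) hxy
    rw [edist_nndist] at h
    exact_mod_cast h
  · simpa using (Metric.isCover_maximalSeparatedSet hpack).subset_iUnion_closedBall

namespace IsHomog

variable {X : Type*} [MetricSpace X] [MeasurableSpace X] {A : Set X} {μ : Measure X}
  {lam kappa del Del : ℝ}

lemma real_closedBall_pos (hA : IsHomog A μ lam kappa del Del) {x : X} (hx : x ∈ A) {r : ℝ}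
    (hr : 0 < r) : 0 < μ.real (Metric.closedBall x r) := by
  have := hA.prob
  exact ENNReal.toReal_pos (hA.supp_pos x hx r hr).ne' (by finiteness)

lemma real_closedBall_mono (hA : IsHomog A μ lam kappa del Del) (x : X) {r s : ℝ}
    (hrs : r ≤ s) : μ.real (Metric.closedBall x r) ≤ μ.real (Metric.closedBall x s) := by
  have := hA.prob
  exact measureReal_mono (Metric.closedBall_subset_closedBall hrs)

lemma real_le_of_inter_subset (hA : IsHomog A μ lam kappa del Del) {s t : Set X}
    (h : A ∩ s ⊆ t) : μ.real s ≤ μ.real t := by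
  have := hA.prob
  refine ENNReal.toReal_mono (by finiteness) ?_
  calc μ s ≤ μ (t ∪ Aᶜ) := measure_mono fun x hx => by
        by_cases hxA : x ∈ A
        · exact Or.inl (h ⟨hxA, hx⟩)
        · exact Or.inr hxA
    _ ≤ μ t + μ Aᶜ := measure_union_le _ _
    _ = μ t := by rw [hA.supp_null, add_zero]

lemma real_closedBall_le_min (hA : IsHomog A μ lam kappa del Del) {x : X} (hx : x ∈ A) (r : ℝ) :
    μ.real (Metric.closedBall x r) ≤ μ.real (Metric.closedBall x (min r (Metric.diam A))) := by
  refine hA.real_le_of_inter_subset fun y hy => ?_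
  exact Metric.mem_closedBall.2
    (le_min hy.2 (Metric.dist_le_diam_of_mem hA.compact.isBounded hy.1 hx))

lemma real_closedBall_le_pow_mul (hA : IsHomog A μ lam kappa del Del) {x : X} (hx : x ∈ A)
    {r : ℝ} (hr : 0 < r) (hrA : r ≤ Metric.diam A) (k : ℕ) :
    μ.real (Metric.closedBall x r) ≤ Del ^ k * μ.real (Metric.closedBall x (kappa ^ k * r)) := by
  have hκ := hA.kappa_pos
  have hDel : 0 ≤ Del := (zero_lt_one.trans hA.one_lt_del).le.trans hA.del_le_Del
  induction k with
  | zero => simp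
  | succ k ih =>
    have h := hA.scale_upper x hx (kappa ^ k * r) (by positivity)
      ((mul_le_of_le_one_left hr.le (pow_le_one₀ hκ.le hA.kappa_lt_one.le)).trans hrA)
    calc _ ≤ _ := ih
      _ ≤ Del ^ k * (Del * μ.real (Metric.closedBall x (kappa * (kappa ^ k * r)))) :=
        mul_le_mul_of_nonneg_left h (by positivity)
      _ = _ := by rw [← mul_assoc, ← pow_succ, ← mul_assoc, ← pow_succ']

lemma pow_mul_le_real_closedBall (hA : IsHomog A μ lam kappa del Del) {x : X} (hx : x ∈ A)
    {r : ℝ} (hr : 0 < r) (hrA : r ≤ Metric.diam A) (k : ℕ) :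
    del ^ k * μ.real (Metric.closedBall x (kappa ^ k * r)) ≤ μ.real (Metric.closedBall x r) := by
  have hκ := hA.kappa_pos
  have hdel : 0 ≤ del := (zero_lt_one.trans hA.one_lt_del).le
  induction k with
  | zero => simp
  | succ k ih =>
    have h := hA.scale_lower x hx (kappa ^ k * r) (by positivity)
      ((mul_le_of_le_one_left hr.le (pow_le_one₀ hκ.le hA.kappa_lt_one.le)).trans hrA)
    calc del ^ (k + 1) * μ.real (Metric.closedBall x (kappa ^ (k + 1) * r))
        = del ^ k * (del * μ.real (Metric.closedBall x (kappa * (kappa ^ k * r)))) := by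
          rw [← mul_assoc, ← pow_succ, ← mul_assoc, ← pow_succ']
      _ ≤ _ := mul_le_mul_of_nonneg_left h (by positivity)
      _ ≤ _ := ih

/-- The measure of a homogeneous set is doubling, at any dilation factor. -/
lemma exists_real_closedBall_mul_le (hA : IsHomog A μ lam kappa del Del) {t : ℝ} (ht : 0 < t) :
    ∃ K : ℝ, 0 < K ∧ ∀ x ∈ A, ∀ r : ℝ, 0 < r →
      μ.real (Metric.closedBall x (t * r)) ≤ K * μ.real (Metric.closedBall x r) := by
  have hκ := hA.kappa_pos
  have hDel : 0 < Del := (zero_lt_one.trans hA.one_lt_del).trans_le hA.del_le_Del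
  obtain ⟨k, hk⟩ := exists_pow_lt_of_lt_one (inv_pos.2 ht) hA.kappa_lt_one
  refine ⟨Del ^ k, by positivity, fun x hx r hr => ?_⟩
  have hpos : 0 < min (t * r) (Metric.diam A) := lt_min (by positivity) hA.diam_pos
  refine (hA.real_closedBall_le_min hx _).trans
    ((hA.real_closedBall_le_pow_mul hx hpos (min_le_right _ _) k).trans ?_)
  refine mul_le_mul_of_nonneg_left (hA.real_closedBall_mono x ?_) (by positivity)
  calc kappa ^ k * min (t * r) (Metric.diam A) ≤ t⁻¹ * (t * r) :=
        mul_le_mul hk.le (min_le_left _ _) hpos.le (by positivity)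
    _ = r := by field_simp

/-- The measure of a ball centred in a homogeneous set is at most the number of points in a
separated net times the measure of a small ball. -/
lemma exists_finset_separated_real_closedBall_le (hA : IsHomog A μ lam kappa del Del) {x : X}
    (hx : x ∈ A) {r r' : ℝ} (hr' : 0 < r') (hr'A : r' ≤ Metric.diam A) :
    ∃ t : Finset X, (t : Set X) ⊆ A ∩ Metric.closedBall x r ∧
      (∀ y ∈ t, ∀ z ∈ t, y ≠ z → r' < dist y z) ∧
      μ.real (Metric.closedBall x r) ≤ t.card * (lam * μ.real (Metric.closedBall x r')) := by
  obtain ⟨t, htA, hsep, hcov⟩ := (hA.compact.totallyBounded.subset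
    (Set.inter_subset_left (t := Metric.closedBall x r))).exists_finset_separated_cover hr'
  refine ⟨t, htA, hsep, ?_⟩
  calc μ.real (Metric.closedBall x r) ≤ μ.real (⋃ y ∈ t, Metric.closedBall y r') :=
        hA.real_le_of_inter_subset hcov
    _ ≤ ∑ y ∈ t, μ.real (Metric.closedBall y r') := measureReal_biUnion_finset_le _ _
    _ ≤ ∑ _y ∈ t, lam * μ.real (Metric.closedBall x r') :=
        Finset.sum_le_sum fun y hy => hA.ratio_le y (htA hy).1 x hx r' hr' hr'A
    _ = _ := by rw [Finset.sum_const, nsmul_eq_mul]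

/-- The number of points of a separated subset of a ball is controlled by a ratio of measures. -/
lemma card_mul_real_closedBall_le [BorelSpace X] (hA : IsHomog A μ lam kappa del Del) {ι : Type*}
    {t : Finset ι} {g : ι → X} {x y : X} (hx : x ∈ A) {R s : ℝ} (hs : 0 < s)
    (hsA : s ≤ Metric.diam A) (htA : ∀ i ∈ t, g i ∈ A)
    (ht : ∀ i ∈ t, dist (g i) y ≤ R)
    (hsep : ∀ i ∈ t, ∀ j ∈ t, i ≠ j → 2 * s < dist (g i) (g j)) :
    t.card * μ.real (Metric.closedBall x s) ≤ lam * μ.real (Metric.closedBall y (R + s)) := by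
  have := hA.prob
  have hlam : 0 ≤ lam := zero_le_one.trans hA.one_le_lam
  have hdisj : (t : Set ι).PairwiseDisjoint fun i => Metric.closedBall (g i) s :=
    fun i hi j hj hij => Metric.closedBall_disjoint_closedBall
      (by linarith [hsep i hi j hj hij])
  calc (t.card : ℝ) * μ.real (Metric.closedBall x s)
      = ∑ _i ∈ t, μ.real (Metric.closedBall x s) := by rw [Finset.sum_const, nsmul_eq_mul]
    _ ≤ ∑ i ∈ t, lam * μ.real (Metric.closedBall (g i) s) :=
        Finset.sum_le_sum fun i hi => hA.ratio_le x hx (g i) (htA i hi) s hs hsA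
    _ = lam * μ.real (⋃ i ∈ t, Metric.closedBall (g i) s) := by
        rw [← Finset.mul_sum, measureReal_biUnion_finset hdisj
          fun i _ => Metric.isClosed_closedBall.measurableSet]
    _ ≤ _ := by
        refine mul_le_mul_of_nonneg_left (measureReal_mono (Set.iUnion₂_subset fun i hi => ?_)) hlam
        exact Metric.closedBall_subset_closedBall' (by linarith [ht i hi])

/-- Logarithmic growth of the measure of balls in a homogeneous set. -/
lemma log_growth (hA : IsHomog A μ lam kappa del Del) {x : X} (hx : x ∈ A) {r₀ r r' : ℝ}
    (hr₀ : 0 < r₀) (hr₀1 : r₀ ≤ 1) (hr' : 0 < r') (hr'r : r' ≤ r₀ * r)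
    (hrA : r ≤ Metric.diam A) :
    Real.log del * (Real.log r₀ / Real.log kappa - 1) ≤
      Real.log (μ.real (Metric.closedBall x r)) - Real.log (μ.real (Metric.closedBall x r')) := by
  have hr : 0 < r := pos_of_mul_pos_right (hr'.trans_le hr'r) hr₀.le
  have hdel : 0 < del := zero_lt_one.trans hA.one_lt_del
  obtain ⟨k, hk, hk'⟩ := exists_nat_pow_near_of_lt_one hr₀ hr₀1 hA.kappa_pos hA.kappa_lt_one
  have hlogκ : Real.log kappa < 0 := Real.log_neg hA.kappa_pos hA.kappa_lt_one
  have hkle : Real.log r₀ / Real.log kappa - 1 ≤ k := by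
    have h := Real.log_lt_log (pow_pos hA.kappa_pos _) hk
    rw [Real.log_pow] at h
    push_cast at h
    rw [sub_le_iff_le_add, div_le_iff_of_neg hlogκ]
    exact h.le
  have hpos := hA.real_closedBall_pos hx hr'
  have hmain : del ^ k * μ.real (Metric.closedBall x r') ≤ μ.real (Metric.closedBall x r) :=
    (mul_le_mul_of_nonneg_left (hA.real_closedBall_mono x
      (hr'r.trans (mul_le_mul_of_nonneg_right hk' hr.le))) (by positivity)).trans
      (hA.pow_mul_le_real_closedBall hx hr hrA k)
  have hlog := Real.log_le_log (by positivity) hmain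
  rw [Real.log_mul (by positivity) hpos.ne', Real.log_pow] at hlog
  have := mul_le_mul_of_nonneg_left hkle (Real.log_pos hA.one_lt_del).le
  linarith

end IsHomog

/-- A bilipschitz embedding between homogeneous sets forces the ratios of measures of concentric
balls in the source to be controlled by those in the target. -/
lemma BilipEmbed.exists_ratio_le {X Y : Type*} [MetricSpace X] [MeasurableSpace X]
    [MetricSpace Y] [MeasurableSpace Y] [BorelSpace Y]
    {A : Set X} {B : Set Y} {μ : Measure X} {ν : Measure Y}
    {lamA kapA delA DelA lamB kapB delB DelB : ℝ}
    (hemb : BilipEmbed A B) (hA : IsHomog A μ lamA kapA delA DelA)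
    (hB : IsHomog B ν lamB kapB delB DelB) :
    ∃ C : ℝ, 0 < C ∧ ∀ x ∈ A, ∀ y ∈ B, ∀ r' r : ℝ, 0 < r' → r' < r →
      r ≤ min (Metric.diam A) (Metric.diam B) →
      μ.real (Metric.closedBall x r) / μ.real (Metric.closedBall x r') ≤
        C * (ν.real (Metric.closedBall y r) / ν.real (Metric.closedBall y r')) := by
  obtain ⟨f, L, hL, hfAB, -, hf⟩ := hemb
  have hL0 : 0 < L := zero_lt_one.trans_le hL
  obtain ⟨K, hK, hdoub⟩ := hB.exists_real_closedBall_mul_le (t := 2 * L) (by positivity)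
  have hlamA : 0 < lamA := zero_lt_one.trans_le hA.one_le_lam
  have hlamB : 0 < lamB := zero_lt_one.trans_le hB.one_le_lam
  refine ⟨lamA * (K * (lamB * (K * lamB))), by positivity, fun x hx y hy r' r hr' hr'r hr => ?_⟩
  have hr0 : 0 < r := hr'.trans hr'r
  have hrA := hr.trans (min_le_left _ _)
  have hrB := hr.trans (min_le_right _ _)
  obtain ⟨t, htA, hsep, hcard⟩ :=
    hA.exists_finset_separated_real_closedBall_le hx (r := r) hr' (hr'r.le.trans hrA)
  have hs : 0 < r' / (2 * L) := by positivity
  have hsr : r' / (2 * L) ≤ r' := div_le_self hr'.le (by linarith)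
  have hcount : t.card * ν.real (Metric.closedBall y (r' / (2 * L))) ≤
      lamB * ν.real (Metric.closedBall (f x) (L * r + r' / (2 * L))) := by
    refine hB.card_mul_real_closedBall_le (g := f) hy hs (hsr.trans (hr'r.le.trans hrB))
      (fun i hi => hfAB (htA hi).1) (fun i hi => ?_) fun i hi j hj hij => ?_
    · exact (hf i (htA hi).1 x hx).2.trans
        (mul_le_mul_of_nonneg_left (Metric.mem_closedBall.1 (htA hi).2) hL0.le)
    · calc 2 * (r' / (2 * L)) = r' / L := by field_simp
        _ < dist i j / L := div_lt_div_of_pos_right (hsep i hi j hj hij) hL0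
        _ ≤ _ := (hf i (htA hi).1 j (htA hj).1).1
  have hbig : ν.real (Metric.closedBall (f x) (L * r + r' / (2 * L))) ≤
      K * (lamB * ν.real (Metric.closedBall y r)) := by
    calc _ ≤ ν.real (Metric.closedBall (f x) (2 * L * r)) :=
          hB.real_closedBall_mono _ (by nlinarith)
      _ ≤ K * ν.real (Metric.closedBall (f x) r) := hdoub _ (hfAB hx) r hr0
      _ ≤ _ := mul_le_mul_of_nonneg_left (hB.ratio_le _ (hfAB hx) y hy r hr0 hrB) hK.le
  have hsmall : ν.real (Metric.closedBall y r') ≤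
      K * ν.real (Metric.closedBall y (r' / (2 * L))) := by
    have h := hdoub y hy _ hs
    rwa [mul_div_cancel₀ r' (by positivity)] at h
  have hμ' := hA.real_closedBall_pos hx hr'
  have hν' := hB.real_closedBall_pos hy hr'
  rw [div_le_iff₀ hμ', mul_div_assoc', div_mul_eq_mul_div, le_div_iff₀ hν']
  calc μ.real (Metric.closedBall x r) * ν.real (Metric.closedBall y r')
      ≤ (t.card * (lamA * μ.real (Metric.closedBall x r'))) *
          (K * ν.real (Metric.closedBall y (r' / (2 * L)))) :=
        mul_le_mul hcard hsmall hν'.le (by positivity)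
    _ = lamA * μ.real (Metric.closedBall x r') * K *
          (t.card * ν.real (Metric.closedBall y (r' / (2 * L)))) := by ring
    _ ≤ lamA * μ.real (Metric.closedBall x r') * K *
          (lamB * (K * (lamB * ν.real (Metric.closedBall y r)))) := by
        refine mul_le_mul_of_nonneg_left (hcount.trans ?_) (by positivity)
        exact mul_le_mul_of_nonneg_left hbig hlamB.le
    _ = _ := by ring

lemma EquivNearZero.exists_abs_mul_log_sub_log_le {X : Type*} [MetricSpace X] [MeasurableSpace X]
    {μ : Measure X} {x : X} {g : ℝ → ℝ} (h : EquivNearZero g fun r => alphaPt μ x r) :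
    ∃ C : ℝ, 0 < C ∧ ∃ δ : ℝ, 0 < δ ∧ δ ≤ 1 ∧ ∀ r : ℝ, 0 < r → r < δ →
      |g r * Real.log r - Real.log (μ.real (Metric.closedBall x r))| ≤ C := by
  obtain ⟨C, hC, δ, hδ, h⟩ := h
  refine ⟨C, hC, min δ 1, lt_min hδ one_pos, min_le_right _ _, fun r hr hrδ => ?_⟩
  have hlog : Real.log r < 0 := Real.log_neg hr (hrδ.trans_le (min_le_right _ _))
  have h₁ := h r hr (hrδ.trans_le (min_le_left _ _))
  have h₂ : alphaPt μ x r * Real.log r = Real.log (μ.real (Metric.closedBall x r)) :=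
    div_mul_cancel₀ _ hlog.ne
  rwa [le_div_iff₀ (abs_pos.2 hlog.ne), ← abs_mul, sub_mul, h₂, abs_sub_comm] at h₁

/-- If `|p| ≤ v + a` and `q ≥ v - b` with `v ≥ s > b`, then `|p / q|` is close to `1`. -/
lemma abs_div_le_one_add_div {p q v a b s : ℝ} (hab : 0 ≤ a + b) (hbs : b < s) (hsv : s ≤ v)
    (hp : |p| ≤ v + a) (hq : v - b ≤ q) : |p / q| ≤ 1 + (a + b) / (s - b) := by
  have hv : 0 < v - b := by linarith
  have hs : 0 < s - b := by linarith
  have hq0 : 0 < q := hv.trans_le hq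
  rw [abs_div, abs_of_pos hq0]
  calc |p| / q ≤ (v + a) / (v - b) := div_le_div₀ ((abs_nonneg p).trans hp) hp hv hq
    _ = 1 + (a + b) / (v - b) := by field_simp; ring
    _ ≤ _ := by gcongr

/-- A gauge of the form `M / (logarithmic growth)` is positive, non-decreasing and tends to `0`. -/
lemma exists_gauge {a b M κ : ℝ} (ha : 0 < a) (hM : 0 < M) (hκ : 0 < κ) (hκ1 : κ < 1) :
    ∃ δ : ℝ, 0 < δ ∧ (∀ r : ℝ, 0 < r → r < δ → b < a * (Real.log r / Real.log κ - 1)) ∧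
      (∀ r s : ℝ, 0 < r → r ≤ s → s < δ →
        M / (a * (Real.log r / Real.log κ - 1) - b) ≤
          M / (a * (Real.log s / Real.log κ - 1) - b)) ∧
      Tendsto (fun r => M / (a * (Real.log r / Real.log κ - 1) - b))
        (nhdsWithin (0 : ℝ) (Set.Ioi 0)) (nhds 0) := by
  have hlogκ : Real.log κ < 0 := Real.log_neg hκ hκ1
  have htend : Tendsto (fun r => a * (Real.log r / Real.log κ - 1))
      (nhdsWithin (0 : ℝ) (Set.Ioi 0)) atTop := by
    refine Tendsto.const_mul_atTop ha (tendsto_atTop_add_const_right _ _ ?_)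
    simp only [div_eq_mul_inv]
    exact Real.tendsto_log_nhdsGT_zero.atBot_mul_const_of_neg (inv_lt_zero.2 hlogκ)
  obtain ⟨δ, hδ, hsub⟩ := mem_nhdsGT_iff_exists_Ioo_subset.1 (htend.eventually_gt_atTop b)
  refine ⟨δ, hδ, fun r hr hrδ => hsub ⟨hr, hrδ⟩, fun r s hr hrs hsδ => ?_, ?_⟩
  · have hs : b < a * (Real.log s / Real.log κ - 1) := hsub ⟨hr.trans_le hrs, hsδ⟩
    have hlog : Real.log s / Real.log κ ≤ Real.log r / Real.log κ :=
      div_le_div_of_nonpos_of_le hlogκ.le (Real.log_le_log hr hrs)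
    refine div_le_div_of_nonneg_left hM.le (sub_pos.2 hs) ?_
    gcongr
  · exact (tendsto_atTop_add_const_right _ (-b) htend).const_div_atTop M

/-- Necessary conditions for a bilipschitz embedding of the homogeneous set `A` into the
homogeneous set `B`: (i) `μ(B(x,r))/μ(B(x,r')) ≤ C · ν(B(y,r))/ν(B(y,r'))` for all
`x ∈ A`, `y ∈ B`, `r' < r ≤ min(|A|,|B|)`; (ii) there is a non-decreasing
`ε : (0,δ) → (0,∞)` with `ε(r₀) ↓ 0` as `r₀ ↓ 0` such that
`sup_{r' < r₀ r < r < r₀} |(α_A(r)log r − α_A(r')log r')/(α_B(r)log r − α_B(r')log r')|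
≤ 1 + ε(r₀)` for every `r₀ < δ`. -/
theorem statement12 {X Y : Type*} [MetricSpace X] [MeasurableSpace X] [BorelSpace X]
    [MetricSpace Y] [MeasurableSpace Y] [BorelSpace Y]
    (A : Set X) (B : Set Y) (μ : Measure X) (ν : Measure Y)
    (lamA kapA delA DelA lamB kapB delB DelB : ℝ)
    (hA : IsHomog A μ lamA kapA delA DelA) (hB : IsHomog B ν lamB kapB delB DelB)
    (gA gB : ℝ → ℝ) (hgA : IsAlphaRep A μ gA) (hgB : IsAlphaRep B ν gB)
    (hemb : BilipEmbed A B) :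
    (∃ C : ℝ, 0 < C ∧ ∀ x ∈ A, ∀ y ∈ B, ∀ r' r : ℝ, 0 < r' → r' < r →
      r ≤ min (Metric.diam A) (Metric.diam B) →
      (μ (Metric.closedBall x r)).toReal / (μ (Metric.closedBall x r')).toReal ≤
        C * ((ν (Metric.closedBall y r)).toReal / (ν (Metric.closedBall y r')).toReal)) ∧
    (∃ δ : ℝ, 0 < δ ∧ δ < 1 ∧ ∃ e : ℝ → ℝ,
      (∀ a b : ℝ, 0 < a → a ≤ b → b < δ → e a ≤ e b) ∧
      (∀ a : ℝ, 0 < a → a < δ → 0 < e a) ∧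
      Filter.Tendsto e (nhdsWithin (0 : ℝ) (Set.Ioi 0)) (nhds 0) ∧
      ∀ r₀ : ℝ, 0 < r₀ → r₀ < δ → ∀ r r' : ℝ, 0 < r' → r' < r₀ * r → r < r₀ →
        |(gA r * Real.log r - gA r' * Real.log r') /
          (gB r * Real.log r - gB r' * Real.log r')| ≤ 1 + e r₀) := by
  obtain ⟨C, hC, hratio⟩ := hemb.exists_ratio_le hA hB
  refine ⟨⟨C, hC, hratio⟩, ?_⟩
  obtain ⟨x, hx, hgx⟩ := hgA
  obtain ⟨y, hy, hgy⟩ := hgB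
  obtain ⟨CA, hCA, δA, hδA, hδA1, hgA⟩ := hgx.exists_abs_mul_log_sub_log_le
  obtain ⟨CB, hCB, δB, hδB, -, hgB⟩ := hgy.exists_abs_mul_log_sub_log_le
  set a : ℝ := |Real.log C| + 2 * CA with ha
  have ha0 : 0 < a := by positivity
  obtain ⟨δ, hδ, hgrow, hmono, htend⟩ := exists_gauge (b := 2 * CB) (M := a + 2 * CB)
    (Real.log_pos hB.one_lt_del) (by positivity) hB.kappa_pos hB.kappa_lt_one
  set D : ℝ := min (Metric.diam A) (Metric.diam B) with hD
  have hD0 : 0 < D := lt_min hA.diam_pos hB.diam_pos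
  obtain ⟨η, hη, hηlt⟩ := exists_between
    (show (0 : ℝ) < min (min δA δB) (min δ D) from lt_min (lt_min hδA hδB) (lt_min hδ hD0))
  simp only [lt_min_iff] at hηlt
  obtain ⟨⟨hηA, hηB⟩, hηδ, hηD⟩ := hηlt
  refine ⟨η, hη, hηA.trans_le hδA1, _, fun r s hr hrs hs => hmono r s hr hrs (hs.trans hηδ),
    fun r hr hrη => div_pos (by positivity) (sub_pos.2 (hgrow r hr (hrη.trans hηδ))), htend, ?_⟩
  intro r₀ hr₀ hr₀η r r' hr' hr'r hrr₀
  have hr₀1 : r₀ < 1 := hr₀η.trans (hηA.trans_le hδA1)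
  have hr : 0 < r := pos_of_mul_pos_right (hr'.trans hr'r) hr₀.le
  have hrη : r < η := hrr₀.trans hr₀η
  have hlt : r' < r := hr'r.trans_le (mul_le_of_le_one_left hr.le hr₀1.le)
  have hrD : r ≤ D := (hrη.trans hηD).le
  have hμ := hA.real_closedBall_pos hx hr
  have hμ' := hA.real_closedBall_pos hx hr'
  have hν := hB.real_closedBall_pos hy hr
  have hν' := hB.real_closedBall_pos hy hr'
  have hv := hB.log_growth hy hr₀ hr₀1.le hr' hr'r.le (hrD.trans (min_le_right _ _))
  have hu : Real.log (μ.real (Metric.closedBall x r')) ≤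
      Real.log (μ.real (Metric.closedBall x r)) :=
    Real.log_le_log hμ' (hA.real_closedBall_mono x hlt.le)
  have huv := Real.log_le_log (div_pos hμ hμ') (hratio x hx y hy r' r hr' hlt hrD)
  change Real.log (μ.real _ / μ.real _) ≤ Real.log (C * (ν.real _ / ν.real _)) at huv
  rw [Real.log_mul hC.ne' (div_pos hν hν').ne', Real.log_div hμ.ne' hμ'.ne',
    Real.log_div hν.ne' hν'.ne'] at huv
  have h₁ := abs_le.1 (hgA r hr (hrη.trans hηA))
  have h₂ := abs_le.1 (hgA r' hr' (hlt.trans (hrη.trans hηA)))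
  have h₃ := abs_le.1 (hgB r hr (hrη.trans hηB))
  have h₄ := abs_le.1 (hgB r' hr' (hlt.trans (hrη.trans hηB)))
  have hlogC := le_abs_self (Real.log C)
  have hlogC' := abs_nonneg (Real.log C)
  refine abs_div_le_one_add_div (by positivity) (hgrow r₀ hr₀ (hr₀η.trans hηδ)) hv
    (abs_le.2 ⟨?_, ?_⟩) ?_ <;> linarith

end
end

section
/- There exist a homogeneous set B and a number t ∈ (0, dim_H B) such that no Ahlfors–David regular set A with t < dim_H A < dim_H B can be bilipschitz embedded into B. (In particular, no self-similar set satisfying the strong separation condition with Hausdorff dimension in (t, dim_H B) embeds bilipschitzly into B; the construction gives a Moran set B ⊂ [0,1] with dim_H B = dim_P B = log 5/log 6 and t = log 3/log 6.) -/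
open scoped ENNReal

noncomputable section

open Filter MeasureTheory

/-! ### Separated nets and measures of balls -/

lemma exists_finset_net {X : Type*} [MetricSpace X] {F : Set X} (hF : TotallyBounded F)
    {ε : ℝ} (hε : 0 < ε) :
    ∃ t : Finset X, ↑t ⊆ F ∧ (∀ x ∈ t, ∀ y ∈ t, x ≠ y → ε < dist x y) ∧
      ∀ x ∈ F, ∃ y ∈ t, dist x y ≤ ε := by
  lift ε to NNReal using hε.le
  have hε' : ε ≠ 0 := by rintro rfl; simp at hε
  obtain ⟨N, -, hfin, hN⟩ :=
    Metric.exists_finite_isCover_of_totallyBounded (ε := ε / 2) (by positivity) hF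
  have hpack : Metric.packingNumber ε F ≠ ⊤ := by
    have h1 := Metric.packingNumber_two_mul_le_externalCoveringNumber (ε / 2) F
    rw [mul_div_cancel₀ _ two_ne_zero] at h1
    exact ((h1.trans hN.externalCoveringNumber_le_encard).trans_lt hfin.encard_lt_top).ne
  obtain ⟨S, hS⟩ : ∃ S, S = Metric.maximalSeparatedSet ε F := ⟨_, rfl⟩
  have hSfin : S.Finite := by
    rw [← Set.encard_ne_top_iff, hS, Metric.encard_maximalSeparatedSet hpack]
    exact hpack
  refine ⟨hSfin.toFinset, by simpa [hS] using Metric.maximalSeparatedSet_subset, ?_, ?_⟩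
  · intro x hx y hy hxy
    have hsep : Metric.IsSeparated (ε : ℝ≥0∞) S := hS ▸ Metric.isSeparated_maximalSeparatedSet
    have h2 : (ε : ℝ≥0∞) < edist x y := hsep (by simpa using hx) (by simpa using hy) hxy
    rw [edist_nndist] at h2
    exact_mod_cast h2
  · intro x hx
    have hcov := Metric.isCover_iff_subset_iUnion_closedBall.1
      (Metric.isCover_maximalSeparatedSet hpack)
    obtain ⟨y, hy, hxy⟩ := Set.mem_iUnion₂.1 (hcov hx)
    exact ⟨y, by simpa [hS] using hy, by simpa using hxy⟩

lemma card_mul_le_measureReal {ι X : Type*} [MetricSpace X] [MeasurableSpace X] [BorelSpace X]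
    (μ : Measure X) [IsFiniteMeasure μ] (t : Finset ι) (g : ι → X) {ρ a : ℝ} {U : Set X}
    (hsep : ∀ i ∈ t, ∀ j ∈ t, i ≠ j → 2 * ρ < dist (g i) (g j))
    (hU : ∀ i ∈ t, Metric.closedBall (g i) ρ ⊆ U)
    (ha : ∀ i ∈ t, a ≤ μ.real (Metric.closedBall (g i) ρ)) :
    t.card * a ≤ μ.real U := by
  have hdisj : (t : Set ι).PairwiseDisjoint fun i => Metric.closedBall (g i) ρ := by
    intro i hi j hj hij
    exact Metric.closedBall_disjoint_closedBall (by linarith [hsep i hi j hj hij])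
  calc (t.card : ℝ) * a = ∑ _i ∈ t, a := by simp
    _ ≤ ∑ i ∈ t, μ.real (Metric.closedBall (g i) ρ) := Finset.sum_le_sum ha
    _ = μ.real (⋃ i ∈ t, Metric.closedBall (g i) ρ) :=
      (measureReal_biUnion_finset hdisj fun i _ => Metric.isClosed_closedBall.measurableSet).symm
    _ ≤ μ.real U := measureReal_mono (Set.iUnion₂_subset hU)

lemma measureReal_le_card_mul {X : Type*} [MetricSpace X] [MeasurableSpace X]
    (μ : Measure X) [IsFiniteMeasure μ] (t : Finset X) {ε a : ℝ} {F : Set X}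
    (hcov : ∀ x ∈ F, ∃ y ∈ t, dist x y ≤ ε)
    (ha : ∀ y ∈ t, μ.real (Metric.closedBall y ε) ≤ a) :
    μ.real F ≤ t.card * a := by
  calc μ.real F ≤ μ.real (⋃ y ∈ t, Metric.closedBall y ε) := by
        refine measureReal_mono (fun x hx => ?_) (measure_ne_top _ _)
        obtain ⟨y, hy, hxy⟩ := hcov x hx
        exact Set.mem_iUnion₂.2 ⟨y, hy, hxy⟩
    _ ≤ ∑ y ∈ t, μ.real (Metric.closedBall y ε) := measureReal_biUnion_finset_le _ _
    _ ≤ ∑ _y ∈ t, a := Finset.sum_le_sum ha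
    _ = t.card * a := by simp

/-! ### Dimension estimates from measures of balls -/

open scoped NNReal in
lemma dimH_le_of_le_measureReal_closedBall {X : Type*} [MetricSpace X] [MeasurableSpace X]
    [BorelSpace X] {A : Set X} (hA : TotallyBounded A) (μ : Measure X) [IsFiniteMeasure μ]
    {c r₀ : ℝ} {s : ℝ≥0} (hc : 0 < c) (hr₀ : 0 < r₀)
    (h : ∀ x ∈ A, ∀ r : ℝ, 0 < r → r ≤ r₀ → c * r ^ (s : ℝ) ≤ μ.real (Metric.closedBall x r)) :
    dimH A ≤ s := by
  apply dimH_le_of_hausdorffMeasure_ne_top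
  have hρ : ∀ m : ℕ, 0 < r₀ / (m + 1) := fun m => by positivity
  choose t htA hsep hcov using fun m : ℕ => exists_finset_net hA (hρ m)
  have hdiam : ∀ (m : ℕ) (i : t m), Metric.ediam (Metric.closedBall (i : X) (r₀ / (m + 1))) ≤
      ENNReal.ofReal (2 * (r₀ / (m + 1))) := by
    intro m i
    rw [← Metric.closedEBall_ofReal (hρ m).le, ENNReal.ofReal_mul (by norm_num)]
    simpa using Metric.ediam_closedEBall_le (x := (i : X)) (r := ENNReal.ofReal (r₀ / (m + 1)))
  have hcard : ∀ m : ℕ, (t m).card * (c * (r₀ / (m + 1) / 3) ^ (s : ℝ)) ≤ μ.real Set.univ := by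
    intro m
    refine card_mul_le_measureReal μ (t m) id (ρ := r₀ / (m + 1) / 3) ?_ (by simp) ?_
    · intro x hx y hy hxy
      have := hsep m x hx y hy hxy
      have := hρ m
      simp only [id]; linarith
    · intro x hx
      refine h x (htA m hx) _ (by have := hρ m; positivity) ?_
      have h1 : r₀ / (m + 1) ≤ r₀ := div_le_self hr₀.le (by norm_num)
      have := hρ m
      linarith
  have key : μH[(s : ℝ)] A ≤ ENNReal.ofReal (μ.real Set.univ / c * 6 ^ (s : ℝ)) := by
    refine (Measure.hausdorffMeasure_le_liminf_sum (s : ℝ) A (l := atTop)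
      (fun m : ℕ => ENNReal.ofReal (2 * (r₀ / (m + 1))))
      ?_ (fun m (i : t m) => Metric.closedBall (i : X) (r₀ / (m + 1)))
      (Eventually.of_forall hdiam) (Eventually.of_forall fun m x hx => ?_)).trans ?_
    · rw [← ENNReal.ofReal_zero]
      refine ENNReal.tendsto_ofReal ?_
      have h1 := (tendsto_one_div_add_atTop_nhds_zero_nat (𝕜 := ℝ)).const_mul (2 * r₀)
      simp only [mul_zero] at h1
      refine h1.congr fun m => ?_
      ring
    · obtain ⟨y, hy, hxy⟩ := hcov m x hx
      exact Set.mem_iUnion.2 ⟨⟨y, hy⟩, hxy⟩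
    · refine liminf_le_of_le (by isBoundedDefault) fun b hb => ?_
      obtain ⟨m, hm⟩ := hb.exists
      refine hm.trans ?_
      calc ∑ i : t m, Metric.ediam (Metric.closedBall (i : X) (r₀ / (m + 1))) ^ (s : ℝ)
          ≤ ∑ _i : t m, ENNReal.ofReal ((2 * (r₀ / (m + 1))) ^ (s : ℝ)) := by
            refine Finset.sum_le_sum fun i _ => ?_
            rw [← ENNReal.ofReal_rpow_of_nonneg (by have := hρ m; positivity) (NNReal.coe_nonneg s)]
            exact ENNReal.rpow_le_rpow (hdiam m i) s.2
        _ = ENNReal.ofReal ((t m).card * (2 * (r₀ / (m + 1))) ^ (s : ℝ)) := by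
            rw [ENNReal.ofReal_mul (by positivity)]
            simp
        _ ≤ _ := by
            refine ENNReal.ofReal_le_ofReal ?_
            have h2 : (2 * (r₀ / ((m : ℝ) + 1))) ^ (s : ℝ) =
                6 ^ (s : ℝ) * (r₀ / (m + 1) / 3) ^ (s : ℝ) := by
              rw [← Real.mul_rpow (by norm_num) (by have := hρ m; positivity)]
              congr 1; ring
            rw [h2, div_mul_eq_mul_div, le_div_iff₀ hc]
            have := mul_le_mul_of_nonneg_right (hcard m) (by positivity : (0:ℝ) ≤ 6 ^ (s : ℝ))
            linarith
  exact ne_top_of_le_ne_top ENNReal.ofReal_ne_top key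

open scoped NNReal in
lemma le_dimH_of_measureReal_closedBall_le {B : Set ℝ} (μ : Measure ℝ) [IsFiniteMeasure μ]
    (hB : 0 < μ B) (hBc : μ Bᶜ = 0)
    {C r₀ : ℝ} {s : ℝ≥0} (hC : 0 < C) (hr₀ : 0 < r₀)
    (h : ∀ x ∈ B, ∀ r : ℝ, 0 < r → r ≤ r₀ → μ.real (Metric.closedBall x r) ≤ C * r ^ (s : ℝ)) :
    (s : ℝ≥0∞) ≤ dimH B := by
  rcases eq_or_ne s 0 with rfl | hs
  · simp
  have hs' : (0 : ℝ) < s := by positivity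
  apply le_dimH_of_hausdorffMeasure_ne_zero
  set K := ENNReal.ofReal C with hK
  have hK0 : K ≠ 0 := by simpa [hK] using hC
  have hKt : K ≠ ⊤ := ENNReal.ofReal_ne_top
  have hball : ∀ x ∈ B, ∀ r : ℝ, 0 < r → r ≤ r₀ →
      μ (Metric.closedBall x r) ≤ K * ENNReal.ofReal r ^ (s : ℝ) := by
    intro x hx r hr hr'
    rw [ENNReal.ofReal_rpow_of_pos hr, hK, ← ENNReal.ofReal_mul hC.le,
      ENNReal.le_ofReal_iff_toReal_le (measure_ne_top _ _) (by positivity)]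
    exact h x hx r hr hr'
  have hle : K⁻¹ • μ ≤ μH[(s : ℝ)] := by
    refine Measure.le_hausdorffMeasure (s : ℝ) _ (ENNReal.ofReal (r₀ / 2)) (by simpa using hr₀)
      fun S hS => ?_
    rw [Measure.smul_apply, smul_eq_mul, mul_comm, ← div_eq_mul_inv]
    refine ENNReal.div_le_of_le_mul' ?_
    by_cases hSB : (S ∩ B).Nonempty
    · obtain ⟨x, hxS, hxB⟩ := hSB
      have hSt : Metric.ediam S ≠ ⊤ := ne_top_of_le_ne_top ENNReal.ofReal_ne_top hS
      obtain ⟨d, hd⟩ : ∃ d, d = Metric.diam S := ⟨_, rfl⟩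
      have hd0 : 0 ≤ d := hd ▸ Metric.diam_nonneg
      have hdE : Metric.ediam S = ENNReal.ofReal d := by
        rw [hd, Metric.diam, ENNReal.ofReal_toReal hSt]
      have hdr : d ≤ r₀ / 2 := by
        rw [hdE, ENNReal.ofReal_le_ofReal_iff (by positivity)] at hS
        exact hS
      have hr : ∀ r : ℝ, d < r → r ≤ r₀ → μ S ≤ K * ENNReal.ofReal r ^ (s : ℝ) := by
        intro r hr hr'
        refine (measure_mono fun y hy => ?_).trans (hball x hxB r (by linarith) hr')
        rw [Metric.mem_closedBall, dist_comm]
        refine (Metric.dist_le_diam_of_mem (Metric.isBounded_iff_ediam_ne_top.2 hSt) hxS hy).trans ?_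
        rw [← hd]; exact hr.le
      have hlim : Tendsto (fun r : ℝ => K * ENNReal.ofReal r ^ (s : ℝ)) (nhdsWithin d (Set.Ioi d))
          (nhds (K * ENNReal.ofReal d ^ (s : ℝ))) := by
        refine Tendsto.mono_left ?_ nhdsWithin_le_nhds
        refine ENNReal.Tendsto.const_mul ?_ (Or.inr hKt)
        exact (ENNReal.continuous_rpow_const.comp ENNReal.continuous_ofReal).tendsto d
      rw [hdE]
      refine ge_of_tendsto hlim ?_
      filter_upwards [Ioc_mem_nhdsGT (show d < r₀ by linarith)] with r hr1
      exact hr r hr1.1 hr1.2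
    · have h0 : μ S = 0 := measure_mono_null
        (fun y hy hyB => hSB ⟨y, hy, hyB⟩) hBc
      simp [h0]
  intro h0
  have h1 := hle B
  rw [h0, Measure.smul_apply, smul_eq_mul] at h1
  simp only [nonpos_iff_eq_zero, mul_eq_zero, ENNReal.inv_eq_zero] at h1
  exact h1.elim hKt hB.ne'

lemma packPre_eq_zero_of_le_measureReal_closedBall {X : Type*} [MetricSpace X]
    [MeasurableSpace X] [BorelSpace X] {B : Set X} (μ : Measure X) [IsFiniteMeasure μ]
    {c s D : ℝ} (hc : 0 < c) (hs : D < s)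
    (h : ∀ x ∈ B, ∀ r : ℝ, 0 < r → r ≤ 1 → c * r ^ D ≤ μ.real (Metric.closedBall x r)) :
    packPre B s = 0 := by
  have hle : ∀ δ : ℝ, 0 < δ → δ ≤ 1 →
      packPre B s ≤ ENNReal.ofReal (δ ^ (s - D) * (μ.real Set.univ / c)) := by
    intro δ hδ hδ1
    refine iInf₂_le_of_le δ hδ ?_
    refine iSup_le fun m => iSup_le fun x => iSup_le fun ρ => iSup_le fun hx => iSup_le fun hρ =>
      iSup_le fun hdisj => ?_
    rw [← ENNReal.ofReal_sum_of_nonneg fun i _ => (Real.rpow_pos_of_pos (hρ i).1 s).le]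
    refine ENNReal.ofReal_le_ofReal ?_
    have hterm : ∀ i, ρ i ^ s ≤ δ ^ (s - D) * (μ.real (Metric.closedBall (x i) (ρ i)) / c) := by
      intro i
      obtain ⟨h0, h1⟩ := hρ i
      have e : ρ i ^ s = ρ i ^ (s - D) * ρ i ^ D := by
        rw [← Real.rpow_add h0]; congr 1; ring
      rw [e]
      have hpow : ρ i ^ (s - D) ≤ δ ^ (s - D) :=
        Real.rpow_le_rpow h0.le h1 (by linarith)
      have hD : ρ i ^ D ≤ μ.real (Metric.closedBall (x i) (ρ i)) / c := by
        rw [le_div_iff₀ hc, mul_comm]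
        exact h (x i) (hx i) _ h0 (h1.trans hδ1)
      gcongr
    calc ∑ i, ρ i ^ s ≤ ∑ i, δ ^ (s - D) * (μ.real (Metric.closedBall (x i) (ρ i)) / c) :=
          Finset.sum_le_sum fun i _ => hterm i
      _ = δ ^ (s - D) * (μ.real (⋃ i ∈ Finset.univ, Metric.closedBall (x i) (ρ i)) / c) := by
          rw [measureReal_biUnion_finset (fun i _ j _ hij => hdisj i j hij)
            fun i _ => Metric.isClosed_closedBall.measurableSet, ← Finset.mul_sum, Finset.sum_div]
      _ ≤ δ ^ (s - D) * (μ.real Set.univ / c) := by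
          have := measureReal_mono (μ := μ)
            (Set.subset_univ (⋃ i ∈ Finset.univ, Metric.closedBall (x i) (ρ i)))
          gcongr
  have hlim : Tendsto (fun δ : ℝ => ENNReal.ofReal (δ ^ (s - D) * (μ.real Set.univ / c)))
      (nhdsWithin 0 (Set.Ioi 0)) (nhds 0) := by
    refine Tendsto.mono_left ?_ nhdsWithin_le_nhds
    rw [← ENNReal.ofReal_zero]
    refine ENNReal.tendsto_ofReal ?_
    have h1 := ((Real.continuousAt_rpow_const 0 (s - D) (Or.inr (by linarith))).tendsto).mul_const
      (μ.real Set.univ / c)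
    rwa [Real.zero_rpow (by linarith), zero_mul] at h1
  refine le_antisymm (ge_of_tendsto hlim ?_) zero_le
  filter_upwards [Ioc_mem_nhdsGT (zero_lt_one' ℝ)] with δ hδ
  exact hle δ hδ.1 hδ.2

lemma packMeasure_ne_zero_of_measureReal_closedBall_le {X : Type*} [MetricSpace X]
    [MeasurableSpace X] [BorelSpace X] {B : Set X} (hB : TotallyBounded B) (μ : Measure X)
    [IsFiniteMeasure μ] (hB0 : 0 < μ B) (hBc : μ Bᶜ = 0) {C s : ℝ} (hC : 0 < C)
    (h : ∀ x ∈ B, ∀ r : ℝ, 0 < r → r ≤ 1 → μ.real (Metric.closedBall x r) ≤ C * r ^ s) :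
    packMeasure B s ≠ 0 := by
  set K := ENNReal.ofReal (C * 2 ^ s) with hK
  have hK0 : K ≠ 0 := by
    rw [hK, Ne, ENNReal.ofReal_eq_zero, not_le]; positivity
  have hKt : K ≠ ⊤ := ENNReal.ofReal_ne_top
  have hF : ∀ F : Set X, μ F / K ≤ packPre F s := by
    intro F
    refine le_iInf₂ fun δ hδ => ?_
    obtain ⟨ρ, hρ⟩ : ∃ ρ, ρ = min δ (1 / 2) := ⟨_, rfl⟩
    have hρ0 : 0 < ρ := by rw [hρ]; positivity
    have hρδ : ρ ≤ δ := hρ ▸ min_le_left _ _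
    have hρ2 : ρ ≤ 1 / 2 := hρ ▸ min_le_right _ _
    obtain ⟨t, htF, hsep, hcov⟩ := exists_finset_net
      (hB.subset (Set.inter_subset_right : F ∩ B ⊆ B)) (show 0 < 2 * ρ by positivity)
    have hμF : μ F ≤ K * ∑ i : Fin t.card, ENNReal.ofReal (ρ ^ s) := by
      have h1 : μ.real (F ∩ B) ≤ t.card * (C * (2 * ρ) ^ s) :=
        measureReal_le_card_mul μ t hcov fun y hy =>
          h y (htF hy).2 _ (by positivity) (by linarith)
      calc μ F = μ (F ∩ B) := by
            rw [measure_inter_conull hBc]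
        _ = ENNReal.ofReal (μ.real (F ∩ B)) := by simp
        _ ≤ ENNReal.ofReal (t.card * (C * (2 * ρ) ^ s)) := ENNReal.ofReal_le_ofReal h1
        _ = ENNReal.ofReal ((C * 2 ^ s) * (t.card * ρ ^ s)) := by
            rw [Real.mul_rpow (by norm_num) hρ0.le]; congr 1; ring
        _ = _ := by
            rw [ENNReal.ofReal_mul (by positivity), ENNReal.ofReal_mul (by positivity)]
            rw [hK, ENNReal.ofReal_mul hC.le]
            simp
    refine (ENNReal.div_le_of_le_mul' hμF).trans ?_
    refine le_iSup_of_le t.card (le_iSup_of_le (fun i => (t.equivFin.symm i : X))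
      (le_iSup_of_le (fun _ => ρ) (le_iSup_of_le (fun i => (htF (t.equivFin.symm i).2).1)
      (le_iSup_of_le (fun _ => ⟨hρ0, hρδ⟩) (le_iSup_of_le (fun i j hij => ?_) le_rfl)))))
    refine Metric.closedBall_disjoint_closedBall ?_
    have := hsep _ (t.equivFin.symm i).2 _ (t.equivFin.symm j).2
      (fun hEq => hij (t.equivFin.symm.injective (Subtype.ext hEq)))
    linarith
  have hle : μ B / K ≤ packMeasure B s := by
    refine le_iInf₂ fun F hBF => ?_
    calc μ B / K ≤ (∑' m, μ (F m)) / K := by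
          gcongr
          exact (measure_mono hBF).trans (measure_iUnion_le F)
      _ = ∑' m, μ (F m) / K := by simp only [div_eq_mul_inv, ENNReal.tsum_mul_right]
      _ ≤ ∑' m, packPre (F m) s := ENNReal.tsum_le_tsum fun m => hF (F m)
  exact pos_iff_ne_zero.1 ((ENNReal.div_pos hB0.ne' hKt).trans_le hle)

/-! ### Sets whose balls have the measure of `6`-adic cylinders -/

/-- `μ` is a probability measure on the compact set `B ⊆ [0,1]` giving balls of radius about
`6⁻ᵏ` centred in `B` a mass comparable to `(n₁⋯n_k)⁻¹`. -/
structure HasCylinderBounds (B : Set ℝ) (μ : Measure ℝ) (n : ℕ → ℕ) : Prop where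
  compact : IsCompact B
  subset_Icc : B ⊆ Set.Icc (0 : ℝ) 1
  prob : IsProbabilityMeasure μ
  compl_null : μ Bᶜ = 0
  upper : ∀ x ∈ B, ∀ (k : ℕ) (r : ℝ), r ≤ (1 / 6) ^ (k + 1) →
    μ.real (Metric.closedBall x r) * prodN n k ≤ 1
  lower : ∀ x ∈ B, ∀ (k : ℕ) (r : ℝ), (1 / 6) ^ k ≤ r →
    1 ≤ μ.real (Metric.closedBall x r) * prodN n k

lemma prodN_succ (n : ℕ → ℕ) (k : ℕ) : prodN n (k + 1) = prodN n k * n k :=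
  Finset.prod_range_succ _ _

lemma prodN_pos {n : ℕ → ℕ} (hn : ∀ k, 3 ≤ n k) (k : ℕ) : 0 < prodN n k :=
  Finset.prod_pos fun i _ => by have := hn i; omega

lemma three_mul_prodN_le {n : ℕ → ℕ} (hn : ∀ k, 3 ≤ n k) (k : ℕ) :
    3 * (prodN n k : ℝ) ≤ prodN n (k + 1) := by
  rw [prodN_succ, mul_comm]; push_cast
  gcongr
  exact_mod_cast hn k

lemma prodN_succ_le {n : ℕ → ℕ} (hn : ∀ k, n k ≤ 5) (k : ℕ) :
    (prodN n (k + 1) : ℝ) ≤ 5 * prodN n k := by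
  rw [prodN_succ, mul_comm 5]; push_cast
  gcongr
  exact_mod_cast hn k

lemma prodN_le_five_pow {n : ℕ → ℕ} (hn : ∀ k, n k ≤ 5) (k : ℕ) :
    (prodN n k : ℝ) ≤ 5 ^ k := by
  induction k with
  | zero => simp [prodN]
  | succ k ih => rw [pow_succ']; linarith [prodN_succ_le hn k]

lemma prodN_add_of_eq_three {n : ℕ → ℕ} {k m : ℕ} (h : ∀ j < m, n (k + j) = 3) :
    prodN n (k + m) = 3 ^ m * prodN n k := by
  rw [prodN, Finset.prod_range_add, ← prodN, mul_comm,
    Finset.prod_congr rfl fun j hj => h j (Finset.mem_range.1 hj)]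
  simp

namespace HasCylinderBounds

variable {B : Set ℝ} {μ : Measure ℝ} {n : ℕ → ℕ}

lemma measure_eq_one (h : HasCylinderBounds B μ n) : μ B = 1 := by
  have := h.prob
  exact (prob_compl_eq_zero_iff h.compact.measurableSet).1 h.compl_null

lemma nonempty (h : HasCylinderBounds B μ n) : B.Nonempty := by
  rw [Set.nonempty_iff_ne_empty]
  intro hB
  have := h.measure_eq_one
  simp [hB] at this

lemma le_five (h : HasCylinderBounds B μ n) (hn5 : ∀ k, n k ≤ 5) {x : ℝ} (hx : x ∈ B) {k : ℕ}
    {r : ℝ} (hr : r ≤ (1 / 6) ^ k) : μ.real (Metric.closedBall x r) * prodN n k ≤ 5 := by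
  have := h.prob
  cases k with
  | zero =>
    have h1 : μ.real (Metric.closedBall x r) ≤ 1 := measureReal_le_one
    simp only [prodN, Finset.range_zero, Finset.prod_empty, Nat.cast_one]
    linarith
  | succ k =>
    have h1 := h.upper x hx k r hr
    have h2 := mul_le_mul_of_nonneg_left (prodN_succ_le hn5 k)
      (measureReal_nonneg (μ := μ) (s := Metric.closedBall x r))
    linarith

lemma one_le_five_mul (h : HasCylinderBounds B μ n) (hn5 : ∀ k, n k ≤ 5) {x : ℝ} (hx : x ∈ B)
    {k : ℕ} {r : ℝ} (hr : (1 / 6) ^ (k + 1) ≤ r) :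
    1 ≤ 5 * (μ.real (Metric.closedBall x r) * prodN n k) := by
  have h1 := h.lower x hx (k + 1) r hr
  have h2 := mul_le_mul_of_nonneg_left (prodN_succ_le hn5 k)
    (measureReal_nonneg (μ := μ) (s := Metric.closedBall x r))
  linarith

lemma exists_scale {r : ℝ} (hr : 0 < r) (hr1 : r ≤ 1) :
    ∃ k : ℕ, (1 / 6 : ℝ) ^ (k + 1) < r ∧ r ≤ (1 / 6) ^ k :=
  exists_nat_pow_near_of_lt_one hr hr1 (by norm_num) (by norm_num)

lemma diam_le_one (h : HasCylinderBounds B μ n) : Metric.diam B ≤ 1 := by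
  simpa [Real.diam_Icc zero_le_one] using Metric.diam_mono h.subset_Icc (Metric.isBounded_Icc 0 1)

lemma diam_pos (h : HasCylinderBounds B μ n) (hn3 : ∀ k, 3 ≤ n k) : 0 < Metric.diam B := by
  have := h.prob
  refine Metric.diam_pos ?_ h.compact.isBounded
  rw [← Set.not_subsingleton_iff]
  intro hsub
  obtain ⟨x, hx⟩ := h.nonempty
  have hBx : B ⊆ Metric.closedBall x ((1 / 6) ^ 2) := fun y hy => by
    rw [hsub hy hx]; exact Metric.mem_closedBall_self (by positivity)
  have h1 : 1 ≤ μ.real (Metric.closedBall x ((1 / 6) ^ 2)) := by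
    have h2 := measureReal_mono (μ := μ) hBx
    rwa [measureReal_def, h.measure_eq_one, ENNReal.toReal_one] at h2
  have h3 := h.upper x hx 1 _ le_rfl
  have h4 := three_mul_prodN_le hn3 0
  simp only [prodN, Finset.range_zero, Finset.prod_empty, Nat.cast_one, zero_add] at h3 h4
  nlinarith

lemma isHomog (h : HasCylinderBounds B μ n) (hn3 : ∀ k, 3 ≤ n k) (hn5 : ∀ k, n k ≤ 5) :
    IsHomog B μ 25 ((1 / 6) ^ 3) (9 / 5) 3125 := by
  have hP : ∀ k, (0 : ℝ) < prodN n k := fun k => by exact_mod_cast prodN_pos hn3 k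
  have hdiam := h.diam_le_one
  have := h.prob
  refine ⟨h.compact, h.diam_pos hn3, h.prob, h.compl_null, ?_, by norm_num, ?_, by positivity,
    by norm_num, by norm_num, by norm_num, ?_, ?_⟩
  · intro x hx r hr
    obtain ⟨k, hk⟩ := exists_pow_lt_of_lt_one hr (show (1 / 6 : ℝ) < 1 by norm_num)
    have h1 := h.lower x hx k r hk.le
    have h2 : 0 < μ.real (Metric.closedBall x r) := by
      by_contra! h3
      nlinarith [hP k]
    exact (ENNReal.toReal_pos_iff.1 h2).1
  · intro x hx y hy r hr hr1
    obtain ⟨k, hk, hk'⟩ := exists_scale hr (hr1.trans hdiam)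
    have h1 := h.le_five hn5 hx hk'
    have h2 := h.one_le_five_mul hn5 hy hk.le
    refine le_of_mul_le_mul_right ?_ (hP k)
    simp only [measureReal_def] at h1 h2
    linarith
  · intro x hx r hr hr1
    obtain ⟨k, hk, hk'⟩ := exists_scale hr (hr1.trans hdiam)
    have h1 := h.upper x hx (k + 2) ((1 / 6) ^ 3 * r) (by
      calc (1 / 6 : ℝ) ^ 3 * r ≤ (1 / 6) ^ 3 * (1 / 6) ^ k := by gcongr
        _ = (1 / 6) ^ (k + 2 + 1) := by ring)
    have h2 := h.one_le_five_mul hn5 hx hk.le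
    have h3 := three_mul_prodN_le hn3 k
    have h4 := three_mul_prodN_le hn3 (k + 1)
    have h5 := mul_le_mul_of_nonneg_left (show 9 * (prodN n k : ℝ) ≤ prodN n (k + 2) by linarith)
      (measureReal_nonneg (μ := μ) (s := Metric.closedBall x ((1 / 6) ^ 3 * r)))
    refine le_of_mul_le_mul_right ?_ (hP k)
    simp only [measureReal_def] at h1 h2 h5
    linarith
  · intro x hx r hr hr1
    obtain ⟨k, hk, hk'⟩ := exists_scale hr (hr1.trans hdiam)
    have h1 := h.le_five hn5 hx hk'
    have h2 := h.lower x hx (k + 4) ((1 / 6) ^ 3 * r) (by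
      calc (1 / 6 : ℝ) ^ (k + 4) = (1 / 6) ^ 3 * (1 / 6) ^ (k + 1) := by ring
        _ ≤ (1 / 6) ^ 3 * r := by gcongr)
    have h3 := mul_le_mul_of_nonneg_left
      (show (prodN n (k + 4) : ℝ) ≤ 625 * prodN n k by
        linarith [prodN_succ_le hn5 k, prodN_succ_le hn5 (k + 1), prodN_succ_le hn5 (k + 2),
          prodN_succ_le hn5 (k + 3)])
      (measureReal_nonneg (μ := μ) (s := Metric.closedBall x ((1 / 6) ^ 3 * r)))
    refine le_of_mul_le_mul_right ?_ (hP k)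
    simp only [measureReal_def] at h1 h2 h3
    linarith

lemma rpow_le_measureReal (h : HasCylinderBounds B μ n) (hn3 : ∀ k, 3 ≤ n k)
    (hn5 : ∀ k, n k ≤ 5) {D : ℝ} (hD0 : 0 ≤ D) (hD : (6 : ℝ) ^ D = 5) {x : ℝ} (hx : x ∈ B)
    {r : ℝ} (hr : 0 < r) (hr1 : r ≤ 1) :
    1 / 5 * r ^ D ≤ μ.real (Metric.closedBall x r) := by
  have hP : ∀ k, (0 : ℝ) < prodN n k := fun k => by exact_mod_cast prodN_pos hn3 k
  obtain ⟨k, hk, hk'⟩ := exists_scale hr hr1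
  have h1 := h.one_le_five_mul hn5 hx hk.le
  have h2 : r ^ D ≤ ((1 / 6 : ℝ) ^ k) ^ D := Real.rpow_le_rpow hr.le hk' hD0
  have h3 : ((1 / 6 : ℝ) ^ k) ^ D * 5 ^ k = 1 := by
    rw [← Real.rpow_pow_comm (by norm_num), ← mul_pow, one_div, Real.inv_rpow (by norm_num), hD]
    norm_num
  have h4 : r ^ D * prodN n k ≤ 1 := by
    rw [← h3]
    exact mul_le_mul h2 (prodN_le_five_pow hn5 k) (hP k).le (by positivity)
  refine le_of_mul_le_mul_right ?_ (hP k)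
  linarith

lemma measureReal_le_rpow (h : HasCylinderBounds B μ n) (hn3 : ∀ k, 3 ≤ n k)
    (hn5 : ∀ k, n k ≤ 5) {c s : ℝ} (hs : 0 ≤ s) (hc : 0 < c)
    (hcs : ∀ k, c ≤ prodN n k * ((1 / 6 : ℝ) ^ k) ^ s) {x : ℝ} (hx : x ∈ B)
    {r : ℝ} (hr : 0 < r) (hr1 : r ≤ 1) :
    μ.real (Metric.closedBall x r) ≤ 5 * 6 ^ s / c * r ^ s := by
  have hP : ∀ k, (0 : ℝ) < prodN n k := fun k => by exact_mod_cast prodN_pos hn3 k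
  obtain ⟨k, hk, hk'⟩ := exists_scale hr hr1
  have h1 := h.le_five hn5 hx hk'
  have h2 : ((1 / 6 : ℝ) ^ k) ^ s ≤ 6 ^ s * r ^ s := by
    rw [← Real.mul_rpow (by norm_num) hr.le]
    refine Real.rpow_le_rpow (by positivity) ?_ hs
    rw [pow_succ] at hk
    linarith
  have h3 : c ≤ prodN n k * (6 ^ s * r ^ s) :=
    (hcs k).trans (mul_le_mul_of_nonneg_left h2 (hP k).le)
  rw [div_mul_eq_mul_div, le_div_iff₀ hc]
  calc μ.real (Metric.closedBall x r) * c
      ≤ μ.real (Metric.closedBall x r) * (prodN n k * (6 ^ s * r ^ s)) :=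
        mul_le_mul_of_nonneg_left h3 measureReal_nonneg
    _ = (μ.real (Metric.closedBall x r) * prodN n k) * (6 ^ s * r ^ s) := by ring
    _ ≤ 5 * (6 ^ s * r ^ s) := mul_le_mul_of_nonneg_right h1 (by positivity)
    _ = _ := by ring

lemma dimH_eq (h : HasCylinderBounds B μ n) (hn3 : ∀ k, 3 ≤ n k) (hn5 : ∀ k, n k ≤ 5)
    {D : ℝ} (hD0 : 0 < D) (hD : (6 : ℝ) ^ D = 5)
    (hlow : ∀ s < D, ∃ c : ℝ, 0 < c ∧ ∀ k, c ≤ prodN n k * ((1 / 6 : ℝ) ^ k) ^ s) :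
    dimH B = ENNReal.ofReal D := by
  have := h.prob
  apply le_antisymm
  · exact dimH_le_of_le_measureReal_closedBall (s := D.toNNReal) h.compact.totallyBounded μ
      (c := 1 / 5) (r₀ := 1) (by norm_num) one_pos fun x hx r hr hr1 => by
        rw [Real.coe_toNNReal D hD0.le]
        exact h.rpow_le_measureReal hn3 hn5 hD0.le hD hx hr hr1
  · refine le_of_forall_lt fun a ha => ?_
    obtain ⟨s, has, hs⟩ := ENNReal.lt_iff_exists_nnreal_btwn.1 ha
    refine has.trans_le ?_
    have hsD : (s : ℝ) < D := by
      rw [ENNReal.ofReal, ENNReal.coe_lt_coe, Real.lt_toNNReal_iff_coe_lt] at hs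
      exact hs
    obtain ⟨c, hc, hcs⟩ := hlow s hsD
    refine le_dimH_of_measureReal_closedBall_le μ (by simp [h.measure_eq_one]) h.compl_null
      (C := 5 * 6 ^ (s : ℝ) / c) (r₀ := 1) (by positivity) one_pos fun x hx r hr hr1 =>
      h.measureReal_le_rpow hn3 hn5 s.2 hc hcs hx hr hr1

lemma packDim_eq (h : HasCylinderBounds B μ n) (hn3 : ∀ k, 3 ≤ n k) (hn5 : ∀ k, n k ≤ 5)
    {D : ℝ} (hD0 : 0 < D) (hD : (6 : ℝ) ^ D = 5)
    (hlow : ∀ s < D, ∃ c : ℝ, 0 < c ∧ ∀ k, c ≤ prodN n k * ((1 / 6 : ℝ) ^ k) ^ s) :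
    packDim B = D := by
  have := h.prob
  have hmem : ∀ s, D < s → 0 ≤ s ∧ packMeasure B s = 0 := by
    intro s hs
    refine ⟨(hD0.trans hs).le, le_antisymm ?_ zero_le⟩
    refine iInf₂_le_of_le (fun _ => B) (Set.subset_iUnion (fun _ : ℕ => B) 0) ?_
    have h0 := packPre_eq_zero_of_le_measureReal_closedBall μ (c := 1 / 5) (by norm_num) hs
      fun x hx r hr hr1 => h.rpow_le_measureReal hn3 hn5 hD0.le hD hx hr hr1
    simp [h0]
  apply le_antisymm
  · refine le_of_forall_gt_imp_ge_of_dense fun s hs => ?_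
    exact csInf_le ⟨0, fun y hy => hy.1⟩ (hmem s hs)
  · refine le_csInf ⟨D + 1, hmem _ (by linarith)⟩ fun s hs => ?_
    by_contra! hsD
    obtain ⟨c, hc, hcs⟩ := hlow s hsD
    exact packMeasure_ne_zero_of_measureReal_closedBall_le h.compact.totallyBounded μ
      (by simp [h.measure_eq_one]) h.compl_null (C := 5 * 6 ^ s / c) (by positivity)
      (fun x hx r hr hr1 => h.measureReal_le_rpow hn3 hn5 hs.1 hc hcs hx hr hr1) hs.2

end HasCylinderBounds

/-! ### Ahlfors–David regular sets -/

lemma IsADRegular.exists_measureReal_bounds {Y : Type*} [MetricSpace Y] [MeasurableSpace Y]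
    {A : Set Y} {s : ℝ} (h : IsADRegular A s) :
    ∃ (ν : Measure Y) (c : ℝ), IsFiniteMeasure ν ∧ 1 ≤ c ∧ ν Aᶜ = 0 ∧
      ∀ x ∈ A, ∀ r : ℝ, 0 < r → r ≤ Metric.diam A →
        c⁻¹ * r ^ s ≤ ν.real (Metric.closedBall x r) ∧
          ν.real (Metric.closedBall x r) ≤ c * r ^ s := by
  obtain ⟨hA, hd, ν, c, hc, hν, hb⟩ := h
  have hfin : IsFiniteMeasure ν := by
    obtain ⟨x, hx⟩ : A.Nonempty := by
      rw [Set.nonempty_iff_ne_empty]; rintro rfl; simp at hd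
    refine ⟨?_⟩
    have hcov : (Set.univ : Set Y) ⊆ Metric.closedBall x (Metric.diam A) ∪ Aᶜ := by
      intro y _
      by_cases hy : y ∈ A
      · exact Or.inl (Metric.dist_le_diam_of_mem hA.isBounded hy hx)
      · exact Or.inr hy
    calc ν Set.univ ≤ ν (Metric.closedBall x (Metric.diam A)) + ν Aᶜ :=
          (measure_mono hcov).trans (measure_union_le _ _)
      _ < ⊤ := by
          rw [hν, add_zero]
          exact (hb x hx _ hd le_rfl).2.trans_lt ENNReal.ofReal_lt_top
  refine ⟨ν, c, hfin, hc, hν, fun x hx r hr hr1 => ⟨?_, ?_⟩⟩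
  · exact (ENNReal.ofReal_le_iff_le_toReal (measure_ne_top _ _)).1 (hb x hx r hr hr1).1
  · exact (ENNReal.le_ofReal_iff_toReal_le (measure_ne_top _ _) (by positivity)).1
      (hb x hx r hr hr1).2

lemma IsADRegular.dimH_toReal_le {Y : Type*} [MetricSpace Y] [MeasurableSpace Y] [BorelSpace Y]
    {A : Set Y} {s : ℝ} (hs : 0 < s) (h : IsADRegular A s) : (dimH A).toReal ≤ s := by
  obtain ⟨ν, c, hfin, hc, -, hb⟩ := h.exists_measureReal_bounds
  have h1 : dimH A ≤ (s.toNNReal : ℝ≥0∞) :=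
    dimH_le_of_le_measureReal_closedBall h.1.totallyBounded ν (c := c⁻¹) (by positivity) h.2.1
      fun x hx r hr hr1 => by
        rw [Real.coe_toNNReal s hs.le]
        exact (hb x hx r hr hr1).1
  exact ENNReal.toReal_le_of_le_ofReal hs.le h1

lemma HasCylinderBounds.not_bilipEmbed {B : Set ℝ} {μ : Measure ℝ} {n : ℕ → ℕ}
    (h : HasCylinderBounds B μ n) (hn3 : ∀ k, 3 ≤ n k)
    (hblock : ∀ m : ℕ, ∃ k, m ≤ k ∧ ∀ j < m, n (k + j) = 3)
    {Y : Type*} [MetricSpace Y] [MeasurableSpace Y] {A : Set Y} {s : ℝ}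
    (hs : Real.log 3 / Real.log 6 < s) (hA : IsADRegular A s) :
    ¬ BilipEmbed A B := by
  rintro ⟨f, L, hL, hmaps, -, hf⟩
  have := h.prob
  obtain ⟨ν, c, hfin, hc, hν, hb⟩ := hA.exists_measureReal_bounds
  obtain ⟨hAc, hd, -⟩ := hA
  obtain ⟨x, hx⟩ : A.Nonempty := by
    rw [Set.nonempty_iff_ne_empty]; rintro rfl; simp at hd
  have hL0 : 0 < L := by linarith
  have hc0 : 0 < c := by linarith
  have hP : ∀ k, (0 : ℝ) < prodN n k := fun k => by exact_mod_cast prodN_pos hn3 k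
  obtain ⟨q, hq⟩ : ∃ q : ℝ, q = 3 * (1 / 6) ^ s := ⟨_, rfl⟩
  have hq0 : 0 ≤ q := by rw [hq]; positivity
  have hq1 : q < 1 := by
    have h3 : (3 : ℝ) < 6 ^ s := by
      rw [div_lt_iff₀ (Real.log_pos (by norm_num))] at hs
      rw [← Real.log_lt_log_iff (by norm_num) (by positivity), Real.log_rpow (by norm_num)]
      exact hs
    rw [hq, one_div, Real.inv_rpow (by norm_num), ← div_eq_mul_inv, div_lt_one (by positivity)]
    exact h3
  obtain ⟨m, hm2, hmd, hmq⟩ : ∃ m : ℕ, 2 ≤ m ∧ 2 * L * (1 / 6 : ℝ) ^ m < Metric.diam A ∧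
      c ^ 2 * (72 * L ^ 2) ^ s * q ^ m < 1 := by
    have l1 : Tendsto (fun m : ℕ => 2 * L * (1 / 6 : ℝ) ^ m) atTop (nhds 0) := by
      simpa using (tendsto_pow_atTop_nhds_zero_of_lt_one (show (0 : ℝ) ≤ 1 / 6 by norm_num)
        (by norm_num)).const_mul (2 * L)
    have l2 : Tendsto (fun m : ℕ => c ^ 2 * (72 * L ^ 2) ^ s * q ^ m) atTop (nhds 0) := by
      simpa using (tendsto_pow_atTop_nhds_zero_of_lt_one hq0 hq1).const_mul
        (c ^ 2 * (72 * L ^ 2) ^ s)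
    exact ((eventually_ge_atTop 2).and
      ((l1.eventually_lt_const hd).and (l2.eventually_lt_const one_pos))).exists
  obtain ⟨k, hmk, hk⟩ := hblock m
  obtain ⟨a, ha⟩ : ∃ a : ℝ, a = (1 / 6) ^ k := ⟨_, rfl⟩
  obtain ⟨b, hbdef⟩ : ∃ b : ℝ, b = (1 / 6) ^ m := ⟨_, rfl⟩
  have ha0 : 0 < a := by rw [ha]; positivity
  have hb0 : 0 < b := by rw [hbdef]; positivity
  have hab : a ≤ b := by
    rw [ha, hbdef]; exact pow_le_pow_of_le_one (by norm_num) (by norm_num) hmk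
  have hb36 : b ≤ 1 / 36 := by
    rw [hbdef]
    calc (1 / 6 : ℝ) ^ m ≤ (1 / 6) ^ 2 := pow_le_pow_of_le_one (by norm_num) (by norm_num) hm2
      _ = 1 / 36 := by norm_num
  rw [← hbdef] at hmd
  have hkm : (1 / 6 : ℝ) ^ (k + m) = a * b := by rw [pow_add, ha, hbdef]
  -- the ball `R` is mapped into one cylinder of level `k`; the net has scale `6 ^ -(k + m)`
  obtain ⟨R, hR⟩ : ∃ R : ℝ, R = a / (36 * L) := ⟨_, rfl⟩
  obtain ⟨r, hr⟩ : ∃ r : ℝ, r = 2 * L * (a * b) := ⟨_, rfl⟩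
  have hR0 : 0 < R := by rw [hR]; positivity
  have hr0 : 0 < r := by rw [hr]; positivity
  have hLR : L * R = a / 36 := by rw [hR]; field_simp
  have hRd : R ≤ Metric.diam A := by
    have : R ≤ a := by
      rw [hR]; exact div_le_self ha0.le (by linarith)
    nlinarith
  have hrd : r ≤ Metric.diam A := by
    have h1 : a * b ≤ 1 * b := by gcongr; linarith
    rw [hr]; nlinarith
  obtain ⟨t, htF, hsep, hcov⟩ := exists_finset_net
    (hAc.totallyBounded.subset (Set.inter_subset_right : Metric.closedBall x R ∩ A ⊆ A)) hr0
  have hcard : (t.card : ℝ) ≤ 3 ^ m := by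
    have h1 : t.card * (1 / prodN n (k + m) : ℝ) ≤
        μ.real (Metric.closedBall (f x) ((1 / 6) ^ (k + 1))) := by
      refine card_mul_le_measureReal μ t f (ρ := a * b) ?_ ?_ ?_
      · intro y hy z hz hyz
        have h2 := (hf y (htF hy).2 z (htF hz).2).1
        refine lt_of_lt_of_le ?_ h2
        rw [lt_div_iff₀ hL0]
        have := hsep y hy z hz hyz
        rw [hr] at this
        linarith
      · intro y hy
        refine Metric.closedBall_subset_closedBall' ?_
        have h2 := (hf y (htF hy).2 x hx).2
        have h3 : L * dist y x ≤ L * R := by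
          gcongr
          exact (htF hy).1
        have h4 : a * b ≤ a * (1 / 36) := by gcongr
        rw [pow_succ, ← ha]
        linarith
      · intro y hy
        rw [div_le_iff₀ (hP _)]
        exact h.lower (f y) (hmaps (htF hy).2) (k + m) _ hkm.le
    have h2 := h.upper (f x) (hmaps hx) k _ le_rfl
    have h3 : (prodN n (k + m) : ℝ) = 3 ^ m * prodN n k := by
      exact_mod_cast prodN_add_of_eq_three hk
    have h4 := (mul_le_mul_of_nonneg_right h1 (hP k).le).trans h2
    rw [h3] at h4
    have h5 : (t.card : ℝ) * (1 / (3 ^ m * prodN n k)) * prodN n k = t.card / 3 ^ m := by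
      have := (hP k).ne'
      field_simp
    rw [h5] at h4
    exact (div_le_one (by positivity)).1 h4
  have hmain : c⁻¹ * R ^ s ≤ 3 ^ m * (c * r ^ s) := by
    calc c⁻¹ * R ^ s ≤ ν.real (Metric.closedBall x R) := (hb x hx R hR0 hRd).1
      _ = ν.real (Metric.closedBall x R ∩ A) := by
          simp only [measureReal_def, measure_inter_conull hν]
      _ ≤ t.card * (c * r ^ s) := measureReal_le_card_mul ν t hcov fun y hy =>
          (hb y (htF hy).2 r hr0 hrd).2
      _ ≤ 3 ^ m * (c * r ^ s) := by gcongr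
  have hrR : r ^ s = (72 * L ^ 2) ^ s * b ^ s * R ^ s := by
    rw [← Real.mul_rpow (by positivity) hb0.le, ← Real.mul_rpow (by positivity) hR0.le, hr, hR]
    congr 1
    field_simp
    norm_num
  have hqm : q ^ m = 3 ^ m * b ^ s := by
    rw [hq, mul_pow, hbdef, Real.rpow_pow_comm (by norm_num)]
  have hRs : 0 < R ^ s := by positivity
  rw [hrR] at hmain
  have h6 : R ^ s ≤ (c ^ 2 * (72 * L ^ 2) ^ s * q ^ m) * R ^ s := by
    have h7 := mul_le_mul_of_nonneg_left hmain hc0.le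
    rw [← mul_assoc, mul_inv_cancel₀ hc0.ne', one_mul] at h7
    rw [hqm]
    linarith
  nlinarith

/-! ### The Moran set: digit sequences with prescribed branching in base `6` -/

lemma ofDigits_le_four_fifths {x : ℕ → Fin 6} (hx : ∀ k, (x k : ℕ) < 5) :
    Real.ofDigits x ≤ 4 / 5 := by
  have hsum : HasSum (fun i : ℕ => (4 / 6 : ℝ) * (1 / 6) ^ i) (4 / 5) := by
    have := (hasSum_geometric_of_lt_one (show (0 : ℝ) ≤ 1 / 6 by norm_num)
      (by norm_num)).mul_left (4 / 6 : ℝ)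
    norm_num at this ⊢
    exact this
  rw [← hsum.tsum_eq]
  refine Summable.tsum_le_tsum (fun i => ?_) Real.summable_ofDigitsTerm hsum.summable
  have h4 : ((x i : ℕ) : ℝ) ≤ 4 := by exact_mod_cast Nat.le_of_lt_succ (hx i)
  calc Real.ofDigitsTerm x i = ((x i : ℕ) : ℝ) * ((6 : ℝ) ^ (i + 1))⁻¹ := by
        simp [Real.ofDigitsTerm]
    _ ≤ 4 * ((6 : ℝ) ^ (i + 1))⁻¹ := by gcongr
    _ = _ := by rw [one_div, inv_pow, pow_succ, mul_inv]; ring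

lemma lt_abs_ofDigits_sub_ofDigits {x y : ℕ → Fin 6} (hx : ∀ k, (x k : ℕ) < 5)
    (hy : ∀ k, (y k : ℕ) < 5) {k : ℕ} (hxy : ∃ i < k, x i ≠ y i) :
    (1 / 6) ^ (k + 1) < |Real.ofDigits x - Real.ofDigits y| := by
  classical
  obtain ⟨j, ⟨hjk, hj⟩, hmin⟩ : ∃ j, (j < k ∧ x j ≠ y j) ∧ ∀ i < j, x i = y i := by
    refine ⟨Nat.find hxy, Nat.find_spec hxy, fun i hi => ?_⟩
    by_contra hne
    exact Nat.find_min hxy hi ⟨hi.trans (Nat.find_spec hxy).1, hne⟩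
  have hpre : ∑ i ∈ Finset.range j, Real.ofDigitsTerm x i =
      ∑ i ∈ Finset.range j, Real.ofDigitsTerm y i :=
    Finset.sum_congr rfl fun i hi => by
      simp [Real.ofDigitsTerm, hmin i (Finset.mem_range.1 hi)]
  obtain ⟨u, hu⟩ : ∃ u, u = Real.ofDigits fun i => x (i + (j + 1)) := ⟨_, rfl⟩
  obtain ⟨v, hv⟩ : ∃ v, v = Real.ofDigits fun i => y (i + (j + 1)) := ⟨_, rfl⟩
  have hu1 : u ≤ 4 / 5 := hu ▸ ofDigits_le_four_fifths fun i => hx _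
  have hv1 : v ≤ 4 / 5 := hv ▸ ofDigits_le_four_fifths fun i => hy _
  have hu0 : 0 ≤ u := hu ▸ Real.ofDigits_nonneg _
  have hv0 : 0 ≤ v := hv ▸ Real.ofDigits_nonneg _
  have hsub : Real.ofDigits x - Real.ofDigits y =
      ((6 : ℝ) ^ (j + 1))⁻¹ * ((((x j : ℕ) : ℝ) - (y j : ℕ)) + (u - v)) := by
    rw [Real.ofDigits_eq_sum_add_ofDigits x (j + 1), Real.ofDigits_eq_sum_add_ofDigits y (j + 1),
      Finset.sum_range_succ, Finset.sum_range_succ, hpre, ← hu, ← hv]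
    simp only [Real.ofDigitsTerm, Nat.cast_ofNat]
    ring
  have hge : 1 / 5 ≤ |(((x j : ℕ) : ℝ) - (y j : ℕ)) + (u - v)| := by
    rcases lt_or_gt_of_ne (fun h => hj (Fin.ext h) : (x j : ℕ) ≠ y j) with h | h
    · have : ((x j : ℕ) : ℝ) + 1 ≤ (y j : ℕ) := by exact_mod_cast h
      rw [le_abs]; right; linarith
    · have : ((y j : ℕ) : ℝ) + 1 ≤ (x j : ℕ) := by exact_mod_cast h
      rw [le_abs]; left; linarith
  rw [hsub, abs_mul, abs_of_pos (by positivity : (0 : ℝ) < ((6 : ℝ) ^ (j + 1))⁻¹)]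
  calc (1 / 6 : ℝ) ^ (k + 1) ≤ (1 / 6) ^ (j + 2) :=
        pow_le_pow_of_le_one (by norm_num) (by norm_num) (by omega)
    _ = ((6 : ℝ) ^ (j + 1))⁻¹ * (1 / 6) := by rw [one_div, inv_pow, pow_succ, mul_inv]
    _ < ((6 : ℝ) ^ (j + 1))⁻¹ * (1 / 5) := by gcongr; norm_num
    _ ≤ _ := by gcongr

open ProbabilityTheory in
lemma exists_hasCylinderBounds (n : ℕ → ℕ) (hn3 : ∀ k, 3 ≤ n k) (hn5 : ∀ k, n k ≤ 5) :
    ∃ (B : Set ℝ) (μ : Measure ℝ), HasCylinderBounds B μ n := by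
  classical
  let S : ℕ → Finset (Fin 6) := fun k => Finset.univ.filter fun d => (d : ℕ) < n k
  have hScard : ∀ k, (S k).card = n k := by
    intro k
    have h5 := hn5 k
    have h3 := hn3 k
    simp only [S]
    interval_cases n k <;> decide
  let p : ℕ → Measure (Fin 6) := fun k => uniformOn (S k : Set (Fin 6))
  have hp : ∀ k, IsProbabilityMeasure (p k) := fun k =>
    isProbabilityMeasure_uniformOn (S k).finite_toSet
      (by rw [Finset.coe_nonempty, ← Finset.card_pos, hScard]; have := hn3 k; omega)
  have hpS : ∀ k, p k (S k) = 1 := fun k =>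
    uniformOn_self (S k).finite_toSet
      (by rw [Finset.coe_nonempty, ← Finset.card_pos, hScard]; have := hn3 k; omega)
  have hp1 : ∀ k, ∀ d ∈ S k, p k {d} = (n k : ℝ≥0∞)⁻¹ := by
    intro k d hd
    have h1 := uniformOn_apply_finset (s := S k) (t := {d})
    rw [Finset.inter_singleton_of_mem hd, hScard] at h1
    simpa [p] using h1
  let K : Set (ℕ → Fin 6) := Set.univ.pi fun k => (S k : Set (Fin 6))
  let P : Measure (ℕ → Fin 6) := Measure.infinitePi p
  have hmem : ∀ {ω}, ω ∈ K ↔ ∀ k, (ω k : ℕ) < n k := by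
    intro ω
    simp [K, S]
  have hlt5 : ∀ {ω}, ω ∈ K → ∀ k, (ω k : ℕ) < 5 := fun hω k =>
    (hmem.1 hω k).trans_le (hn5 k)
  have hKc : IsCompact K := (isClosed_set_pi fun k _ => isClosed_discrete _).isCompact
  have hKP : P Kᶜ = 0 := by
    have hsub : Kᶜ ⊆ ⋃ k, {ω : ℕ → Fin 6 | ω k ∉ S k} := by
      intro ω hω
      by_contra hne
      simp only [Set.mem_iUnion, Set.mem_ofPred_eq, not_exists, not_not] at hne
      exact hω fun k _ => hne k
    refine measure_mono_null hsub (measure_iUnion_null fun k => ?_)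
    have h1 : {ω : ℕ → Fin 6 | ω k ∉ S k} = Set.pi ({k} : Finset ℕ) fun k => (S k : Set (Fin 6))ᶜ := by
      ext ω; simp
    rw [h1, Measure.infinitePi_pi _ fun i _ => (S i).measurableSet.compl]
    simp [prob_compl_eq_zero_iff (S k).measurableSet, hpS]
  let C : (ℕ → Fin 6) → ℕ → Set (ℕ → Fin 6) := fun ω k =>
    Set.pi (Finset.range k) fun i => {ω i}
  have hC : ∀ ω ∈ K, ∀ k, P (C ω k) = (prodN n k : ℝ≥0∞)⁻¹ := by
    intro ω hω k
    rw [Measure.infinitePi_pi _ fun i _ => measurableSet_singleton _,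
      Finset.prod_congr rfl fun i _ => hp1 i (ω i) (hω i trivial), prodN, Nat.cast_prod,
      ENNReal.prod_inv_distrib]
    intro i _ j _ _
    left
    have := hn3 i
    simp; omega
  have hCr : ∀ ω ∈ K, ∀ k, P.real (C ω k) * prodN n k = 1 := by
    intro ω hω k
    rw [measureReal_def, hC ω hω, ENNReal.toReal_inv, ENNReal.toReal_natCast]
    exact inv_mul_cancel₀ (by exact_mod_cast (prodN_pos hn3 k).ne')
  have hcont : Continuous (Real.ofDigits (b := 6)) := Real.continuous_ofDigits
  have hB : IsCompact (Real.ofDigits '' K) := hKc.image hcont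
  refine ⟨Real.ofDigits '' K, P.map Real.ofDigits, hB, ?_, ?_, ?_, ?_, ?_⟩
  · rintro _ ⟨ω, -, rfl⟩
    exact ⟨Real.ofDigits_nonneg _, Real.ofDigits_le_one _⟩
  · exact Measure.isProbabilityMeasure_map hcont.measurable.aemeasurable
  · rw [Measure.map_apply hcont.measurable hB.measurableSet.compl]
    exact measure_mono_null (fun ω hω hK => hω ⟨ω, hK, rfl⟩) hKP
  · rintro _ ⟨ω, hω, rfl⟩ k r hr
    rw [map_measureReal_apply hcont.measurable Metric.isClosed_closedBall.measurableSet,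
      ← hCr ω hω k]
    gcongr ?_ * _
    rw [measureReal_def, ← measure_inter_conull hKP, ← measureReal_def]
    refine measureReal_mono ?_
    rintro ω' ⟨hball, hω'⟩ i hi
    by_contra hne
    have h1 := lt_abs_ofDigits_sub_ofDigits (hlt5 hω') (hlt5 hω)
      ⟨i, by simpa using hi, by simpa using hne⟩
    have h2 : |Real.ofDigits ω' - Real.ofDigits ω| ≤ r := hball
    linarith
  · rintro _ ⟨ω, hω, rfl⟩ k r hr
    rw [map_measureReal_apply hcont.measurable Metric.isClosed_closedBall.measurableSet,
      ← hCr ω hω k]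
    gcongr ?_ * _
    refine measureReal_mono fun ω' hω' => ?_
    have h1 : |Real.ofDigits ω' - Real.ofDigits ω| ≤ (((6 : ℕ) : ℝ) ^ k)⁻¹ :=
      Real.abs_ofDigits_sub_ofDigits_le fun i hi => hω' i (by simpa using hi)
    refine h1.trans (le_trans (le_of_eq ?_) hr)
    simp

/-! ### A sparse branching sequence -/

open Classical in
/-- The branching sequence equal to `3` on the blocks `[m⁴, m⁴ + m)` and to `5` elsewhere. -/
def sparseBranching (k : ℕ) : ℕ := if ∃ m, m ^ 4 ≤ k ∧ k < m ^ 4 + m then 3 else 5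

lemma three_le_sparseBranching (k : ℕ) : 3 ≤ sparseBranching k := by
  unfold sparseBranching; split_ifs <;> norm_num

lemma sparseBranching_le_five (k : ℕ) : sparseBranching k ≤ 5 := by
  unfold sparseBranching; split_ifs <;> norm_num

lemma sparseBranching_block (m : ℕ) :
    ∃ k, m ≤ k ∧ ∀ j < m, sparseBranching (k + j) = 3 :=
  ⟨m ^ 4, Nat.le_self_pow (by norm_num) m, fun j hj => if_pos ⟨m, by omega, by omega⟩⟩

lemma card_filter_sparseBranching_sq_le (K : ℕ) :
    ((Finset.range K).filter fun i => sparseBranching i ≠ 5).card ^ 2 ≤ 4 * K := by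
  obtain ⟨q, hq⟩ : ∃ q, q = Nat.sqrt (Nat.sqrt K) := ⟨_, rfl⟩
  have hsub : ((Finset.range K).filter fun i => sparseBranching i ≠ 5) ⊆
      (Finset.range (q + 1)).biUnion fun m => Finset.Ico (m ^ 4) (m ^ 4 + m) := by
    intro i hi
    rw [Finset.mem_filter, Finset.mem_range] at hi
    obtain ⟨m, hm⟩ : ∃ m, m ^ 4 ≤ i ∧ i < m ^ 4 + m := by
      by_contra hne
      exact hi.2 (if_neg hne)
    refine Finset.mem_biUnion.2 ⟨m, ?_, Finset.mem_Ico.2 hm⟩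
    rw [Finset.mem_range, Nat.lt_succ_iff, hq, Nat.le_sqrt, Nat.le_sqrt]
    calc m * m * (m * m) = m ^ 4 := by ring
      _ ≤ K := by omega
  have hcard := (Finset.card_le_card hsub).trans (Finset.card_biUnion_le_card_mul _ _ q
    fun m hm => by
      rw [Nat.card_Ico, Nat.add_sub_cancel_left]
      exact Nat.lt_succ_iff.1 (Finset.mem_range.1 hm))
  rw [Finset.card_range] at hcard
  have h1 : q * q ≤ Nat.sqrt K := hq ▸ Nat.sqrt_le _
  have h2 : Nat.sqrt K * Nat.sqrt K ≤ K := Nat.sqrt_le _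
  have h3 : (q + 1) * q ≤ 2 * Nat.sqrt K := by nlinarith [Nat.le_mul_self q]
  calc _ ≤ (2 * Nat.sqrt K) ^ 2 := Nat.pow_le_pow_left (hcard.trans h3) 2
    _ = 4 * (Nat.sqrt K * Nat.sqrt K) := by ring
    _ ≤ 4 * K := by omega

lemma five_pow_le_prodN_sparseBranching (K : ℕ) :
    5 ^ K ≤ prodN sparseBranching K *
      2 ^ ((Finset.range K).filter fun i => sparseBranching i ≠ 5).card := by
  induction K with
  | zero => simp [prodN]
  | succ K ih =>
    rw [prodN_succ, Finset.range_add_one, Finset.filter_insert]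
    split_ifs with h5
    · rw [Finset.card_insert_of_notMem (by simp), pow_succ, pow_succ]
      calc 5 ^ K * 5 ≤ 5 ^ K * 3 * 2 := by omega
        _ ≤ _ := Nat.mul_le_mul_right 2 (Nat.mul_le_mul ih (three_le_sparseBranching K))
        _ = _ := by ring
    · rw [not_not.1 h5, pow_succ]
      linarith

lemma exists_le_prodN_sparseBranching {D s : ℝ} (hD : (6 : ℝ) ^ D = 5) (hs : s < D) :
    ∃ c : ℝ, 0 < c ∧ ∀ k, c ≤ prodN sparseBranching k * ((1 / 6 : ℝ) ^ k) ^ s := by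
  obtain ⟨ε, hε⟩ : ∃ ε : ℝ, ε = Real.log 6 * (D - s) := ⟨_, rfl⟩
  have hε0 : 0 < ε := hε ▸ mul_pos (Real.log_pos (by norm_num)) (by linarith)
  refine ⟨Real.exp (-(1 / ε)), Real.exp_pos _, fun k => ?_⟩
  obtain ⟨z, hz⟩ : ∃ z, z = ((Finset.range k).filter fun i => sparseBranching i ≠ 5).card :=
    ⟨_, rfl⟩
  have h1 : (5 : ℝ) ^ k ≤ prodN sparseBranching k * 2 ^ z := by
    rw [hz]; exact_mod_cast five_pow_le_prodN_sparseBranching k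
  have h2 : (z : ℝ) ^ 2 ≤ 4 * k := by
    rw [hz]; exact_mod_cast card_filter_sparseBranching_sq_le k
  have h3 : (z : ℝ) ≤ ε * k + 1 / ε := by
    have h4 : 0 ≤ (ε * z - 2) ^ 2 / (4 * ε) := by positivity
    have h5 : (ε * z - 2) ^ 2 / (4 * ε) = ε * z ^ 2 / 4 - z + 1 / ε := by field_simp; ring
    nlinarith
  have h6 : (2 : ℝ) ^ z ≤ Real.exp z := by
    rw [← mul_one (z : ℝ), Real.exp_nat_mul]
    gcongr
    linarith [Real.add_one_le_exp 1]
  have h7 : (5 : ℝ) ^ k * ((1 / 6 : ℝ) ^ k) ^ s = Real.exp (k * ε) := by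
    rw [← Real.rpow_pow_comm (by norm_num), ← mul_pow, ← hD, one_div, Real.inv_rpow (by norm_num),
      ← Real.rpow_neg (by norm_num), ← Real.rpow_add (by norm_num),
      Real.rpow_def_of_pos (by norm_num), Real.exp_nat_mul, hε, sub_eq_add_neg]
  have hpos : (0 : ℝ) < ((1 / 6 : ℝ) ^ k) ^ s := by positivity
  refine le_of_mul_le_mul_right ?_ (Real.exp_pos z)
  calc Real.exp (-(1 / ε)) * Real.exp z ≤ Real.exp (k * ε) := by
        rw [← Real.exp_add]
        exact Real.exp_le_exp.2 (by linarith)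
    _ = (5 : ℝ) ^ k * ((1 / 6 : ℝ) ^ k) ^ s := h7.symm
    _ ≤ (prodN sparseBranching k * Real.exp z) * ((1 / 6 : ℝ) ^ k) ^ s := by
        gcongr
        exact h1.trans (by gcongr)
    _ = _ := by ring

/-- There are a homogeneous set `B ⊆ [0,1]` (with `dim_H B = dim_P B = log 5/log 6`) and a
number `t = log 3/log 6 ∈ (0, dim_H B)` such that no Ahlfors–David regular set `A` with
`t < dim_H A < dim_H B` can be bilipschitz embedded into `B`. -/
theorem statement13 :
    ∃ (B : Set ℝ) (μ : Measure ℝ) (lam kappa del Del t : ℝ),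
      IsHomog B μ lam kappa del Del ∧
      B ⊆ Set.Icc (0 : ℝ) 1 ∧
      0 < t ∧ t = Real.log 3 / Real.log 6 ∧
      (dimH B).toReal = Real.log 5 / Real.log 6 ∧
      packDim B = Real.log 5 / Real.log 6 ∧
      t < (dimH B).toReal ∧
      ∀ (Y : Type*) [MetricSpace Y] [MeasurableSpace Y] [BorelSpace Y]
        (A : Set Y) (s : ℝ), 0 < s → IsADRegular A s →
        t < (dimH A).toReal → (dimH A).toReal < (dimH B).toReal →
        ¬ BilipEmbed A B := by
  have h6 : 0 < Real.log 6 := Real.log_pos (by norm_num)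
  have hD0 : 0 < Real.log 5 / Real.log 6 := div_pos (Real.log_pos (by norm_num)) h6
  have hD : (6 : ℝ) ^ (Real.log 5 / Real.log 6) = 5 := by
    rw [Real.rpow_def_of_pos (by norm_num), mul_div_cancel₀ _ h6.ne', Real.exp_log (by norm_num)]
  have hn3 := three_le_sparseBranching
  have hn5 := sparseBranching_le_five
  obtain ⟨B, μ, h⟩ := exists_hasCylinderBounds sparseBranching hn3 hn5
  have hdim : (dimH B).toReal = Real.log 5 / Real.log 6 := by
    rw [h.dimH_eq hn3 hn5 hD0 hD fun s => exists_le_prodN_sparseBranching hD,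
      ENNReal.toReal_ofReal hD0.le]
  refine ⟨B, μ, 25, (1 / 6) ^ 3, 9 / 5, 3125, Real.log 3 / Real.log 6, h.isHomog hn3 hn5,
    h.subset_Icc, div_pos (Real.log_pos (by norm_num)) h6, rfl, hdim,
    h.packDim_eq hn3 hn5 hD0 hD fun s => exists_le_prodN_sparseBranching hD, ?_, ?_⟩
  · rw [hdim]
    gcongr
    norm_num
  · intro Y _ _ _ A s hs hA hlt _
    exact h.not_bilipEmbed hn3 sparseBranching_block (hlt.trans_le (hA.dimH_toReal_le hs)) hA

end
end
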